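/- arXiv:1409.7329 — 17 statements merged into one kernel-verified Lean document; each statement's English description precedes it below -/
import Mathlib

section
/- (Lemma 3.1(i)) Let R, Rμ, η be positive reals and let (F, G) be a steady profile for (R, Rμ, η). Then the positivity sets intersect: {x ∈ ℝ : F(x) > 0} ∩ {x ∈ ℝ : G(x) > 0} ≠ ∅. -/
open MeasureTheory

/-- A pair `(F, G)` of continuous, nonnegative, integrable functions of unit mass is a
steady profile for the parameters `(R, Rμ, η)` if the function
`x ↦ η²(1+R)F(x) + R G(x) + x²/6` is constant on every connected component of
`{x | F x > 0}` and `x ↦ η² Rμ F(x) + Rμ G(x) + x²/6` is constant on every connected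
component of `{x | G x > 0}`. -/
def IsSteadyProfile (R Rμ η : ℝ) (F G : ℝ → ℝ) : Prop :=
  Continuous F ∧ Continuous G ∧
  (∀ x, 0 ≤ F x) ∧ (∀ x, 0 ≤ G x) ∧
  Integrable F ∧ Integrable G ∧
  (∫ x, F x) = 1 ∧ (∫ x, G x) = 1 ∧
  (∀ x, 0 < F x → ∀ y ∈ connectedComponentIn {z : ℝ | 0 < F z} x,
      η ^ 2 * (1 + R) * F y + R * G y + y ^ 2 / 6
        = η ^ 2 * (1 + R) * F x + R * G x + x ^ 2 / 6) ∧
  (∀ x, 0 < G x → ∀ y ∈ connectedComponentIn {z : ℝ | 0 < G z} x,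
      η ^ 2 * Rμ * F y + Rμ * G y + y ^ 2 / 6
        = η ^ 2 * Rμ * F x + Rμ * G x + x ^ 2 / 6)

theorem aux_pos_zero (H : ℝ → ℝ) (hc : Continuous H) (a : ℝ) (ha : 0 < a) (x : ℝ) (hx : 0 < H x)
    (he : ∀ y ∈ connectedComponentIn {z : ℝ | 0 < H z} x,
      a * H y + y ^ 2 / 6 = a * H x + x ^ 2 / 6) : 0 < H 0 := by
  by_contra h0
  have hc2 : Continuous (fun t : ℝ => H (t * x)) := by fun_prop
  let S : Set ℝ := Set.Icc 0 1 ∩ {t | H (t * x) ≤ 0}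
  have hS : IsCompact S := isCompact_Icc.inter_right (isClosed_le hc2 continuous_const)
  have hne : S.Nonempty := ⟨0, by simp, by simpa using h0⟩
  obtain ⟨p, ⟨⟨hp0, hp1⟩, hpH⟩, hmax⟩ := hS.exists_isGreatest hne
  have hpH' : H (p * x) ≤ 0 := hpH
  have hp1' : p < 1 := by
    rcases hp1.lt_or_eq with h | h
    · exact h
    · rw [h, one_mul] at hpH'; linarith
  have key : ∀ t ∈ Set.Ioc p 1, H x ≤ H (t * x) := by
    intro t ht
    have hsub : (fun s : ℝ => s * x) '' Set.Icc t 1 ⊆ {z : ℝ | 0 < H z} := by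
      rintro _ ⟨s, hs, rfl⟩
      by_contra hn
      have hn' : H (s * x) ≤ 0 := not_lt.mp hn
      have : s ≤ p := hmax ⟨⟨by linarith [hs.1, ht.1], hs.2⟩, hn'⟩
      linarith [hs.1, ht.1]
    have hpre : IsPreconnected ((fun s : ℝ => s * x) '' Set.Icc t 1) :=
      isPreconnected_Icc.image _ (by fun_prop)
    have hmem := hpre.subset_connectedComponentIn (x := x) ⟨1, ⟨ht.2, le_rfl⟩, one_mul x⟩ hsub
      ⟨t, ⟨le_rfl, ht.2⟩, rfl⟩
    have e := he _ hmem
    have ht0 : 0 ≤ t := by linarith [ht.1]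
    have ht2 : t ^ 2 ≤ 1 := by nlinarith [ht.2]
    have : (t * x) ^ 2 ≤ x ^ 2 := by
      rw [mul_pow]; nlinarith [sq_nonneg x]
    simp only at e
    exact le_of_mul_le_mul_left (by linarith) ha
  have hlim : Filter.Tendsto (fun t : ℝ => H (t * x)) (nhdsWithin p (Set.Ioi p))
      (nhds (H (p * x))) := (hc2.tendsto p).mono_left nhdsWithin_le_nhds
  have : H x ≤ H (p * x) := by
    refine ge_of_tendsto hlim ?_
    filter_upwards [Ioc_mem_nhdsGT hp1'] with t ht using key t ht
  linarith

theorem aux_exists (H : ℝ → ℝ) (h0 : ∀ x, 0 ≤ H x) (hi : (∫ x, H x) = 1) : ∃ x, 0 < H x := by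
  by_contra! hn
  have : H = fun _ => 0 := funext fun x => le_antisymm (hn x) (h0 x)
  rw [this] at hi
  simp at hi

/-- Lemma 3.1(i): the positivity sets of a steady profile intersect. -/
theorem steadyProfile_positivity_sets_intersect (R Rμ η : ℝ)
    (hR : 0 < R) (hRμ : 0 < Rμ) (hη : 0 < η)
    (F G : ℝ → ℝ) (h : IsSteadyProfile R Rμ η F G) :
    ({x : ℝ | 0 < F x} ∩ {x : ℝ | 0 < G x}).Nonempty := by
  obtain ⟨hF, hG, hF0, hG0, -, -, hFi, hGi, h1, h2⟩ := h
  by_contra hem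
  have hd : ∀ x, 0 < F x → 0 < G x → False := fun x hf hg => hem ⟨x, hf, hg⟩
  obtain ⟨x, hx⟩ := aux_exists F hF0 hFi
  obtain ⟨y, hy⟩ := aux_exists G hG0 hGi
  refine hd 0 (aux_pos_zero F hF (η ^ 2 * (1 + R)) (by positivity) x hx ?_)
    (aux_pos_zero G hG Rμ hRμ y hy ?_)
  · have hz : ∀ z, 0 < F z → G z = 0 := fun z hz =>
      le_antisymm (not_lt.mp fun hg => hd z hz hg) (hG0 z)
    intro z hzm
    have hzp : z ∈ {z : ℝ | 0 < F z} := connectedComponentIn_subset _ _ hzm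
    have e := h1 x hx z hzm
    rw [hz x hx, hz z hzp] at e
    linarith
  · have hz : ∀ z, 0 < G z → F z = 0 := fun z hz =>
      le_antisymm (not_lt.mp fun hf => hd z hf hz) (hF0 z)
    intro z hzm
    have hzp : z ∈ {z : ℝ | 0 < G z} := connectedComponentIn_subset _ _ hzm
    have e := h2 y hy z hzm
    rw [hz y hy, hz z hzp] at e
    linarith
end

section
/- (Lemma 3.1(ii)) Let R, Rμ, η be positive reals and let (F, G) be a steady profile for (R, Rμ, η). Then every connected component of the open set {x ∈ ℝ : F(x) > 0} and every connected component of the open set {x ∈ ℝ : G(x) > 0} is a bounded subset of ℝ. -/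
open MeasureTheory

/-- Lemma 3.1(ii): every connected component of each positivity set of a steady profile
is bounded. -/
theorem steadyProfile_components_bounded (R Rμ η : ℝ)
    (hR : 0 < R) (hRμ : 0 < Rμ) (hη : 0 < η)
    (F G : ℝ → ℝ) (h : IsSteadyProfile R Rμ η F G) :
    (∀ x, 0 < F x → Bornology.IsBounded (connectedComponentIn {z : ℝ | 0 < F z} x)) ∧
    (∀ x, 0 < G x → Bornology.IsBounded (connectedComponentIn {z : ℝ | 0 < G z} x)) := by
  obtain ⟨-, -, hF, hG, -, -, -, -, h1, h2⟩ := h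
  have key : ∀ (S : Set ℝ) (C : ℝ), (∀ y ∈ S, y ^ 2 / 6 ≤ C) → Bornology.IsBounded S := by
    intro S C hS
    refine (Metric.isBounded_Icc (-(6 * C + 1)) (6 * C + 1)).subset ?_
    intro y hy
    have := hS y hy
    constructor <;> nlinarith [sq_nonneg (y - 1), sq_nonneg (y + 1)]
  constructor
  · intro x hx
    refine key _ (η ^ 2 * (1 + R) * F x + R * G x + x ^ 2 / 6) fun y hy => ?_
    have e := h1 x hx y hy
    have a : 0 ≤ η ^ 2 * (1 + R) * F y := mul_nonneg (by positivity) (hF y)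
    have b : 0 ≤ R * G y := mul_nonneg hR.le (hG y)
    linarith
  · intro x hx
    refine key _ (η ^ 2 * Rμ * F x + Rμ * G x + x ^ 2 / 6) fun y hy => ?_
    have e := h2 x hx y hy
    have a : 0 ≤ η ^ 2 * Rμ * F y := mul_nonneg (by positivity) (hF y)
    have b : 0 ≤ Rμ * G y := mul_nonneg hRμ.le (hG y)
    linarith
end

section
/- (Lemma 3.1(iii)-(iv)) Let R, Rμ, η be positive reals and let (F, G) be a steady profile for (R, Rμ, η). If Rμ > R, then every connected component of {x ∈ ℝ : F(x) > 0} contains 0, and consequently {x : F(x) > 0} is order-connected (an interval). If Rμ < 1 + R, then every connected component of {x ∈ ℝ : G(x) > 0} contains 0, and consequently {x : G(x) > 0} is order-connected (an interval). -/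
open MeasureTheory

theorem sp_mono (α₁ β₁ α₂ β₂ : ℝ) (h1 : 0 < α₁) (h2 : 0 < β₁)
    (hd : 0 < α₁ * β₂ - α₂ * β₁) (hb : 0 < β₂ - β₁)
    (u v : ℝ → ℝ) (hu : Continuous u) (hv : Continuous v) (hv0 : ∀ x, 0 ≤ v x)
    (H1 : ∀ x y, x ≤ y → (∀ z ∈ Set.Icc x y, 0 < u z) →
      α₁ * u y + β₁ * v y + y ^ 2 / 6 = α₁ * u x + β₁ * v x + x ^ 2 / 6)
    (H2 : ∀ x y, x ≤ y → (∀ z ∈ Set.Icc x y, 0 < v z) →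
      α₂ * u y + β₂ * v y + y ^ 2 / 6 = α₂ * u x + β₂ * v x + x ^ 2 / 6)
    (x y : ℝ) (hx : 0 ≤ x) (hxy : x ≤ y) (hp : ∀ z ∈ Set.Icc x y, 0 < u z) :
    u y ≤ u x := by
  have both : ∀ w, x ≤ w → w ≤ y → (∀ z ∈ Set.Icc x w, 0 < v z) → u w ≤ u x := by
    intro w hw hwy hvp
    have e1 := H1 x w hw (fun z hz => hp z ⟨hz.1, hz.2.trans hwy⟩)
    have e2 := H2 x w hw hvp
    have hs : x ^ 2 ≤ w ^ 2 := by gcongr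
    have key : (α₁ * β₂ - α₂ * β₁) * (u w - u x) + (β₂ - β₁) * ((w ^ 2 - x ^ 2) / 6) = 0 := by
      linear_combination β₂ * e1 - β₁ * e2
    have : 0 ≤ (β₂ - β₁) * ((w ^ 2 - x ^ 2) / 6) := mul_nonneg hb.le (by linarith)
    by_contra hc
    push Not at hc
    have : 0 < (α₁ * β₂ - α₂ * β₁) * (u w - u x) := mul_pos hd (by linarith)
    linarith
  by_cases hvp : ∀ z ∈ Set.Icc x y, 0 < v z
  · exact both y hxy le_rfl hvp
  push Not at hvp
  obtain ⟨z0, hz0, hvz0⟩ := hvp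
  have hcomp : IsCompact (Set.Icc x y ∩ {z | v z ≤ 0}) :=
    isCompact_Icc.inter_right (isClosed_le hv continuous_const)
  obtain ⟨z, ⟨⟨hz, hvz⟩, hmin⟩⟩ := hcomp.exists_isLeast ⟨z0, hz0, hvz0⟩
  have hvz' : v z = 0 := le_antisymm hvz (hv0 z)
  have huz : u z ≤ u x := by
    rcases hz.1.eq_or_lt with h | h
    · rw [h]
    · have hcl : IsClosed {w | u w ≤ u x} := isClosed_le hu continuous_const
      have hsub : Set.Ico x z ⊆ {w | u w ≤ u x} := by
        intro w hw
        refine both w hw.1 (hw.2.le.trans hz.2) ?_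
        intro t ht
        by_contra hc
        have := hmin ⟨⟨ht.1, ht.2.trans (hw.2.le.trans hz.2)⟩, not_lt.mp hc⟩
        linarith [ht.2, hw.2]
      have := closure_minimal hsub hcl
      rw [closure_Ico h.ne] at this
      exact this ⟨h.le, le_rfl⟩
  have e1 := H1 z y hz.2 (fun t ht => hp t ⟨hz.1.trans ht.1, ht.2⟩)
  rw [hvz'] at e1
  have hs : z ^ 2 ≤ y ^ 2 := by
    have := hx.trans hz.1
    have := hz.2
    gcongr
  have := mul_nonneg h2.le (hv0 y)
  have : u y ≤ u z := by
    by_contra hc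
    push Not at hc
    have := mul_pos h1 (sub_pos.mpr hc)
    linarith
  linarith

theorem sp_pos (α₁ β₁ α₂ β₂ : ℝ) (h1 : 0 < α₁) (h2 : 0 < β₁)
    (hd : 0 < α₁ * β₂ - α₂ * β₁) (hb : 0 < β₂ - β₁)
    (u v : ℝ → ℝ) (hu : Continuous u) (hv : Continuous v) (hv0 : ∀ x, 0 ≤ v x)
    (H1 : ∀ x y, x ≤ y → (∀ z ∈ Set.Icc x y, 0 < u z) →
      α₁ * u y + β₁ * v y + y ^ 2 / 6 = α₁ * u x + β₁ * v x + x ^ 2 / 6)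
    (H2 : ∀ x y, x ≤ y → (∀ z ∈ Set.Icc x y, 0 < v z) →
      α₂ * u y + β₂ * v y + y ^ 2 / 6 = α₂ * u x + β₂ * v x + x ^ 2 / 6)
    (x : ℝ) (hux : 0 < u x) (z : ℝ) (hz : z ∈ Set.Icc 0 x) : 0 < u z := by
  by_contra hc
  have hcomp : IsCompact (Set.Icc 0 x ∩ {z | u z ≤ 0}) :=
    isCompact_Icc.inter_right (isClosed_le hu continuous_const)
  obtain ⟨a, ⟨⟨ha, hua⟩, hmax⟩⟩ := hcomp.exists_isGreatest ⟨z, hz, not_lt.mp hc⟩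
  have hua : u a ≤ 0 := hua
  have hax : a < x := lt_of_le_of_ne ha.2 (by rintro rfl; linarith)
  have hcl : IsClosed {w | u x ≤ u w} := isClosed_le continuous_const hu
  have hsub : Set.Ioc a x ⊆ {w | u x ≤ u w} := by
    intro w hw
    refine sp_mono α₁ β₁ α₂ β₂ h1 h2 hd hb u v hu hv hv0 H1 H2 w x (ha.1.trans hw.1.le) hw.2 ?_
    intro t ht
    by_contra hc
    have := hmax ⟨⟨ha.1.trans (hw.1.le.trans ht.1), ht.2⟩, not_lt.mp hc⟩
    linarith [ht.1, hw.1]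
  have := closure_minimal hsub hcl
  rw [closure_Ioc hax.ne] at this
  have : u x ≤ u a := this ⟨le_rfl, hax.le⟩
  linarith

theorem sp_final (α₁ β₁ α₂ β₂ : ℝ) (h1 : 0 < α₁) (h2 : 0 < β₁)
    (hd : 0 < α₁ * β₂ - α₂ * β₁) (hb : 0 < β₂ - β₁)
    (u v : ℝ → ℝ) (hu : Continuous u) (hv : Continuous v) (hv0 : ∀ x, 0 ≤ v x)
    (H1 : ∀ x, 0 < u x → ∀ y ∈ connectedComponentIn {z : ℝ | 0 < u z} x,
      α₁ * u y + β₁ * v y + y ^ 2 / 6 = α₁ * u x + β₁ * v x + x ^ 2 / 6)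
    (H2 : ∀ x, 0 < v x → ∀ y ∈ connectedComponentIn {z : ℝ | 0 < v z} x,
      α₂ * u y + β₂ * v y + y ^ 2 / 6 = α₂ * u x + β₂ * v x + x ^ 2 / 6) :
    (∀ x, 0 < u x → (0 : ℝ) ∈ connectedComponentIn {z : ℝ | 0 < u z} x) ∧
      Set.OrdConnected {x : ℝ | 0 < u x} := by
  have K : ∀ (f : ℝ → ℝ) (x y : ℝ), x ≤ y → (∀ z ∈ Set.Icc x y, 0 < f z) →
      ∀ s ∈ Set.Icc x y, ∀ t ∈ Set.Icc x y, t ∈ connectedComponentIn {z : ℝ | 0 < f z} s := by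
    intro f x y hxy hp s hs t ht
    exact isPreconnected_Icc.subset_connectedComponentIn hs (fun z hz => hp z hz) ht
  have P : ∀ x, 0 < u x → ∀ z ∈ Set.Icc 0 x, 0 < u z :=
    sp_pos α₁ β₁ α₂ β₂ h1 h2 hd hb u v hu hv hv0
      (fun x y hxy hp => H1 x (hp x ⟨le_rfl, hxy⟩) y
        (K u x y hxy hp x ⟨le_rfl, hxy⟩ y ⟨hxy, le_rfl⟩))
      (fun x y hxy hp => H2 x (hp x ⟨le_rfl, hxy⟩) y
        (K v x y hxy hp x ⟨le_rfl, hxy⟩ y ⟨hxy, le_rfl⟩))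
  have N : ∀ x, 0 < u (-x) → ∀ z ∈ Set.Icc 0 x, 0 < u (-z) := by
    have hn : ∀ (f : ℝ → ℝ) (x y : ℝ), (∀ z ∈ Set.Icc x y, 0 < f (-z)) →
        ∀ z ∈ Set.Icc (-y) (-x), 0 < f z := by
      intro f x y hp z hz
      have := hp (-z) ⟨by linarith [hz.2], by linarith [hz.1]⟩
      rwa [neg_neg] at this
    refine sp_pos α₁ β₁ α₂ β₂ h1 h2 hd hb (fun x => u (-x)) (fun x => v (-x))
      (by fun_prop) (by fun_prop) (fun x => hv0 _) ?_ ?_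
    · intro x y hxy hp
      have hxy' : -y ≤ -x := by linarith
      have := H1 (-x) (hp x ⟨le_rfl, hxy⟩) (-y)
        (K u (-y) (-x) hxy' (hn u x y hp) (-x) ⟨hxy', le_rfl⟩ (-y) ⟨le_rfl, hxy'⟩)
      simpa only [neg_sq] using this
    · intro x y hxy hp
      have hxy' : -y ≤ -x := by linarith
      have := H2 (-x) (hp x ⟨le_rfl, hxy⟩) (-y)
        (K v (-y) (-x) hxy' (hn v x y hp) (-x) ⟨hxy', le_rfl⟩ (-y) ⟨le_rfl, hxy'⟩)
      simpa only [neg_sq] using this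
  have N' : ∀ x, 0 < u x → ∀ z ∈ Set.Icc x 0, 0 < u z := by
    intro x hx z hz
    have := N (-x) (by rwa [neg_neg]) (-z) ⟨by linarith [hz.2], by linarith [hz.1]⟩
    rwa [neg_neg] at this
  refine ⟨?_, ⟨?_⟩⟩
  · intro x hx
    rcases le_total 0 x with h | h
    · exact K u 0 x h (P x hx) x ⟨h, le_rfl⟩ 0 ⟨le_rfl, h⟩
    · exact K u x 0 h (N' x hx) x ⟨le_rfl, h⟩ 0 ⟨h, le_rfl⟩
  · intro x hx y hy z hz
    rcases le_total 0 z with h | h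
    · exact P y hy z ⟨h, hz.2⟩
    · exact N' x hx z ⟨hz.1, h⟩

/-- Lemma 3.1(iii)-(iv): if `Rμ > R` every connected component of `{F > 0}` contains `0`
and `{F > 0}` is an interval; if `Rμ < 1 + R` the same holds for `{G > 0}`. -/
theorem steadyProfile_components_contain_zero (R Rμ η : ℝ)
    (hR : 0 < R) (hRμ : 0 < Rμ) (hη : 0 < η)
    (F G : ℝ → ℝ) (h : IsSteadyProfile R Rμ η F G) :
    (R < Rμ →
      (∀ x, 0 < F x → (0 : ℝ) ∈ connectedComponentIn {z : ℝ | 0 < F z} x) ∧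
      Set.OrdConnected {x : ℝ | 0 < F x}) ∧
    (Rμ < 1 + R →
      (∀ x, 0 < G x → (0 : ℝ) ∈ connectedComponentIn {z : ℝ | 0 < G z} x) ∧
      Set.OrdConnected {x : ℝ | 0 < G x}) := by
  obtain ⟨hF, hG, hF0, hG0, -, -, -, -, H1, H2⟩ := h
  have hη2 : 0 < η ^ 2 := by positivity
  constructor
  · intro hlt
    refine sp_final (η ^ 2 * (1 + R)) R (η ^ 2 * Rμ) Rμ (by positivity) hR ?_ (by linarith)
      F G hF hG hG0 H1 H2
    have : 0 < η ^ 2 * Rμ := by positivity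
    linarith
  · intro hlt
    refine sp_final Rμ (η ^ 2 * Rμ) R (η ^ 2 * (1 + R)) hRμ (by positivity) ?_ ?_
      G F hG hF hF0 ?_ ?_
    · have : 0 < η ^ 2 * Rμ := by positivity
      linarith
    · have := mul_pos hη2 (sub_pos.mpr hlt)
      linarith
    · intro x hx y hy
      linarith [H2 x hx y hy]
    · intro x hx y hy
      linarith [H1 x hx y hy]
end

section
/- (Lemma 3.1(v)) Let R, Rμ, η be positive reals and let (F, G) be a steady profile for (R, Rμ, η). If I is a connected component of {x ∈ ℝ : F(x) > 0} with 0 ∉ I, then I ∩ {x : G(x) > 0} ≠ ∅. Symmetrically, if J is a connected component of {x ∈ ℝ : G(x) > 0} with 0 ∉ J, then J ∩ {x : F(x) > 0} ≠ ∅. -/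
open MeasureTheory

lemma zero_mem_component_aux (a : ℝ) (ha : 0 < a) (f : ℝ → ℝ) (hf : Continuous f) (x : ℝ)
    (hx : 0 < f x)
    (hc : ∀ y ∈ connectedComponentIn {z : ℝ | 0 < f z} x,
      a * f y + y ^ 2 / 6 = a * f x + x ^ 2 / 6) :
    (0 : ℝ) ∈ connectedComponentIn {z : ℝ | 0 < f z} x := by
  set C := connectedComponentIn {z : ℝ | 0 < f z} x with hC
  have hxC : x ∈ C := mem_connectedComponentIn hx
  have hCo : IsOpen C := (isOpen_lt continuous_const hf).connectedComponentIn
  have hCpre : IsPreconnected C := isPreconnected_connectedComponentIn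
  have hCP : C ⊆ {z : ℝ | 0 < f z} := connectedComponentIn_subset _ _
  have hcl : ∀ y ∈ closure C, a * f y + y ^ 2 / 6 = a * f x + x ^ 2 / 6 := by
    intro y hy
    have hcls : IsClosed {y : ℝ | a * f y + y ^ 2 / 6 = a * f x + x ^ 2 / 6} :=
      isClosed_eq (by fun_prop) continuous_const
    exact closure_minimal (fun z hz => hc z hz) hcls hy
  have hD : closure C ∩ {z : ℝ | 0 < f z} ⊆ C :=
    (hCpre.subset_closure (t := closure C ∩ {z : ℝ | 0 < f z}) (fun z hz => ⟨subset_closure hz, hCP hz⟩)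
      Set.inter_subset_left).subset_connectedComponentIn ⟨subset_closure hxC, hx⟩
      Set.inter_subset_right
  have hK : Set.uIcc 0 x ⊆ C := by
    refine IsPreconnected.subset_left_of_subset_union hCo (isClosed_closure (s := C)).isOpen_compl
      (Set.disjoint_left.2 fun z hz hz2 => hz2 (subset_closure hz)) ?_
      ⟨x, Set.right_mem_uIcc, hxC⟩ isPreconnected_uIcc
    intro y hy
    by_cases hyc : y ∈ closure C
    · left
      refine hD ⟨hyc, ?_⟩
      have h1 := hcl y hyc
      have h2 : y ^ 2 ≤ x ^ 2 := by
        apply sq_le_sq.2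
        rcases Set.mem_uIcc.1 hy with ⟨h3, h4⟩ | ⟨h3, h4⟩
        · rw [abs_of_nonneg h3]; exact h4.trans (le_abs_self x)
        · rw [abs_of_nonpos h4]; exact (neg_le_neg h3).trans (neg_le_abs x)
      have h3 : 0 < a * f x := mul_pos ha hx
      have h4 : 0 < a * f y := by linarith
      exact (mul_pos_iff_of_pos_left ha).1 h4
    · right; exact hyc
  exact hK Set.left_mem_uIcc

/-- Lemma 3.1(v): a connected component of one positivity set that does not contain `0`
must meet the other positivity set. -/
theorem steadyProfile_component_meets_other (R Rμ η : ℝ)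
    (hR : 0 < R) (hRμ : 0 < Rμ) (hη : 0 < η)
    (F G : ℝ → ℝ) (h : IsSteadyProfile R Rμ η F G) :
    (∀ x, 0 < F x → (0 : ℝ) ∉ connectedComponentIn {z : ℝ | 0 < F z} x →
      (connectedComponentIn {z : ℝ | 0 < F z} x ∩ {z : ℝ | 0 < G z}).Nonempty) ∧
    (∀ x, 0 < G x → (0 : ℝ) ∉ connectedComponentIn {z : ℝ | 0 < G z} x →
      (connectedComponentIn {z : ℝ | 0 < G z} x ∩ {z : ℝ | 0 < F z}).Nonempty) := by
  obtain ⟨hF, hG, hF0, hG0, -, -, -, -, h1, h2⟩ := h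
  constructor
  · intro x hx h0
    by_contra hne
    have hz : ∀ y ∈ connectedComponentIn {z : ℝ | 0 < F z} x, G y = 0 := fun y hy =>
      le_antisymm (not_lt.1 fun hlt => hne ⟨y, hy, hlt⟩) (hG0 y)
    refine h0 (zero_mem_component_aux (η ^ 2 * (1 + R)) (by positivity) F hF x hx ?_)
    intro y hy
    have h3 := h1 x hx y hy
    rw [hz y hy, hz x (mem_connectedComponentIn hx)] at h3
    linarith
  · intro x hx h0
    by_contra hne
    have hz : ∀ y ∈ connectedComponentIn {z : ℝ | 0 < G z} x, F y = 0 := fun y hy =>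
      le_antisymm (not_lt.1 fun hlt => hne ⟨y, hy, hlt⟩) (hF0 y)
    refine h0 (zero_mem_component_aux Rμ hRμ G hG x hx ?_)
    intro y hy
    have h3 := h2 x hx y hy
    rw [hz y hy, hz x (mem_connectedComponentIn hx)] at h3
    linarith
end

section
/- (Lemma 3.2, invariance properties) Let R, Rμ, η be positive reals and let (F, G) be a steady profile for (R, Rμ, η). Then: (i) the reflected pair (x ↦ F(−x), x ↦ G(−x)) is also a steady profile for (R, Rμ, η); (ii) setting Rμ₁ := R(1+R)/Rμ, η₁ := (1/η)·√(R/(1+R)), λ := (η²Rμ/R)^{1/3}, F₁(x) := λ·G(λx) and G₁(x) := λ·F(λx), the pair (F₁, G₁) is a steady profile for the parameters (R, Rμ₁, η₁). -/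
open MeasureTheory

theorem cc_map_aux (f : ℝ → ℝ) (hf : Continuous f) (S T : Set ℝ) (hST : ∀ z ∈ T, f z ∈ S)
    (x y : ℝ) (hx : x ∈ T) (hy : y ∈ connectedComponentIn T x) :
    f y ∈ connectedComponentIn S (f x) := by
  have h1 : IsPreconnected (f '' connectedComponentIn T x) :=
    isPreconnected_connectedComponentIn.image f hf.continuousOn
  have h2 : f x ∈ f '' connectedComponentIn T x := ⟨x, mem_connectedComponentIn hx, rfl⟩
  refine h1.subset_connectedComponentIn h2 ?_ ⟨y, hy, rfl⟩
  rintro _ ⟨z, hz, rfl⟩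
  exact hST z (connectedComponentIn_subset T x hz)

theorem scaling_aux (R Rμ η l e : ℝ) (hR : 0 < R) (hRμ : 0 < Rμ) (hη : 0 < η) (hl : 0 < l)
    (hl3 : l ^ 3 = η ^ 2 * Rμ / R) (he : e ^ 2 = R / ((1 + R) * η ^ 2))
    (F G : ℝ → ℝ) (h : IsSteadyProfile R Rμ η F G) :
    IsSteadyProfile R (R * (1 + R) / Rμ) e (fun x => l * G (l * x)) (fun x => l * F (l * x)) := by
  obtain ⟨cF, cG, pF, pG, iF, iG, mF, mG, eF, eG⟩ := h
  have hl3' : l ^ 3 * R = η ^ 2 * Rμ := by rw [hl3]; field_simp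
  have hpos : ∀ t : ℝ, 0 < l * t ↔ 0 < t := fun t => mul_pos_iff_of_pos_left hl
  have hc : Continuous (fun x : ℝ => l * x) := by fun_prop
  have mass : ∀ H : ℝ → ℝ, (∫ x, H x) = 1 → (∫ x, l * H (l * x)) = 1 := by
    intro H hH
    rw [integral_const_mul, Measure.integral_comp_mul_left, hH, abs_of_pos (inv_pos.mpr hl)]
    simp [hl.ne']
  refine ⟨by fun_prop, by fun_prop, fun x => mul_nonneg hl.le (pG _),
    fun x => mul_nonneg hl.le (pF _), (iG.comp_mul_left' hl.ne').const_mul l,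
    (iF.comp_mul_left' hl.ne').const_mul l, mass G mG, mass F mF, ?_, ?_⟩
  · intro x hx y hy
    have hm := cc_map_aux (fun x => l * x) hc {z | 0 < G z} {z | 0 < l * G (l * z)}
      (fun z hz => (hpos _).1 hz) x y hx hy
    have E := eG (l * x) ((hpos _).1 hx) (l * y) hm
    simp only at E ⊢
    have a : e ^ 2 * (1 + R) * l = Rμ / l ^ 2 := by
      rw [he]; field_simp; linear_combination hl3'
    have b : R * l = η ^ 2 * Rμ / l ^ 2 := by
      field_simp; linear_combination hl3'
    have key : ∀ t : ℝ, e ^ 2 * (1 + R) * (l * G (l * t)) + R * (l * F (l * t)) + t ^ 2 / 6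
        = (η ^ 2 * Rμ * F (l * t) + Rμ * G (l * t) + (l * t) ^ 2 / 6) / l ^ 2 := by
      intro t
      rw [← mul_assoc, ← mul_assoc R, a, b]; field_simp; ring
    rw [key, key, E]
  · intro x hx y hy
    have hm := cc_map_aux (fun x => l * x) hc {z | 0 < F z} {z | 0 < l * F (l * z)}
      (fun z hz => (hpos _).1 hz) x y hx hy
    have E := eF (l * x) ((hpos _).1 hx) (l * y) hm
    simp only at E ⊢
    have a : e ^ 2 * (R * (1 + R) / Rμ) * l = R / l ^ 2 := by
      rw [he]; field_simp; linear_combination hl3'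
    have b : R * (1 + R) / Rμ * l = η ^ 2 * (1 + R) / l ^ 2 := by
      field_simp; linear_combination hl3'
    have key : ∀ t : ℝ, e ^ 2 * (R * (1 + R) / Rμ) * (l * G (l * t))
          + R * (1 + R) / Rμ * (l * F (l * t)) + t ^ 2 / 6
        = (η ^ 2 * (1 + R) * F (l * t) + R * G (l * t) + (l * t) ^ 2 / 6) / l ^ 2 := by
      intro t
      rw [← mul_assoc, ← mul_assoc (R * (1 + R) / Rμ), a, b]; field_simp; ring
    rw [key, key, E]

/-- Lemma 3.2: invariance of the steady-profile equations under reflection and under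
the scaling transformation `Rμ₁ = R(1+R)/Rμ`, `η₁ = (1/η)√(R/(1+R))`,
`λ = (η²Rμ/R)^{1/3}`, `F₁(x) = λ G(λx)`, `G₁(x) = λ F(λx)`. -/
theorem steadyProfile_invariance (R Rμ η : ℝ)
    (hR : 0 < R) (hRμ : 0 < Rμ) (hη : 0 < η)
    (F G : ℝ → ℝ) (h : IsSteadyProfile R Rμ η F G) :
    IsSteadyProfile R Rμ η (fun x => F (-x)) (fun x => G (-x)) ∧
    IsSteadyProfile R (R * (1 + R) / Rμ) (1 / η * Real.sqrt (R / (1 + R)))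
      (fun x => (η ^ 2 * Rμ / R) ^ ((1 : ℝ) / 3) * G ((η ^ 2 * Rμ / R) ^ ((1 : ℝ) / 3) * x))
      (fun x => (η ^ 2 * Rμ / R) ^ ((1 : ℝ) / 3) * F ((η ^ 2 * Rμ / R) ^ ((1 : ℝ) / 3) * x)) := by
  constructor
  · obtain ⟨cF, cG, pF, pG, iF, iG, mF, mG, eF, eG⟩ := h
    refine ⟨by fun_prop, by fun_prop, fun x => pF _, fun x => pG _, iF.comp_neg, iG.comp_neg,
      by rw [integral_neg_eq_self F volume, mF], by rw [integral_neg_eq_self G volume, mG], ?_, ?_⟩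
    · intro x hx y hy
      have E := eF (-x) hx (-y) (cc_map_aux (fun x => -x) continuous_neg {z | 0 < F z}
        {z | 0 < F (-z)} (fun z hz => hz) x y hx hy)
      simpa only [neg_sq] using E
    · intro x hx y hy
      have E := eG (-x) hx (-y) (cc_map_aux (fun x => -x) continuous_neg {z | 0 < G z}
        {z | 0 < G (-z)} (fun z hz => hz) x y hx hy)
      simpa only [neg_sq] using E
  · have hp : 0 < η ^ 2 * Rμ / R := by positivity
    refine scaling_aux R Rμ η _ _ hR hRμ hη (Real.rpow_pos_of_pos hp _) ?_ ?_ F G h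
    · rw [← Real.rpow_natCast, ← Real.rpow_mul hp.le]; norm_num
    · rw [mul_pow, Real.sq_sqrt (by positivity)]; field_simp
end

section
/- (Proposition 3.3, classification of even self-similar profiles — existence and uniqueness) For all positive reals R, Rμ, η there exists exactly one steady profile (F, G) for (R, Rμ, η) such that both F and G are even, i.e. F(−x) = F(x) and G(−x) = G(x) for all x ∈ ℝ. -/
open MeasureTheory

open Filter Topology Set

namespace Muskat

lemma right_local {f : ℝ → ℝ} (hf : Continuous f) {x y : ℝ} (hxy : x ≤ y)
    (h : ∀ z, x ≤ z → z < y → f x < f z → ∀ᶠ w in 𝓝[>] z, f w ≤ f z) : f y ≤ f x := by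
  by_contra hlt
  push Not at hlt
  obtain ⟨m, hm1, hm2⟩ := exists_between hlt
  let S : Set ℝ := Icc x y ∩ {t | f t ≤ m}
  have hSc : IsClosed S := isClosed_Icc.inter (isClosed_le hf continuous_const)
  have hSn : S.Nonempty := ⟨x, ⟨le_refl _, hxy⟩, hm1.le⟩
  have hSb : BddAbove S := ⟨y, fun t ht => ht.1.2⟩
  have hz := hSc.csSup_mem hSn hSb
  set z := sSup S with hzdef
  obtain ⟨⟨hz1, hz2⟩, hz3⟩ := hz
  have hz3 : f z ≤ m := hz3
  have hzy : z < y := lt_of_le_of_ne hz2 (by rintro h; rw [h] at hz3; linarith)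
  have hgt : ∀ w, z < w → w ≤ y → m < f w := by
    intro w hw1 hw2
    by_contra hc
    push Not at hc
    have : w ≤ z := le_csSup hSb ⟨⟨by linarith, hw2⟩, hc⟩
    linarith
  have hzm : m ≤ f z := by
    have hcl : z ∈ closure (Ioc z y) := by rw [closure_Ioc hzy.ne]; exact ⟨le_refl _, hz2⟩
    have hsub : Ioc z y ⊆ {w | m ≤ f w} := fun w hw => (hgt w hw.1 hw.2).le
    exact closure_minimal hsub (isClosed_le continuous_const hf) hcl
  have h1 := h z hz1 hzy (by linarith)
  have h2 : ∀ᶠ w in 𝓝[>] z, w ∈ Ioc z y := Ioc_mem_nhdsGT hzy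
  obtain ⟨w, hw1, hw2⟩ := (h1.and h2).exists
  have := hgt w hw2.1 hw2.2
  linarith

lemma loc_const {v P : ℝ → ℝ} (hv : Continuous v)
    (H : ∀ x y, x ≤ y → (∀ t ∈ Icc x y, 0 < v t) → P x = P y) (z : ℝ) (hz : 0 < v z) :
    ∀ᶠ w in 𝓝[>] z, P w = P z := by
  have h : ∀ᶠ t in 𝓝 z, 0 < v t := hv.continuousAt.eventually (lt_mem_nhds hz)
  obtain ⟨e, he, hb⟩ := Metric.eventually_nhds_iff.1 h
  filter_upwards [Ioo_mem_nhdsGT (show z < z + e by linarith)] with w hw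
  refine (H z w hw.1.le ?_).symm
  intro t ht
  apply hb
  rw [Real.dist_eq, abs_lt]
  constructor <;> linarith [ht.1, ht.2, hw.2]

lemma gt_ev (z : ℝ) : ∀ᶠ w in 𝓝[>] z, z < w := self_mem_nhdsWithin

/-- cancel -/
lemma solve_le {A B C k l a b p q s : ℝ} (hD : B ^ 2 < A * C)
    (h1 : A * a + B * b = A * p + B * q - k * s)
    (h2 : B * a + C * b = B * p + C * q - l * s) (hs : 0 ≤ (C * k - B * l) * s) : a ≤ p := by
  have : (A * C - B ^ 2) * (a - p) = - ((C * k - B * l) * s) := by linear_combination C * h1 - B * h2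
  by_contra hc
  push Not at hc
  nlinarith [mul_pos (sub_pos.2 hD) (sub_pos.2 hc)]

def Loc (A B k : ℝ) (u v : ℝ → ℝ) : Prop :=
  ∀ x y, x ≤ y → (∀ t ∈ Icc x y, 0 < u t) →
    A * u x + B * v x + k * x ^ 2 = A * u y + B * v y + k * y ^ 2

lemma core {A B C k l : ℝ} (hA : 0 < A) (hB : 0 < B) (hC : 0 < C) (hk : 0 < k)
    (hD : B ^ 2 < A * C) (h : B * l ≤ C * k) {u v : ℝ → ℝ}
    (hu : Continuous u) (hv : Continuous v) (u0 : ∀ x, 0 ≤ u x) (v0 : ∀ x, 0 ≤ v x)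
    (Hu : Loc A B k u v) (Hv : Loc C B l v u) :
    (∀ x y, 0 ≤ x → x ≤ y → u y ≤ u x) ∧
    (∀ x, 0 ≤ x → A * u 0 + B * v 0 + k * 0 ^ 2 ≤ A * u x + B * v x + k * x ^ 2) ∧
    (∀ x, 0 ≤ x → 0 < u x → A * u x + B * v x + k * x ^ 2 = A * u 0 + B * v 0 + k * 0 ^ 2) := by
  have h1 : ∀ x y, 0 ≤ x → x ≤ y → u y ≤ u x := by
    intro x y hx hxy
    apply right_local hu hxy
    intro z hxz _ hz
    have huz : 0 < u z := lt_of_le_of_lt (u0 x) hz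
    have e1 := loc_const (P := fun x => A * u x + B * v x + k * x ^ 2) hu Hu z huz
    rcases (v0 z).eq_or_lt with hvz | hvz
    · filter_upwards [e1, gt_ev z] with w hw hzw
      have : z ^ 2 ≤ w ^ 2 := by nlinarith
      have h3 := v0 w
      have : A * u w ≤ A * u z := by
        rw [← hvz] at hw
        nlinarith [mul_nonneg hB.le h3, mul_le_mul_of_nonneg_left this hk.le]
      exact le_of_mul_le_mul_left this hA
    · have e2 := loc_const (P := fun x => C * v x + B * u x + l * x ^ 2) hv Hv z hvz
      filter_upwards [e1, e2, gt_ev z] with w hw1 hw2 hzw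
      have : z ^ 2 ≤ w ^ 2 := by nlinarith
      exact solve_le (A := A) (B := B) (C := C) (k := k) (l := l) (b := v w) (q := v z)
        (s := w ^ 2 - z ^ 2) hD
        (by linarith) (by linarith) (mul_nonneg (by linarith) (by linarith))
  refine ⟨h1, ?_, ?_⟩
  · intro x hx
    have := right_local (f := fun x => -(A * u x + B * v x + k * x ^ 2)) (by fun_prop) hx ?_
    · linarith
    intro z hz _ _
    rcases (u0 z).eq_or_lt with huz | huz
    · rcases (v0 z).eq_or_lt with hvz | hvz
      · filter_upwards [gt_ev z] with w hzw
        have : z ^ 2 ≤ w ^ 2 := by nlinarith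
        rw [← huz, ← hvz]
        nlinarith [mul_nonneg hB.le (v0 w), mul_nonneg hA.le (u0 w),
          mul_le_mul_of_nonneg_left this hk.le]
      · have e2 := loc_const (P := fun x => C * v x + B * u x + l * x ^ 2) hv Hv z hvz
        filter_upwards [e2, gt_ev z] with w hw hzw
        have : z ^ 2 ≤ w ^ 2 := by nlinarith
        rw [← huz] at hw ⊢
        have key : C * (A * 0 + B * v z + k * z ^ 2) ≤ C * (A * u w + B * v w + k * w ^ 2) := by
          have e : C * (A * u w + B * v w + k * w ^ 2) - C * (A * 0 + B * v z + k * z ^ 2)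
              = (A * C - B ^ 2) * u w + (C * k - B * l) * (w ^ 2 - z ^ 2) := by
            linear_combination B * hw
          have p1 := mul_nonneg (sub_pos.2 hD).le (u0 w)
          have p2 := mul_nonneg (sub_nonneg.2 h) (sub_nonneg.2 this)
          linarith
        linarith [le_of_mul_le_mul_left key hC]
    · have e1 := loc_const (P := fun x => A * u x + B * v x + k * x ^ 2) hu Hu z huz
      filter_upwards [e1] with w hw
      exact (neg_le_neg hw.ge)
  · intro x hx hux
    refine (Hu 0 x hx ?_).symm
    intro t ht
    exact lt_of_lt_of_le hux (h1 t x ht.1 ht.2)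

def KKT (A B k c : ℝ) (u v : ℝ → ℝ) : Prop :=
  ∀ x, c ≤ A * u x + B * v x + k * x ^ 2 ∧ (0 < u x → A * u x + B * v x + k * x ^ 2 = c)

lemma kkt_even {A B k c : ℝ} {u v : ℝ → ℝ} (eu : ∀ x, u (-x) = u x) (ev : ∀ x, v (-x) = v x)
    (h : ∀ x, 0 ≤ x → c ≤ A * u x + B * v x + k * x ^ 2 ∧
      (0 < u x → A * u x + B * v x + k * x ^ 2 = c)) : KKT A B k c u v := by
  intro x
  rcases le_total 0 x with hx | hx
  · exact h x hx
  · have := h (-x) (by linarith)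
    rwa [eu, ev, neg_sq] at this

lemma kkt_exists_aux {A B C k l : ℝ} (hA : 0 < A) (hB : 0 < B) (hC : 0 < C) (hk : 0 < k)
    (hl : 0 < l) (hD : B ^ 2 < A * C) (h : B * l ≤ C * k) {u v : ℝ → ℝ}
    (hu : Continuous u) (hv : Continuous v) (u0 : ∀ x, 0 ≤ u x) (v0 : ∀ x, 0 ≤ v x)
    (eu : ∀ x, u (-x) = u x) (ev : ∀ x, v (-x) = v x)
    (Hu : Loc A B k u v) (Hv : Loc C B l v u) :
    ∃ c d, KKT A B k c u v ∧ KKT C B l d v u := by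
  obtain ⟨h1, h2, h3⟩ := core hA hB hC hk hD h hu hv u0 v0 Hu Hv
  set c := A * u 0 + B * v 0 + k * 0 ^ 2 with hc
  have K1 : KKT A B k c u v := kkt_even eu ev fun x hx => ⟨h2 x hx, h3 x hx⟩
  rcases le_or_gt (B * k) (A * l) with h' | h'
  · obtain ⟨g1, g2, g3⟩ := core hC hB hA hl (by linarith) h' hv hu v0 u0 Hv Hu
    exact ⟨c, _, K1, kkt_even ev eu fun x hx => ⟨g2 x hx, g3 x hx⟩⟩
  -- the annular case
  let S : Set ℝ := Ici 0 ∩ {t | u t = 0}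
  have hSc : IsClosed S := isClosed_Ici.inter (isClosed_eq hu continuous_const)
  have c0 : 0 ≤ c := by
    have := mul_nonneg hA.le (u0 0)
    have := mul_nonneg hB.le (v0 0)
    rw [hc]; linarith
  have hSn : S.Nonempty := by
    refine ⟨c / k + 1, ?_, ?_⟩
    · have : 0 ≤ c / k := by positivity
      simp only [mem_Ici]; linarith
    · have p : 0 ≤ c / k := by positivity
      by_contra hne
      have hpos : 0 < u (c / k + 1) := lt_of_le_of_ne (u0 _) (Ne.symm hne)
      have := h3 _ (by linarith) hpos
      have e : k * (c / k + 1) ^ 2 = c * (c / k) + 2 * c + k := by field_simp; ring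
      have := mul_nonneg hA.le (u0 (c / k + 1))
      have := mul_nonneg hB.le (v0 (c / k + 1))
      have := mul_nonneg c0 p
      linarith
  have hSb : BddBelow S := ⟨0, fun t ht => ht.1⟩
  have hr := hSc.csInf_mem hSn hSb
  set r := sInf S with hrdef
  obtain ⟨hr0, hur⟩ := hr
  have hr0 : 0 ≤ r := hr0
  have hur : u r = 0 := hur
  have hlt : ∀ t, 0 ≤ t → t < r → 0 < u t := by
    intro t ht htr
    refine lt_of_le_of_ne (u0 t) fun hh => ?_
    have : r ≤ t := csInf_le hSb ⟨ht, hh.symm⟩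
    linarith
  have hge : ∀ t, r ≤ t → u t = 0 := fun t ht =>
    le_antisymm (by rw [← hur]; exact h1 r t hr0 ht) (u0 t)
  have hPhi : ∀ t, 0 ≤ t → t ≤ r → A * u t + B * v t + k * t ^ 2 = c := by
    intro t ht htr
    rcases htr.lt_or_eq with hh | hh
    · exact h3 t ht (hlt t ht hh)
    · rcases ht.eq_or_lt with h0 | h0
      · rw [← h0]
      · have hcl : t ∈ closure (Ico 0 t) := by
          rw [closure_Ico h0.ne]; exact ⟨ht, le_refl _⟩
        have hsub : Ico 0 t ⊆ {w | A * u w + B * v w + k * w ^ 2 = c} := fun w hw =>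
          h3 w hw.1 (hlt w hw.1 (by linarith [hw.2]))
        exact closure_minimal hsub (isClosed_eq (by fun_prop) continuous_const) hcl
  have hPhi' : ∀ t, -r ≤ t → t ≤ 0 → A * u t + B * v t + k * t ^ 2 = c := by
    intro t ht htr
    have := hPhi (-t) (by linarith) (by linarith)
    rwa [eu, ev, neg_sq] at this
  set d := C * v r + B * u r + l * r ^ 2 with hd
  have hd' : d = C * v (-r) + B * u (-r) + l * (-r) ^ 2 := by rw [eu, ev, neg_sq]
  -- outer part
  have o1 : ∀ x y, r ≤ x → x ≤ y → v y ≤ v x := by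
    intro x y hx hxy
    apply right_local hv hxy
    intro z hxz _ hz
    have hvz : 0 < v z := lt_of_le_of_lt (v0 x) hz
    have e2 := loc_const (P := fun x => C * v x + B * u x + l * x ^ 2) hv Hv z hvz
    filter_upwards [e2, gt_ev z] with w hw hzw
    rw [hge z (by linarith), hge w (by linarith)] at hw
    have : z ^ 2 ≤ w ^ 2 := by nlinarith
    have : C * v w ≤ C * v z := by
      have := mul_le_mul_of_nonneg_left this hl.le
      linarith
    exact le_of_mul_le_mul_left this hC
  have o2 : ∀ x, r ≤ x → d ≤ C * v x + B * u x + l * x ^ 2 := by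
    intro x hx
    have := right_local (f := fun x => -(C * v x + B * u x + l * x ^ 2)) (by fun_prop) hx ?_
    · linarith
    intro z hz _ _
    rcases (v0 z).eq_or_lt with hvz | hvz
    · filter_upwards [gt_ev z] with w hzw
      have : z ^ 2 ≤ w ^ 2 := by nlinarith
      rw [← hvz, hge z hz]
      nlinarith [mul_nonneg hB.le (u0 w), mul_nonneg hC.le (v0 w),
          mul_le_mul_of_nonneg_left this hl.le]
    · have e2 := loc_const (P := fun x => C * v x + B * u x + l * x ^ 2) hv Hv z hvz
      filter_upwards [e2] with w hw
      exact (neg_le_neg hw.ge)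
  have o3 : ∀ x, r ≤ x → 0 < v x → C * v x + B * u x + l * x ^ 2 = d := by
    intro x hx hvx
    exact (Hv r x hx fun t ht => lt_of_lt_of_le hvx (o1 t x ht.1 ht.2)).symm
  -- inner part
  have i1 : ∀ x y, -r ≤ x → x ≤ y → y ≤ 0 → v y ≤ v x := by
    intro x y hx hxy hy
    apply right_local hv hxy
    intro z hxz hzy hz
    have hvz : 0 < v z := lt_of_le_of_lt (v0 x) hz
    have e2 := loc_const (P := fun x => C * v x + B * u x + l * x ^ 2) hv Hv z hvz
    filter_upwards [e2, gt_ev z, Ioc_mem_nhdsGT hzy] with w hw hzw hwy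
    have f1 := hPhi' z (by linarith) (by linarith)
    have f2 := hPhi' w (by linarith) (by linarith [hwy.2])
    have : w ^ 2 ≤ z ^ 2 := by nlinarith [hwy.2]
    exact solve_le (A := C) (B := B) (C := A) (k := l) (l := k) (b := u w) (q := u z)
        (s := w ^ 2 - z ^ 2) (by linarith)
        (by linarith) (by linarith) (mul_nonneg_of_nonpos_of_nonpos (by linarith) (by linarith))
  have i2 : ∀ x, -r ≤ x → x ≤ 0 → d ≤ C * v x + B * u x + l * x ^ 2 := by
    intro x hx hx0
    rw [hd']
    have := right_local (f := fun x => -(C * v x + B * u x + l * x ^ 2)) (by fun_prop) hx ?_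
    · linarith
    intro z hz hzx _
    rcases (v0 z).eq_or_lt with hvz | hvz
    · filter_upwards [gt_ev z, Ioc_mem_nhdsGT hzx] with w hzw hwx
      have f1 := hPhi' z (by linarith) (by linarith)
      have f2 := hPhi' w (by linarith) (by linarith [hwx.2])
      have : w ^ 2 ≤ z ^ 2 := by nlinarith [hwx.2]
      rw [← hvz] at f1 ⊢
      have key : A * (C * 0 + B * u z + l * z ^ 2) ≤ A * (C * v w + B * u w + l * w ^ 2) := by
        have e : A * (C * v w + B * u w + l * w ^ 2) - A * (C * 0 + B * u z + l * z ^ 2)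
            = (A * C - B ^ 2) * v w + (B * k - A * l) * (z ^ 2 - w ^ 2) := by
          linear_combination B * f2 - B * f1
        have p1 := mul_nonneg (sub_pos.2 hD).le (v0 w)
        have p2 := mul_nonneg (sub_nonneg.2 h'.le) (sub_nonneg.2 this)
        linarith
      linarith [le_of_mul_le_mul_left key hA]
    · have e2 := loc_const (P := fun x => C * v x + B * u x + l * x ^ 2) hv Hv z hvz
      filter_upwards [e2] with w hw
      exact (neg_le_neg hw.ge)
  have i3 : ∀ x, -r ≤ x → x ≤ 0 → 0 < v x → C * v x + B * u x + l * x ^ 2 = d := by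
    intro x hx hx0 hvx
    rw [hd']
    exact (Hv (-r) x hx fun t ht => lt_of_lt_of_le hvx (i1 t x ht.1 ht.2 hx0)).symm
  refine ⟨c, d, K1, kkt_even ev eu fun x hx => ?_⟩
  rcases le_total r x with hh | hh
  · exact ⟨o2 x hh, o3 x hh⟩
  · have a1 := i2 (-x) (by linarith) (by linarith)
    have a2 := i3 (-x) (by linarith) (by linarith)
    rw [eu, ev, neg_sq] at a1 a2
    exact ⟨a1, a2⟩

lemma kkt_exists {A B C k l : ℝ} (hA : 0 < A) (hB : 0 < B) (hC : 0 < C) (hk : 0 < k)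
    (hl : 0 < l) (hD : B ^ 2 < A * C) {u v : ℝ → ℝ}
    (hu : Continuous u) (hv : Continuous v) (u0 : ∀ x, 0 ≤ u x) (v0 : ∀ x, 0 ≤ v x)
    (eu : ∀ x, u (-x) = u x) (ev : ∀ x, v (-x) = v x)
    (Hu : Loc A B k u v) (Hv : Loc C B l v u) :
    ∃ c d, KKT A B k c u v ∧ KKT C B l d v u := by
  rcases le_or_gt (B * l) (C * k) with h | h
  · exact kkt_exists_aux hA hB hC hk hl hD h hu hv u0 v0 eu ev Hu Hv
  · have h' : B * k ≤ A * l := by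
      by_contra hc
      push Not at hc
      have := mul_lt_mul'' h hc (by positivity) (by positivity)
      have : (A * C) * (k * l) < B ^ 2 * (k * l) := by linarith
      have := lt_of_mul_lt_mul_right this (by positivity)
      linarith
    obtain ⟨d, c, a, b⟩ :=
      kkt_exists_aux hC hB hA hl hk (by linarith) h' hv hu v0 u0 ev eu Hv Hu
    exact ⟨c, d, b, a⟩

lemma kkt_unique {A B C k l : ℝ} (hA : 0 < A) (hD : B ^ 2 < A * C)
    {u v u' v' : ℝ → ℝ} {c d c' d' : ℝ}
    (hu : Continuous u) (hv : Continuous v) (hu' : Continuous u') (hv' : Continuous v')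
    (u0 : ∀ x, 0 ≤ u x) (v0 : ∀ x, 0 ≤ v x) (u0' : ∀ x, 0 ≤ u' x) (v0' : ∀ x, 0 ≤ v' x)
    (iu : Integrable u) (iv : Integrable v) (iu' : Integrable u') (iv' : Integrable v')
    (Iu : ∫ x, u x = ∫ x, u' x) (Iv : ∫ x, v x = ∫ x, v' x)
    (K1 : KKT A B k c u v) (K2 : KKT C B l d v u)
    (K1' : KKT A B k c' u' v') (K2' : KKT C B l d' v' u') : u = u' ∧ v = v' := by
  have aux : ∀ P P' c c' s s' : ℝ, 0 ≤ s → 0 ≤ s' → c ≤ P → c' ≤ P' → (0 < s → P = c) →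
      (0 < s' → P' = c') → (P - P') * (s - s') ≤ (c - c') * (s - s') := by
    intro P P' c c' s s' hs hs' h h' e e'
    have e1 : (P - c) * s = 0 := by
      rcases hs.eq_or_lt with a | a
      · rw [← a, mul_zero]
      · rw [e a, sub_self, zero_mul]
    have e2 : (P' - c') * s' = 0 := by
      rcases hs'.eq_or_lt with a | a
      · rw [← a, mul_zero]
      · rw [e' a, sub_self, zero_mul]
    have p1 := mul_nonneg (sub_nonneg.2 h) hs'
    have p2 := mul_nonneg (sub_nonneg.2 h') hs
    nlinarith
  let g : ℝ → ℝ := fun x => (c - c') * (u x - u' x) + (d - d') * (v x - v' x)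
  have hQ : ∀ x, A * (u x - u' x) ^ 2 + 2 * B * (u x - u' x) * (v x - v' x)
      + C * (v x - v' x) ^ 2 ≤ g x := by
    intro x
    have a1 := aux _ _ c c' (u x) (u' x) (u0 x) (u0' x) (K1 x).1 (K1' x).1 (K1 x).2 (K1' x).2
    have a2 := aux _ _ d d' (v x) (v' x) (v0 x) (v0' x) (K2 x).1 (K2' x).1 (K2 x).2 (K2' x).2
    simp only [g]
    nlinarith
  have hsq : ∀ a b : ℝ, A * (A * a ^ 2 + 2 * B * a * b + C * b ^ 2)
      = (A * a + B * b) ^ 2 + (A * C - B ^ 2) * b ^ 2 := by intros; ring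
  have hg0 : ∀ x, 0 ≤ g x := by
    intro x
    refine le_trans ?_ (hQ x)
    have := hsq (u x - u' x) (v x - v' x)
    have p : 0 ≤ (A * (u x - u' x) + B * (v x - v' x)) ^ 2
      + (A * C - B ^ 2) * (v x - v' x) ^ 2 := by
        have := (sub_pos.2 hD).le
        positivity
    rw [← this] at p
    exact nonneg_of_mul_nonneg_right p hA
  have hgi : Integrable g := ((iu.sub iu').const_mul _).add ((iv.sub iv').const_mul _)
  have hgI : ∫ x, g x = 0 := by
    simp only [g]
    have j1 : Integrable (fun x => (c - c') * (u x - u' x)) := (iu.sub iu').const_mul _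
    have j2 : Integrable (fun x => (d - d') * (v x - v' x)) := (iv.sub iv').const_mul _
    rw [integral_add j1 j2,
      integral_const_mul, integral_const_mul, integral_sub iu iu', integral_sub iv iv', Iu, Iv]
    ring
  have hgz : g =ᵐ[volume] 0 := (integral_eq_zero_iff_of_nonneg hg0 hgi).1 hgI
  have hgc : Continuous g := by fun_prop
  have hg : g = 0 := (hgc.ae_eq_iff_eq volume continuous_zero).1 hgz
  have key : ∀ x, u x = u' x ∧ v x = v' x := by
    intro x
    have q := hQ x
    rw [hg, Pi.zero_apply] at q
    have e := hsq (u x - u' x) (v x - v' x)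
    have q2 := mul_le_mul_of_nonneg_left q hA.le
    rw [e, mul_zero] at q2
    have p1 := sq_nonneg (A * (u x - u' x) + B * (v x - v' x))
    have p2 := mul_nonneg (sub_pos.2 hD).le (sq_nonneg (v x - v' x))
    have z1 : (A * C - B ^ 2) * (v x - v' x) ^ 2 = 0 := by linarith
    have z2 : v x - v' x = 0 := by
      rcases mul_eq_zero.1 z1 with h | h
      · exact absurd h (sub_pos.2 hD).ne'
      · exact pow_eq_zero_iff two_ne_zero |>.1 h
    have z3 : A * (u x - u' x) + B * (v x - v' x) = 0 := by
      apply pow_eq_zero_iff two_ne_zero |>.1; linarith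
    rw [z2, mul_zero, add_zero] at z3
    rcases mul_eq_zero.1 z3 with h | h
    · exact absurd h hA.ne'
    · exact ⟨sub_eq_zero.1 h, sub_eq_zero.1 z2⟩
  exact ⟨funext fun x => (key x).1, funext fun x => (key x).2⟩

/-! existence -/

noncomputable def sol (A B C a b : ℝ) : ℝ := max 0 (min (a / A) ((C * a - B * b) / (A * C - B ^ 2)))

lemma sol_nonneg (A B C a b : ℝ) : 0 ≤ sol A B C a b := le_max_left _ _

lemma sol_lcp {A B C : ℝ} (hA : 0 < A) (hB : 0 < B) (hC : 0 < C) (hD : B ^ 2 < A * C) (a b : ℝ) :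
    a ≤ A * sol A B C a b + B * sol C B A b a ∧
    (0 < sol A B C a b → A * sol A B C a b + B * sol C B A b a = a) := by
  have hD' : 0 < A * C - B ^ 2 := sub_pos.2 hD
  have e : C * A - B ^ 2 = A * C - B ^ 2 := by ring
  unfold sol
  rw [e]
  set D := A * C - B ^ 2 with hDdef
  have s1 : a / A ≤ (C * a - B * b) / D ↔ A * b ≤ B * a := by
    rw [div_le_div_iff₀ hA hD']
    constructor
    · intro h
      have : B * (A * b) ≤ B * (B * a) := by rw [hDdef] at h; nlinarith
      exact le_of_mul_le_mul_left this hB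
    · intro h
      have := mul_le_mul_of_nonneg_left h hB.le
      rw [hDdef]; nlinarith
  have s2 : b / C ≤ (A * b - B * a) / D ↔ C * a ≤ B * b := by
    rw [div_le_div_iff₀ hC hD']
    constructor
    · intro h
      have : B * (C * a) ≤ B * (B * b) := by rw [hDdef] at h; nlinarith
      exact le_of_mul_le_mul_left this hB
    · intro h
      have := mul_le_mul_of_nonneg_left h hB.le
      rw [hDdef]; nlinarith
  rcases le_or_gt (A * b) (B * a) with h1 | h1
  · -- v = 0
    rw [min_eq_left (s1.2 h1)]
    have v0 : max 0 (min (b / C) ((A * b - B * a) / D)) = 0 :=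
      max_eq_left (le_trans (min_le_right _ _)
        (div_nonpos_of_nonpos_of_nonneg (by linarith) hD'.le))
    rw [v0]
    have ea : A * (a / A) = a := by field_simp
    constructor
    · have := mul_le_mul_of_nonneg_left (le_max_right 0 (a / A)) hA.le
      linarith
    · intro h
      have : 0 < a / A := by
        rcases lt_max_iff.1 h with h | h
        · exact absurd h (lt_irrefl _)
        · exact h
      rw [max_eq_right this.le, ea]; ring
  · have m1 : min (a / A) ((C * a - B * b) / D) = (C * a - B * b) / D :=
      min_eq_right (le_of_not_ge fun h => absurd (s1.1 h) (not_le.2 h1))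
    rw [m1]
    rcases le_or_gt (C * a) (B * b) with h2 | h2
    · -- u = 0
      have u0 : max 0 ((C * a - B * b) / D) = 0 :=
        max_eq_left (div_nonpos_of_nonpos_of_nonneg (by linarith) hD'.le)
      rw [u0, min_eq_left (s2.2 h2)]
      refine ⟨?_, fun h => absurd h (lt_irrefl _)⟩
      have := mul_le_mul_of_nonneg_left (le_max_right 0 (b / C)) hB.le
      have h3 : a ≤ B * (b / C) := by
        rw [mul_div_assoc', le_div_iff₀ hC]; linarith
      linarith
    · have m2 : min (b / C) ((A * b - B * a) / D) = (A * b - B * a) / D :=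
        min_eq_right (le_of_not_ge fun h => absurd (s2.1 h) (not_le.2 h2))
      rw [m2, max_eq_right (div_nonneg (by linarith) hD'.le),
        max_eq_right (div_nonneg (by linarith) hD'.le)]
      have : A * ((C * a - B * b) / D) + B * ((A * b - B * a) / D) = a := by
        rw [mul_div_assoc', mul_div_assoc', ← add_div, div_eq_iff hD'.ne', hDdef]; ring
      exact ⟨this.ge, fun _ => this⟩

lemma sol_zero {A B C a b : ℝ} (hA : 0 < A) (ha : a ≤ 0) : sol A B C a b = 0 :=
  max_eq_left (le_trans (min_le_left _ _) (div_nonpos_of_nonpos_of_nonneg ha hA.le))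

lemma sol_cont (A B C : ℝ) : Continuous fun p : ℝ × ℝ => sol A B C p.1 p.2 := by
  unfold sol; fun_prop

noncomputable def prof (A B C k l c d : ℝ) (x : ℝ) : ℝ :=
  sol A B C (c - k * x ^ 2) (d - l * x ^ 2)

lemma prof_cont (A B C k l : ℝ) :
    Continuous fun p : (ℝ × ℝ) × ℝ => prof A B C k l p.1.1 p.1.2 p.2 := by
  unfold prof
  exact (sol_cont A B C).comp
    (f := fun p : (ℝ × ℝ) × ℝ => (p.1.1 - k * p.2 ^ 2, p.1.2 - l * p.2 ^ 2)) (by fun_prop)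

lemma prof_cont' (A B C k l c d : ℝ) : Continuous (prof A B C k l c d) :=
  (prof_cont A B C k l).comp (f := fun x => ((c, d), x)) (by fun_prop)

lemma prof_supp {A k : ℝ} (B C l : ℝ) (hA : 0 < A) (hk : 0 < k) {c : ℝ} (d m : ℝ) (hc : c ≤ m)
    (hm : 0 ≤ m)
    (x : ℝ) (hx : x ∉ Icc (-(m / k + 1)) (m / k + 1)) : prof A B C k l c d x = 0 := by
  apply sol_zero hA
  have p : 0 ≤ m / k := by positivity
  have h1 : (m / k + 1) ^ 2 ≤ x ^ 2 := by
    rw [sq_le_sq, abs_of_nonneg (by linarith : 0 ≤ m / k + 1)]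
    by_contra hlt
    push Not at hlt
    exact hx ⟨by linarith [neg_abs_le x], by linarith [le_abs_self x]⟩
  have e : k * (m / k + 1) ^ 2 = m * (m / k) + 2 * m + k := by field_simp; ring
  have := mul_le_mul_of_nonneg_left h1 hk.le
  have := mul_nonneg hm p
  linarith

lemma prof_int {A k : ℝ} (B C l c d : ℝ) (hA : 0 < A) (hk : 0 < k) :
    Integrable (prof A B C k l c d) := by
  apply (prof_cont' A B C k l c d).integrable_of_hasCompactSupport
  exact HasCompactSupport.intro isCompact_Icc
    (fun x hx => prof_supp B C l hA hk d (max c 0) (le_max_left _ _) (le_max_right _ _) x hx)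

lemma prof_mass_cont {A k : ℝ} (B C l : ℝ) (hA : 0 < A) (hk : 0 < k) (c d : ℝ → ℝ)
    (hc : Continuous c) (hd : Continuous d) (hc1 : ∀ t, c t ≤ 1) :
    Continuous fun t => ∫ x, prof A B C k l (c t) (d t) x := by
  have : ∀ t, ∫ x, prof A B C k l (c t) (d t) x
      = ∫ x in Icc (-(1 / k + 1)) (1 / k + 1), prof A B C k l (c t) (d t) x := by
    intro t
    symm
    apply setIntegral_eq_integral_of_forall_compl_eq_zero
    intro x hx
    exact prof_supp B C l hA hk _ 1 (hc1 t) zero_le_one x hx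
  simp_rw [this]
  apply continuous_parametric_integral_of_continuous _ isCompact_Icc
  exact (prof_cont A B C k l).comp (f := fun p : ℝ × ℝ => ((c p.1, d p.1), p.2)) (by fun_prop)

lemma prof_mass_nonneg (A B C k l c d : ℝ) : 0 ≤ ∫ x, prof A B C k l c d x :=
  integral_nonneg fun _ => sol_nonneg _ _ _ _ _

lemma prof_mass_pos {A k : ℝ} (B C l c d : ℝ) (hA : 0 < A) (hk : 0 < k)
    (h : 0 < sol A B C c d) : 0 < ∫ x, prof A B C k l c d x := by
  refine integral_pos_of_integrable_nonneg_nonzero (x := 0) (prof_cont' A B C k l c d)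
    (prof_int B C l c d hA hk) (fun _ => sol_nonneg _ _ _ _ _) ?_
  simp only [prof]
  simpa using h.ne'

lemma sol_scale {A B C s : ℝ} (hs : 0 ≤ s) (a b : ℝ) :
    sol A B C (s * a) (s * b) = s * sol A B C a b := by
  unfold sol
  rw [mul_max_of_nonneg _ _ hs, mul_min_of_nonneg _ _ hs, mul_zero]
  congr 2 <;> ring

lemma prof_scale {s : ℝ} (A B C k l c d : ℝ) (hs : 0 < s) :
    ∫ x, prof A B C k l (s ^ 2 * c) (s ^ 2 * d) x = s ^ 3 * ∫ x, prof A B C k l c d x := by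
  have e : ∀ x, prof A B C k l (s ^ 2 * c) (s ^ 2 * d) x
      = s ^ 2 * prof A B C k l c d (x / s) := by
    intro x
    unfold prof
    rw [← sol_scale (by positivity)]
    congr 1 <;> field_simp
  simp_rw [e]
  rw [integral_const_mul, Measure.integral_comp_div, abs_of_pos hs, smul_eq_mul]
  ring

lemma exists_prof {A B C k l M N : ℝ} (hA : 0 < A) (hB : 0 < B) (hC : 0 < C) (hk : 0 < k)
    (hl : 0 < l) (hD : B ^ 2 < A * C) (hM : 0 < M) (hN : 0 < N) :
    ∃ c d, ∫ x, prof A B C k l c d x = M ∧ ∫ x, prof C B A l k d c x = N := by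
  have hD2 : B ^ 2 < C * A := by linarith
  have hpos : ∀ c d : ℝ, (0 < c ∨ 0 < d) → 0 < sol A B C c d ∨ 0 < sol C B A d c := by
    intro c d h
    by_contra hcon
    push Not at hcon
    have z1 := le_antisymm hcon.1 (sol_nonneg _ _ _ _ _)
    have z2 := le_antisymm hcon.2 (sol_nonneg _ _ _ _ _)
    have a1 := (sol_lcp hA hB hC hD c d).1
    have a2 := (sol_lcp hC hB hA hD2 d c).1
    rw [z1, z2] at a1 a2
    rcases h with h | h <;> linarith
  let U : ℝ → ℝ := fun t => ∫ x, prof A B C k l (min t 1) (min (1 - t) 1) x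
  let V : ℝ → ℝ := fun t => ∫ x, prof C B A l k (min (1 - t) 1) (min t 1) x
  have hU : Continuous U := prof_mass_cont B C l hA hk _ _ (by fun_prop) (by fun_prop)
    (fun t => min_le_right _ _)
  have hV : Continuous V := prof_mass_cont B A k hC hl _ _ (by fun_prop) (by fun_prop)
    (fun t => min_le_right _ _)
  have U0 : U 0 = 0 := by
    have : ∀ x, prof A B C k l (min 0 1) (min (1 - 0) 1) x = 0 := fun x =>
      sol_zero hA (by have : 0 ≤ k * x ^ 2 := by positivity
                      simp; linarith)
    simp only [U, this, integral_zero]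
  have V1 : V 1 = 0 := by
    have : ∀ x, prof C B A l k (min (1 - 1) 1) (min 1 1) x = 0 := fun x =>
      sol_zero hC (by have : 0 ≤ l * x ^ 2 := by positivity
                      simp; linarith)
    simp only [V, this, integral_zero]
  have hV0 : 0 ≤ V 0 := prof_mass_nonneg _ _ _ _ _ _ _
  have hU1 : 0 ≤ U 1 := prof_mass_nonneg _ _ _ _ _ _ _
  have hcont : Continuous fun t => N * U t - M * V t := by fun_prop
  have : (0 : ℝ) ∈ (fun t => N * U t - M * V t) '' Icc 0 1 := by
    apply intermediate_value_Icc zero_le_one hcont.continuousOn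
    simp only [U0, V1]
    constructor
    · have := mul_nonneg hM.le hV0; linarith
    · have := mul_nonneg hN.le hU1; linarith
  obtain ⟨t, ht, he⟩ := this
  have he : N * U t = M * V t := sub_eq_zero.1 he
  have hsome : 0 < U t ∨ 0 < V t := by
    have : 0 < min t 1 ∨ 0 < min (1 - t) 1 := by
      rcases le_or_gt t 0 with h | h
      · right; exact lt_min (by linarith) one_pos
      · left; exact lt_min h one_pos
    rcases hpos _ _ this with h | h
    · left; exact prof_mass_pos _ _ _ _ _ hA hk h
    · right; exact prof_mass_pos _ _ _ _ _ hC hl h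
  have hUt : 0 < U t := by
    rcases hsome with h | h
    · exact h
    · have : 0 < N * U t := by rw [he]; positivity
      exact pos_of_mul_pos_right this hN.le
  set s : ℝ := (M / U t) ^ ((1 : ℝ) / 3) with hs
  have hs0 : 0 < s := by positivity
  have hs3 : s ^ 3 = M / U t := by
    rw [hs, ← Real.rpow_natCast, ← Real.rpow_mul (by positivity)]; norm_num
  refine ⟨s ^ 2 * min t 1, s ^ 2 * min (1 - t) 1, ?_, ?_⟩
  · rw [prof_scale _ _ _ _ _ _ _ hs0, hs3]
    exact div_mul_cancel₀ M hUt.ne'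
  · rw [prof_scale _ _ _ _ _ _ _ hs0, hs3]
    change M / U t * V t = N
    rw [div_mul_eq_mul_div, ← he, mul_div_cancel_right₀ _ hUt.ne']

lemma prof_kkt {A B C k l : ℝ} (hA : 0 < A) (hB : 0 < B) (hC : 0 < C) (hD : B ^ 2 < A * C)
    (c d : ℝ) : KKT A B k c (prof A B C k l c d) (prof C B A l k d c) := by
  intro x
  have := sol_lcp hA hB hC hD (c - k * x ^ 2) (d - l * x ^ 2)
  unfold prof
  exact ⟨by linarith [this.1], fun h => by linarith [this.2 h]⟩

lemma prof_even (A B C k l c d x : ℝ) : prof A B C k l c d (-x) = prof A B C k l c d x := by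
  unfold prof; rw [neg_sq]

lemma loc_of_comp {w P : ℝ → ℝ}
    (h : ∀ x, 0 < w x → ∀ y ∈ connectedComponentIn {z : ℝ | 0 < w z} x, P y = P x) :
    ∀ x y, x ≤ y → (∀ t ∈ Icc x y, 0 < w t) → P x = P y := by
  intro x y hxy ht
  have hsub : Icc x y ⊆ connectedComponentIn {z : ℝ | 0 < w z} x :=
    isPreconnected_Icc.subset_connectedComponentIn (left_mem_Icc.2 hxy) ht
  exact (h x (ht x (left_mem_Icc.2 hxy)) y (hsub (right_mem_Icc.2 hxy))).symm

lemma steady_kkt {R Rm η : ℝ} (hR : 0 < R) (hRm : 0 < Rm) (hη : 0 < η) {F G : ℝ → ℝ}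
    (h : IsSteadyProfile R Rm η F G) (eF : ∀ x, F (-x) = F x) (eG : ∀ x, G (-x) = G x) :
    ∃ c d, KKT (1 + R) R (1 / 6) c (fun x => η ^ 2 * F x) G ∧
      KKT R R (R / (6 * Rm)) d G (fun x => η ^ 2 * F x) := by
  obtain ⟨cF, cG, F0, G0, iF, iG, IF, IG, HF, HG⟩ := h
  have hη2 : 0 < η ^ 2 := by positivity
  refine kkt_exists (by linarith) hR hR (by norm_num) (by positivity) (by nlinarith)
    (by fun_prop) cG (fun x => mul_nonneg hη2.le (F0 x)) G0 (fun x => by simp only [eF]) eG ?_ ?_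
  · intro x y hxy ht
    have := loc_of_comp (P := fun y => η ^ 2 * (1 + R) * F y + R * G y + y ^ 2 / 6) HF x y hxy
      (fun t h => pos_of_mul_pos_right (ht t h) hη2.le)
    linarith
  · intro x y hxy ht
    have := loc_of_comp (P := fun y => η ^ 2 * Rm * F y + Rm * G y + y ^ 2 / 6) HG x y hxy ht
    have e : ∀ y, R * G y + R * (η ^ 2 * F y) + R / (6 * Rm) * y ^ 2
        = R / Rm * (η ^ 2 * Rm * F y + Rm * G y + y ^ 2 / 6) := by
      intro y; field_simp; ring
    rw [e, e, this]

end Muskat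

open Muskat

/-- Proposition 3.3 (existence and uniqueness part): for all positive parameters there
is exactly one even steady profile. -/
theorem even_steadyProfile_existsUnique (R Rμ η : ℝ)
    (hR : 0 < R) (hRμ : 0 < Rμ) (hη : 0 < η) :
    ∃! p : (ℝ → ℝ) × (ℝ → ℝ),
      IsSteadyProfile R Rμ η p.1 p.2 ∧
      (∀ x, p.1 (-x) = p.1 x) ∧ (∀ x, p.2 (-x) = p.2 x) := by
  have hη2 : 0 < η ^ 2 := by positivity
  have hA : 0 < 1 + R := by linarith
  have hD : R ^ 2 < (1 + R) * R := by nlinarith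
  have hD2 : R ^ 2 < R * (1 + R) := by nlinarith
  have hl : 0 < R / (6 * Rμ) := by positivity
  have hk : (0 : ℝ) < 1 / 6 := by norm_num
  apply existsUnique_of_exists_of_unique
  · obtain ⟨c, d, Iu, Iv⟩ := exists_prof hA hR hR hk hl hD hη2 one_pos
    have K1 := prof_kkt (k := 1 / 6) (l := R / (6 * Rμ)) hA hR hR hD c d
    have K2 := prof_kkt (k := R / (6 * Rμ)) (l := 1 / 6) hR hR hA hD2 d c
    have cu := prof_cont' (1 + R) R R (1 / 6) (R / (6 * Rμ)) c d
    have cv := prof_cont' R R (1 + R) (R / (6 * Rμ)) (1 / 6) d c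
    have iu := prof_int R R (R / (6 * Rμ)) c d hA hk
    have iv := prof_int R (1 + R) (1 / 6) d c hR hl
    have eu := prof_even (1 + R) R R (1 / 6) (R / (6 * Rμ)) c d
    have ev := prof_even R R (1 + R) (R / (6 * Rμ)) (1 / 6) d c
    have u0 : ∀ x, 0 ≤ prof (1 + R) R R (1 / 6) (R / (6 * Rμ)) c d x :=
      fun x => sol_nonneg _ _ _ _ _
    have v0 : ∀ x, 0 ≤ prof R R (1 + R) (R / (6 * Rμ)) (1 / 6) d c x :=
      fun x => sol_nonneg _ _ _ _ _
    generalize prof (1 + R) R R (1 / 6) (R / (6 * Rμ)) c d = u at *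
    generalize prof R R (1 + R) (R / (6 * Rμ)) (1 / 6) d c = v at *
    refine ⟨(fun x => (η ^ 2)⁻¹ * u x, v), ⟨by fun_prop, cv, fun x => ?_, v0,
      iu.const_mul _, iv, ?_, Iv, ?_, ?_⟩, fun x => by simp only [eu], ev⟩
    · exact mul_nonneg (inv_nonneg.2 hη2.le) (u0 x)
    · simp only [integral_const_mul, Iu]
      exact inv_mul_cancel₀ hη2.ne'
    · intro x hx y hy
      have hy' : 0 < (η ^ 2)⁻¹ * u y :=
        connectedComponentIn_subset {z : ℝ | 0 < (η ^ 2)⁻¹ * u z} x hy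
      have hx' : 0 < (η ^ 2)⁻¹ * u x := hx
      have ky := (K1 y).2 (pos_of_mul_pos_right hy' (inv_nonneg.2 hη2.le))
      have kx := (K1 x).2 (pos_of_mul_pos_right hx' (inv_nonneg.2 hη2.le))
      have e : ∀ z, η ^ 2 * (1 + R) * ((η ^ 2)⁻¹ * u z) = (1 + R) * u z := by
        intro z; field_simp
      simp only [e]
      linarith
    · intro x hx y hy
      have hy' : 0 < v y := connectedComponentIn_subset {z : ℝ | 0 < v z} x hy
      have ky := (K2 y).2 hy'
      have kx := (K2 x).2 hx
      have e : ∀ z, η ^ 2 * Rμ * ((η ^ 2)⁻¹ * u z) + Rμ * v z + z ^ 2 / 6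
          = Rμ / R * (R * v z + R * u z + R / (6 * Rμ) * z ^ 2) := by
        intro z; field_simp; ring
      simp only [e]
      rw [ky, kx]
  · rintro ⟨F, G⟩ ⟨F', G'⟩ ⟨h, eF, eG⟩ ⟨h', eF', eG'⟩
    simp only at h h' eF eG eF' eG'
    obtain ⟨c, d, K1, K2⟩ := steady_kkt hR hRμ hη h eF eG
    obtain ⟨c', d', K1', K2'⟩ := steady_kkt hR hRμ hη h' eF' eG'
    obtain ⟨cF, cG, F0, G0, iF, iG, IF, IG, -, -⟩ := h
    obtain ⟨cF', cG', F0', G0', iF', iG', IF', IG', -, -⟩ := h'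
    obtain ⟨r1, r2⟩ := kkt_unique hA hD (by fun_prop) cG (by fun_prop) cG'
      (fun x => mul_nonneg hη2.le (F0 x)) G0 (fun x => mul_nonneg hη2.le (F0' x)) G0'
      (iF.const_mul _) iG (iF'.const_mul _) iG'
      (by simp only [integral_const_mul, IF, IF']) (by rw [IG, IG']) K1 K2 K1' K2'
    have : F = F' := funext fun x => mul_left_cancel₀ hη2.ne' (congrFun r1 x)
    rw [this, r2]
end

section
/- (Proposition 3.3(i)-(ii), explicit even profile for intermediate viscosity ratio) Let R, Rμ, η be positive reals with Rμ⁰(R,η) ≤ Rμ < Rμ⁺(R,η), where Rμ⁰(R,η) := R + η²/(1+η²) and Rμ⁺(R,η) := R + ((1+η²)/η²)² (note these hypotheses give Rμ > R). Define β := (9η²Rμ/(2(Rμ−R)))^{1/3} and γ := (9Rμ(1+η²)/2)^{1/3}, and define F, G : ℝ → ℝ by: F(x) := (Rμ−R)(β²−x²)/(6η²Rμ) for |x| ≤ β and F(x) := 0 for |x| ≥ β; G(x) := (γ² + (R−Rμ)β² − (1+R−Rμ)x²)/(6Rμ) for |x| ≤ β, G(x) := (γ²−x²)/(6Rμ) for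 β ≤ |x| ≤ γ, and G(x) := 0 for |x| ≥ γ. Then β ≤ γ and (F, G) is a steady profile for (R, Rμ, η) with F and G even. -/
open MeasureTheory

theorem bump_aux (c : ℝ) (hc : 0 ≤ c) :
    Integrable (fun x : ℝ => max (c ^ 2 - x ^ 2) 0) ∧
    (∫ x : ℝ, max (c ^ 2 - x ^ 2) 0) = 4 * c ^ 3 / 3 := by
  have hind : (fun x : ℝ => max (c ^ 2 - x ^ 2) 0)
      = (Set.Ioc (-c) c).indicator (fun x : ℝ => c ^ 2 - x ^ 2) := by
    funext x
    by_cases hx : x ∈ Set.Ioc (-c) c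
    · rw [Set.indicator_of_mem hx]
      apply max_eq_left
      nlinarith [hx.1, hx.2]
    · rw [Set.indicator_of_notMem hx]
      apply max_eq_right
      by_contra h
      push Not at h
      have := abs_lt_of_sq_lt_sq (by linarith : x ^ 2 < c ^ 2) hc
      rw [abs_lt] at this
      exact hx ⟨this.1, this.2.le⟩
  have hcont : Continuous (fun x : ℝ => c ^ 2 - x ^ 2) := by fun_prop
  rw [hind]
  refine ⟨?_, ?_⟩
  · rw [integrable_indicator_iff measurableSet_Ioc]
    exact hcont.integrableOn_Ioc
  · rw [integral_indicator measurableSet_Ioc,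
      ← intervalIntegral.integral_of_le (by linarith : -c ≤ c),
      intervalIntegral.integral_sub (Continuous.intervalIntegrable (by fun_prop) _ _)
        (Continuous.intervalIntegrable (by fun_prop) _ _)]
    simp
    ring

/-- Proposition 3.3(i)-(ii): explicit even steady profile in the intermediate viscosity
regime `Rμ⁰(R,η) ≤ Rμ < Rμ⁺(R,η)`. -/
theorem even_steadyProfile_intermediate (R Rμ η : ℝ)
    (hR : 0 < R) (hRμ : 0 < Rμ) (hη : 0 < η)
    (h0 : R + η ^ 2 / (1 + η ^ 2) ≤ Rμ) (h1 : Rμ < R + ((1 + η ^ 2) / η ^ 2) ^ 2)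
    (β γ : ℝ)
    (hβ : β = (9 * η ^ 2 * Rμ / (2 * (Rμ - R))) ^ ((1 : ℝ) / 3))
    (hγ : γ = (9 * Rμ * (1 + η ^ 2) / 2) ^ ((1 : ℝ) / 3))
    (F G : ℝ → ℝ)
    (hF : ∀ x, F x = if |x| ≤ β then (Rμ - R) * (β ^ 2 - x ^ 2) / (6 * η ^ 2 * Rμ) else 0)
    (hG : ∀ x, G x =
      if |x| ≤ β then (γ ^ 2 + (R - Rμ) * β ^ 2 - (1 + R - Rμ) * x ^ 2) / (6 * Rμ)
      else if |x| ≤ γ then (γ ^ 2 - x ^ 2) / (6 * Rμ)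
      else 0) :
    β ≤ γ ∧ IsSteadyProfile R Rμ η F G ∧
    (∀ x, F (-x) = F x) ∧ (∀ x, G (-x) = G x) := by
  have hη2 : 0 < η ^ 2 := by positivity
  have hd : 0 < Rμ - R := by
    have : 0 < η ^ 2 / (1 + η ^ 2) := by positivity
    linarith
  have hβ0 : 0 < β := by rw [hβ]; positivity
  have hγ0 : 0 < γ := by rw [hγ]; positivity
  have hβ3 : β ^ 3 = 9 * η ^ 2 * Rμ / (2 * (Rμ - R)) := by
    rw [hβ, ← Real.rpow_natCast, ← Real.rpow_mul (by positivity)]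
    norm_num
  have hγ3 : γ ^ 3 = 9 * Rμ * (1 + η ^ 2) / 2 := by
    rw [hγ, ← Real.rpow_natCast, ← Real.rpow_mul (by positivity)]
    norm_num
  clear hβ hγ
  have h0' : η ^ 2 ≤ (Rμ - R) * (1 + η ^ 2) := by
    have : η ^ 2 / (1 + η ^ 2) ≤ Rμ - R := by linarith
    rwa [div_le_iff₀ (by positivity)] at this
  have h1' : (Rμ - R) * (η ^ 2) ^ 2 ≤ (1 + η ^ 2) ^ 2 := by
    have : Rμ - R ≤ (1 + η ^ 2) ^ 2 / (η ^ 2) ^ 2 := by rw [← div_pow]; linarith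
    rwa [le_div_iff₀ (by positivity)] at this
  have hβγ : β ≤ γ := by
    apply le_of_pow_le_pow_left₀ (n := 3) (by norm_num) hγ0.le
    rw [hβ3, hγ3, div_le_div_iff₀ (by positivity) (by norm_num)]
    nlinarith [mul_le_mul_of_nonneg_left h0' hRμ.le]
  have hγβ : (Rμ - R) * β ^ 2 ≤ γ ^ 2 := by
    apply le_of_pow_le_pow_left₀ (n := 3) (by norm_num) (by positivity)
    have e1 : ((Rμ - R) * β ^ 2) ^ 3 = (Rμ - R) * (9 * Rμ / 2) ^ 2 * (η ^ 2) ^ 2 := by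
      have : ((Rμ - R) * β ^ 2) ^ 3 = (Rμ - R) ^ 3 * (β ^ 3) ^ 2 := by ring
      rw [this, hβ3]
      field_simp
    have e2 : (γ ^ 2) ^ 3 = (9 * Rμ / 2) ^ 2 * (1 + η ^ 2) ^ 2 := by
      have : (γ ^ 2) ^ 3 = (γ ^ 3) ^ 2 := by ring
      rw [this, hγ3]
      ring
    rw [e1, e2]
    nlinarith [mul_le_mul_of_nonneg_left h1' (sq_nonneg (9 * Rμ / 2))]
  have hsq : ∀ c : ℝ, 0 < c → ∀ x : ℝ, (|x| ≤ c ↔ x ^ 2 ≤ c ^ 2) := by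
    intro c hc x
    rw [sq_le_sq, abs_of_pos hc]
  have hF' : F = fun x => (Rμ - R) / (6 * η ^ 2 * Rμ) * max (β ^ 2 - x ^ 2) 0 := by
    funext x
    rw [hF]
    split_ifs with h
    · rw [max_eq_left (by linarith [(hsq β hβ0 x).1 h])]
      ring
    · rw [hsq β hβ0] at h
      rw [max_eq_right (by linarith)]
      ring
  have hG' : G = fun x => 1 / (6 * Rμ) * max (γ ^ 2 - x ^ 2) 0 - η ^ 2 * F x := by
    have hs : β ^ 2 ≤ γ ^ 2 := by gcongr
    funext x
    rw [hG, hF]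
    split_ifs with h h2
    · rw [max_eq_left (by linarith [(hsq β hβ0 x).1 h])]
      field_simp
      ring
    · rw [max_eq_left (by linarith [(hsq γ hγ0 x).1 h2])]
      ring
    · rw [hsq γ hγ0] at h2
      rw [max_eq_right (by linarith)]
      ring
  obtain ⟨iβ, jβ⟩ := bump_aux β hβ0.le
  obtain ⟨iγ, jγ⟩ := bump_aux γ hγ0.le
  have hFc : Continuous F := by rw [hF']; fun_prop
  have hGc : Continuous G := by rw [hG']; fun_prop
  have hFi : Integrable F := by rw [hF']; exact iβ.const_mul _
  have hGi : Integrable G := by rw [hG']; exact (iγ.const_mul _).sub (hFi.const_mul _)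
  have hF1 : (∫ x, F x) = 1 := by
    rw [hF', integral_const_mul, jβ, hβ3]
    field_simp
    norm_num
  have hG1 : (∫ x, G x) = 1 := by
    rw [hG', integral_sub (iγ.const_mul _) (hFi.const_mul _), integral_const_mul,
      integral_const_mul, hF1, jγ, hγ3]
    field_simp
    ring
  have hFk : ∀ x, 0 < F x → η ^ 2 * (1 + R) * F x + R * G x + x ^ 2 / 6
      = ((1 + R) * (Rμ - R) * β ^ 2 + R * (γ ^ 2 + (R - Rμ) * β ^ 2)) / (6 * Rμ) := by
    intro x hx
    have h : |x| ≤ β := by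
      by_contra h
      rw [hF, if_neg h] at hx
      exact lt_irrefl _ hx
    rw [hF, hG, if_pos h, if_pos h]
    field_simp
    ring
  have hGk : ∀ x, 0 < G x → η ^ 2 * Rμ * F x + Rμ * G x + x ^ 2 / 6 = γ ^ 2 / 6 := by
    intro x hx
    rw [hG] at hx
    rw [hF, hG]
    split_ifs at hx ⊢ with h h2
    · field_simp
      ring
    · field_simp
      ring
    · exact absurd hx (lt_irrefl _)
  refine ⟨hβγ, ⟨hFc, hGc, ?_, ?_, hFi, hGi, hF1, hG1, ?_, ?_⟩, ?_, ?_⟩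
  · intro x
    rw [hF']
    positivity
  · intro x
    rw [hG]
    split_ifs with h h2
    · rw [hsq β hβ0] at h
      apply div_nonneg _ (by positivity)
      have hs : β ^ 2 ≤ γ ^ 2 := by gcongr
      by_cases hc : 0 ≤ 1 + R - Rμ
      · nlinarith [mul_le_mul_of_nonneg_left h hc]
      · push Not at hc
        nlinarith [mul_nonneg (neg_nonneg.2 hc.le) (sq_nonneg x)]
    · rw [hsq γ hγ0] at h2
      exact div_nonneg (by linarith) (by positivity)
    · exact le_refl _
  · intro x hx y hy
    rw [hFk x hx, hFk y (connectedComponentIn_subset {z : ℝ | 0 < F z} x hy)]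
  · intro x hx y hy
    rw [hGk x hx, hGk y (connectedComponentIn_subset {z : ℝ | 0 < G z} x hy)]
  · intro x
    simp only [hF, abs_neg, neg_sq]
  · intro x
    simp only [hG, abs_neg, neg_sq]
end

section
/- (Proposition 3.3(iii), explicit even profile with disconnected upper-fluid support) Let R, Rμ, η be positive reals with Rμ > 1 + R, and let (α, β, γ) be a solution of system (S1) with 0 ≤ α < β < γ. Define F, G : ℝ → ℝ by: η²F(x) := (Rμ−R)β²/(6Rμ) + R(1+R−Rμ)α²/(6Rμ(1+R)) − x²/(6(1+R)) for |x| ≤ α, η²F(x) := (Rμ−R)(β²−x²)/(6Rμ) for α ≤ |x| ≤ β, and F(x) := 0 for |x| ≥ β; G(x) := (1+R−Rμ)(α²−x²)/(6Rμ) for α ≤ |x| ≤ β, G(x) := (γ²−x²)/(6Rμ) for β ≤ |x| ≤ γ, and G(x) := 0 for |x| ≤ α and for |x| ≥ γ. Then (F, G) is a steady profile for (R, Rμ, η) with F and G even; moreover {x : F(x) > 0} = (−β, β) and, if α > 0, {x : G(x) > 0} = (−γ, −α) ∪ (α, γ) is disconnected. -/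
open MeasureTheory

/-- System (S1) of algebraic equations determining the even self-similar profile with
disconnected upper-fluid support. -/
def SystemS1 (R Rμ η α β γ : ℝ) : Prop :=
  (Rμ - R) * β ^ 3 - R * (Rμ - R - 1) / (1 + R) * α ^ 3 = 9 * η ^ 2 * Rμ / 2 ∧
  γ ^ 3 - (Rμ - R) * β ^ 3 + (Rμ - R - 1) * α ^ 3 = 9 * Rμ / 2 ∧
  γ ^ 2 - (Rμ - R) * β ^ 2 + (Rμ - R - 1) * α ^ 2 = 0

theorem bump_eq_indicator (a : ℝ) (ha : 0 ≤ a) :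
    (fun x : ℝ => max (a ^ 2 - x ^ 2) 0) = (Set.Ioc (-a) a).indicator (fun x => a ^ 2 - x ^ 2) := by
  funext x
  by_cases hx : x ∈ Set.Ioc (-a) a
  · rw [Set.indicator_of_mem hx]
    obtain ⟨h1, h2⟩ := hx
    exact max_eq_left (by nlinarith)
  · rw [Set.indicator_of_notMem hx]
    apply max_eq_right
    rw [Set.mem_Ioc, not_and_or, not_lt, not_le] at hx
    rcases hx with h | h <;> nlinarith

theorem bump_integrable (a : ℝ) (ha : 0 ≤ a) :
    Integrable (fun x : ℝ => max (a ^ 2 - x ^ 2) 0) := by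
  rw [bump_eq_indicator a ha, integrable_indicator_iff measurableSet_Ioc]
  have h : Continuous (fun x : ℝ => a ^ 2 - x ^ 2) := by fun_prop
  exact (h.integrableOn_Icc (a := -a) (b := a)).mono_set Set.Ioc_subset_Icc_self

theorem bump_integral (a : ℝ) (ha : 0 ≤ a) :
    (∫ x : ℝ, max (a ^ 2 - x ^ 2) 0) = 4 / 3 * a ^ 3 := by
  rw [bump_eq_indicator a ha, integral_indicator measurableSet_Ioc,
    ← intervalIntegral.integral_of_le (by linarith)]
  rw [intervalIntegral.integral_sub (by simp) (by apply Continuous.intervalIntegrable; fun_prop)]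
  simp only [intervalIntegral.integral_const, integral_pow, smul_eq_mul]
  push_cast
  ring

theorem bump_in (a x : ℝ) (ha : |x| ≤ a) : max (a ^ 2 - x ^ 2) 0 = a ^ 2 - x ^ 2 := by
  apply max_eq_left
  have := abs_nonneg x
  rw [← sq_abs x]; nlinarith

theorem bump_out (a x : ℝ) (h0 : 0 ≤ a) (ha : a ≤ |x|) : max (a ^ 2 - x ^ 2) 0 = 0 := by
  apply max_eq_right
  rw [← sq_abs x]; nlinarith

/-- Proposition 3.3(iii): explicit even steady profile with disconnected support of `G`
in the regime `Rμ > 1 + R`, built from a solution of system (S1). -/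
theorem even_steadyProfile_disconnected (R Rμ η : ℝ)
    (hR : 0 < R) (hRμ : 0 < Rμ) (hη : 0 < η) (hgt : 1 + R < Rμ)
    (α β γ : ℝ) (hα : 0 ≤ α) (hαβ : α < β) (hβγ : β < γ)
    (hsol : SystemS1 R Rμ η α β γ)
    (F G : ℝ → ℝ)
    (hF : ∀ x, F x =
      if |x| ≤ α then
        ((Rμ - R) * β ^ 2 / (6 * Rμ) + R * (1 + R - Rμ) * α ^ 2 / (6 * Rμ * (1 + R))
          - x ^ 2 / (6 * (1 + R))) / η ^ 2
      else if |x| ≤ β then (Rμ - R) * (β ^ 2 - x ^ 2) / (6 * Rμ) / η ^ 2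
      else 0)
    (hG : ∀ x, G x =
      if |x| ≤ α then 0
      else if |x| ≤ β then (1 + R - Rμ) * (α ^ 2 - x ^ 2) / (6 * Rμ)
      else if |x| ≤ γ then (γ ^ 2 - x ^ 2) / (6 * Rμ)
      else 0) :
    IsSteadyProfile R Rμ η F G ∧
    (∀ x, F (-x) = F x) ∧ (∀ x, G (-x) = G x) ∧
    {x : ℝ | 0 < F x} = Set.Ioo (-β) β ∧
    (0 < α →
      {x : ℝ | 0 < G x} = Set.Ioo (-γ) (-α) ∪ Set.Ioo α γ ∧
      ¬ IsPreconnected {x : ℝ | 0 < G x}) := by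
  obtain ⟨e1, e2, e3⟩ := hsol
  have h1R : 0 < 1 + R := by linarith
  have hβ0 : 0 < β := by linarith
  have hγ0 : 0 < γ := by linarith
  have hF' : F = fun x => (Rμ - R) / (6 * Rμ * η ^ 2) * max (β ^ 2 - x ^ 2) 0
      - R * (Rμ - R - 1) / (1 + R) / (6 * Rμ * η ^ 2) * max (α ^ 2 - x ^ 2) 0 := by
    funext x
    rw [hF]
    split_ifs with h1 h2
    · rw [bump_in α x h1, bump_in β x (by linarith)]
      field_simp
      ring
    · rw [bump_out α x hα (by linarith), bump_in β x h2]
      field_simp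
      ring
    · rw [bump_out α x hα (by linarith), bump_out β x hβ0.le (by linarith)]
      ring
  have hG' : G = fun x => 1 / (6 * Rμ) * max (γ ^ 2 - x ^ 2) 0
      - (Rμ - R) / (6 * Rμ) * max (β ^ 2 - x ^ 2) 0
      + (Rμ - R - 1) / (6 * Rμ) * max (α ^ 2 - x ^ 2) 0 := by
    funext x
    rw [hG]
    split_ifs with h1 h2 h3
    · rw [bump_in α x h1, bump_in β x (by linarith), bump_in γ x (by linarith)]
      field_simp
      linarith
    · rw [bump_out α x hα (by linarith), bump_in β x h2, bump_in γ x (by linarith)]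
      field_simp
      linarith
    · rw [bump_out α x hα (by linarith), bump_out β x hβ0.le (by linarith), bump_in γ x h3]
      field_simp
      ring
    · rw [bump_out α x hα (by linarith), bump_out β x hβ0.le (by linarith),
        bump_out γ x hγ0.le (by linarith)]
      ring
  have iα := bump_integrable α hα
  have iβ := bump_integrable β hβ0.le
  have iγ := bump_integrable γ hγ0.le
  have sqle : ∀ x : ℝ, ∀ a : ℝ, |x| ≤ a → x ^ 2 ≤ a ^ 2 := by
    intro x a h
    rw [← sq_abs x]; nlinarith [abs_nonneg x]
  have sqlt : ∀ x : ℝ, ∀ a : ℝ, |x| < a → x ^ 2 < a ^ 2 := by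
    intro x a h
    rw [← sq_abs x]; nlinarith [abs_nonneg x]
  have ltsq : ∀ x : ℝ, ∀ a : ℝ, 0 ≤ a → a < |x| → a ^ 2 < x ^ 2 := by
    intro x a h0 h
    rw [← sq_abs x]; nlinarith [abs_nonneg x]
  -- positivity
  have Fpos : ∀ x, |x| < β → 0 < F x := by
    intro x hx
    rw [hF]
    split_ifs with h1 h2
    · apply div_pos _ (by positivity)
      have : (Rμ - R) * β ^ 2 / (6 * Rμ) + R * (1 + R - Rμ) * α ^ 2 / (6 * Rμ * (1 + R))
          - x ^ 2 / (6 * (1 + R)) = ((Rμ - R) * (β ^ 2 - α ^ 2)) / (6 * Rμ)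
            + (α ^ 2 - x ^ 2) / (6 * (1 + R)) := by
        field_simp
        ring
      rw [this]
      have a1 := sqle x α h1
      have a2 : 0 < β ^ 2 - α ^ 2 := by nlinarith
      have a3 : 0 < Rμ - R := by linarith
      have a4 : 0 ≤ α ^ 2 - x ^ 2 := by linarith
      positivity
    · have a1 : 0 < β ^ 2 - x ^ 2 := by linarith [sqlt x β hx]
      have a3 : 0 < Rμ - R := by linarith
      positivity
    · exact absurd hx.le h2
  have Fzero : ∀ x, β ≤ |x| → F x = 0 := by
    intro x hx
    simp only [hF']
    rw [bump_out α x hα (by linarith), bump_out β x hβ0.le hx]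
    ring
  have Gpos : ∀ x, α < |x| → |x| < γ → 0 < G x := by
    intro x h1 hx
    rw [hG, if_neg (by linarith)]
    split_ifs with h2 h3
    · apply div_pos _ (by positivity)
      exact mul_pos_of_neg_of_neg (by linarith) (by linarith [ltsq x α hα h1])
    · apply div_pos _ (by positivity)
      linarith [sqlt x γ hx]
    · exact absurd hx.le h3
  have Gzero1 : ∀ x, |x| ≤ α → G x = 0 := by
    intro x hx
    rw [hG, if_pos hx]
  have Gzero2 : ∀ x, γ ≤ |x| → G x = 0 := by
    intro x hx
    simp only [hG']
    rw [bump_out α x hα (by linarith), bump_out β x hβ0.le (by linarith),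
      bump_out γ x hγ0.le hx]
    ring
  have Fiff : ∀ x, 0 < F x ↔ |x| < β := by
    intro x
    refine ⟨fun h => ?_, Fpos x⟩
    by_contra hc
    rw [Fzero x (not_lt.mp hc)] at h
    exact lt_irrefl _ h
  have Giff : ∀ x, 0 < G x ↔ α < |x| ∧ |x| < γ := by
    intro x
    refine ⟨fun h => ?_, fun h => Gpos x h.1 h.2⟩
    by_contra hc
    rw [not_and_or, not_lt, not_lt] at hc
    rcases hc with hc | hc
    · rw [Gzero1 x hc] at h
      exact lt_irrefl _ h
    · rw [Gzero2 x hc] at h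
      exact lt_irrefl _ h
  have Fconst : ∀ x, 0 < F x → η ^ 2 * (1 + R) * F x + R * G x + x ^ 2 / 6
      = ((1 + R) * (Rμ - R) * β ^ 2 - R * (Rμ - R - 1) * α ^ 2) / (6 * Rμ) := by
    intro x hx
    have hx := (Fiff x).1 hx
    rw [hF, hG]
    split_ifs with h1 h2
    · field_simp
      ring
    · field_simp
      ring
    · exact absurd hx.le h2
    · exact absurd hx.le h2
  have Gconst : ∀ x, 0 < G x → η ^ 2 * Rμ * F x + Rμ * G x + x ^ 2 / 6 = γ ^ 2 / 6 := by
    intro x hx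
    have hx := (Giff x).1 hx
    rw [hF, hG, if_neg (not_le.mpr hx.1), if_neg (not_le.mpr hx.1)]
    split_ifs with h2 h3
    · field_simp
      linarith
    · field_simp
      ring
    · exact absurd hx.2.le h3
  have Gset : {x : ℝ | 0 < G x} = Set.Ioo (-γ) (-α) ∪ Set.Ioo α γ := by
    ext x
    simp only [Set.mem_ofPred_eq, Giff, Set.mem_union, Set.mem_Ioo, lt_abs, abs_lt]
    constructor
    · rintro ⟨h | h, h2, h3⟩
      · exact Or.inr ⟨h, h3⟩
      · exact Or.inl ⟨h2, by linarith⟩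
    · rintro (⟨h, h2⟩ | ⟨h, h2⟩)
      · exact ⟨Or.inr (by linarith), h, by linarith⟩
      · exact ⟨Or.inl h, by linarith, h2⟩
  refine ⟨⟨?_, ?_, ?_, ?_, ?_, ?_, ?_, ?_, ?_, ?_⟩, ?_, ?_, ?_, ?_⟩
  · rw [hF']; fun_prop
  · rw [hG']; fun_prop
  · intro x
    rcases lt_or_ge |x| β with h | h
    · exact (Fpos x h).le
    · exact (Fzero x h).ge
  · intro x
    rcases le_or_gt |x| α with h | h
    · exact (Gzero1 x h).ge
    · rcases lt_or_ge |x| γ with h' | h'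
      · exact (Gpos x h h').le
      · exact (Gzero2 x h').ge
  · rw [hF']
    exact (iβ.const_mul _).sub (iα.const_mul _)
  · rw [hG']
    exact ((iγ.const_mul _).sub (iβ.const_mul _)).add (iα.const_mul _)
  · rw [hF', integral_sub (iβ.const_mul _) (iα.const_mul _), integral_const_mul,
      integral_const_mul, bump_integral α hα, bump_integral β hβ0.le]
    have : (Rμ - R) / (6 * Rμ * η ^ 2) * (4 / 3 * β ^ 3)
        - R * (Rμ - R - 1) / (1 + R) / (6 * Rμ * η ^ 2) * (4 / 3 * α ^ 3)
        = 4 / 3 / (6 * Rμ * η ^ 2) *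
          ((Rμ - R) * β ^ 3 - R * (Rμ - R - 1) / (1 + R) * α ^ 3) := by ring
    rw [this, e1]
    field_simp
    norm_num
  · have i12 : Integrable (fun x : ℝ => 1 / (6 * Rμ) * max (γ ^ 2 - x ^ 2) 0
        - (Rμ - R) / (6 * Rμ) * max (β ^ 2 - x ^ 2) 0) :=
      (iγ.const_mul _).sub (iβ.const_mul _)
    rw [hG', integral_add i12 (iα.const_mul _),
      integral_sub (iγ.const_mul _) (iβ.const_mul _), integral_const_mul,
      integral_const_mul, integral_const_mul, bump_integral α hα, bump_integral β hβ0.le,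
      bump_integral γ hγ0.le]
    have : 1 / (6 * Rμ) * (4 / 3 * γ ^ 3) - (Rμ - R) / (6 * Rμ) * (4 / 3 * β ^ 3)
        + (Rμ - R - 1) / (6 * Rμ) * (4 / 3 * α ^ 3)
        = 4 / 3 / (6 * Rμ) *
          (γ ^ 3 - (Rμ - R) * β ^ 3 + (Rμ - R - 1) * α ^ 3) := by ring
    rw [this, e2]
    field_simp
    norm_num
  · intro x hx y hy
    have hy' : y ∈ {z : ℝ | 0 < F z} := connectedComponentIn_subset _ _ hy
    rw [Fconst x hx, Fconst y hy']
  · intro x hx y hy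
    have hy' : y ∈ {z : ℝ | 0 < G z} := connectedComponentIn_subset _ _ hy
    rw [Gconst x hx, Gconst y hy']
  · intro x
    simp only [hF', neg_sq]
  · intro x
    simp only [hG', neg_sq]
  · ext x
    simp only [Set.mem_ofPred_eq, Fiff, Set.mem_Ioo, abs_lt]
  · intro hα0
    refine ⟨Gset, fun hc => ?_⟩
    have habs : |β| = β := abs_of_pos hβ0
    have m1 : β ∈ {x : ℝ | 0 < G x} := Gpos β (by rw [habs]; exact hαβ) (by rw [habs]; exact hβγ)
    have m2 : -β ∈ {x : ℝ | 0 < G x} :=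
      Gpos (-β) (by rw [abs_neg, habs]; exact hαβ) (by rw [abs_neg, habs]; exact hβγ)
    have m0 : (0 : ℝ) ∈ {x : ℝ | 0 < G x} :=
      hc.ordConnected.out m2 m1 ⟨by linarith, hβ0.le⟩
    have := ((Giff 0).1 m0).1
    rw [abs_zero] at this
    linarith
end

section
/- (Lemma A.1) Let R, Rμ, η be positive reals with Rμ > R + 1. Then system (S1) has a solution (α, β, γ) with 0 ≤ α < β < γ if and only if Rμ ≥ Rμ⁺(R,η); when such a solution exists it is unique, and it satisfies α > 0 if Rμ > Rμ⁺(R,η) and α = 0 if Rμ = Rμ⁺(R,η). -/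
/-- The one-variable function whose root (in the square of the ratio) solves the system. -/
noncomputable def GG (A q e s : ℝ) : ℝ :=
  e * ((A - (A - 1) * s) ^ (3 / 2 : ℝ) - A + (A - 1) * s ^ (3 / 2 : ℝ))
    - (A - q * (A - 1) * s ^ (3 / 2 : ℝ))

lemma sq_rpow_aux {x : ℝ} (hx : 0 ≤ x) : (x ^ 2) ^ (3 / 2 : ℝ) = x ^ 3 := by
  rw [← Real.rpow_natCast x 2, ← Real.rpow_mul hx, ← Real.rpow_natCast x 3]
  norm_num

lemma GG_convex {A q e : ℝ} (hA : 1 < A) (hq : 0 < q) (he : 0 < e) :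
    ConvexOn ℝ (Set.Icc 0 1) (GG A q e) := by
  refine ⟨convex_Icc 0 1, ?_⟩
  rintro x ⟨hx0, hx1⟩ y ⟨hy0, hy1⟩ a b ha hb hab
  have hc := (convexOn_rpow (p := (3 / 2 : ℝ)) (by norm_num)).2
  have h1 := hc (x := x) hx0 (y := y) hy0 ha hb hab
  have h2 := hc (x := A - (A - 1) * x) (by simp only [Set.mem_Ici]; nlinarith)
    (y := A - (A - 1) * y) (by simp only [Set.mem_Ici]; nlinarith) ha hb hab
  simp only [smul_eq_mul, GG] at *
  have hb' : b = 1 - a := by linarith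
  have e1 : a * (A - (A - 1) * x) + b * (A - (A - 1) * y) = A - (A - 1) * (a * x + b * y) := by
    subst hb'; ring
  rw [e1] at h2
  have h3 := mul_le_mul_of_nonneg_left h2 he.le
  have h4 := mul_le_mul_of_nonneg_left h1 (by nlinarith [mul_pos he (sub_pos.2 hA), mul_pos hq (sub_pos.2 hA)] : 0 ≤ e * (A - 1) + q * (A - 1))
  generalize (A - (A - 1) * (a * x + b * y)) ^ (3 / 2 : ℝ) = u at *
  generalize (a * x + b * y) ^ (3 / 2 : ℝ) = v at *
  subst hb'
  linarith

lemma GG_one {A q e : ℝ} (hA : 1 < A) (hq1 : q < 1) : GG A q e 1 < 0 := by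
  have : A - (A - 1) * 1 = 1 := by ring
  rw [GG, this, Real.one_rpow]
  nlinarith

lemma GG_zero {A q e : ℝ} (hA : 1 < A) (he : 0 < e) :
    ∃ c, 0 < c ∧ GG A q e 0 = c * (A - ((1 + e) / e) ^ 2) := by
  have h0 : (0:ℝ) ^ (3 / 2 : ℝ) = 0 := Real.zero_rpow (by norm_num)
  obtain ⟨a, ha, rfl⟩ : ∃ a, 0 < a ∧ A = a ^ 2 :=
    ⟨√A, Real.sqrt_pos.2 (by linarith), (Real.sq_sqrt (by linarith)).symm⟩
  refine ⟨a ^ 2 * e / (a + (1 + e) / e), by positivity, ?_⟩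
  rw [GG, h0, mul_zero, sub_zero, sq_rpow_aux ha.le]
  have : a + (1 + e) / e ≠ 0 := by positivity
  have h2 : a ^ 2 - ((1 + e) / e) ^ 2 = (a + (1 + e) / e) * (a - (1 + e) / e) := by ring
  rw [h2]
  generalize hd : a + (1 + e) / e = d at *
  field_simp
  ring

lemma GG_root_unique {A q e s t : ℝ} (hA : 1 < A) (hq : 0 < q) (hq1 : q < 1) (he : 0 < e)
    (hs : 0 ≤ s) (hst : s < t) (ht : t < 1) (h0 : 0 ≥ GG A q e s) : GG A q e t < 0 := by
  have h1 := GG_one (e := e) hA hq1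
  have hc0 := (GG_convex hA hq he).2
  have hc := hc0 (x := s) ⟨hs, by linarith⟩ (y := 1) ⟨by norm_num, le_rfl⟩
    (a := (1 - t) / (1 - s)) (b := (t - s) / (1 - s))
    (div_nonneg (by linarith) (by linarith)) (div_nonneg (by linarith) (by linarith))
    (by have : 1 - s ≠ 0 := by linarith
        field_simp; ring)
  have e1 : (1 - t) / (1 - s) * s + (t - s) / (1 - s) * 1 = t := by
    have : 1 - s ≠ 0 := by linarith
    field_simp; ring
  simp only [smul_eq_mul] at hc
  rw [e1] at hc
  have p1 : 0 < (1 - t) / (1 - s) := div_pos (by linarith) (by linarith)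
  have p2 : 0 < (t - s) / (1 - s) := div_pos (by linarith) (by linarith)
  nlinarith

lemma GG_of_sol {R Rμ η α β γ : ℝ} (hgt : R + 1 < Rμ)
    (h0 : 0 ≤ α) (h1 : α < β) (h2 : β < γ) (h : SystemS1 R Rμ η α β γ) :
    GG (Rμ - R) (R / (1 + R)) (η ^ 2) ((α / β) ^ 2) = 0 := by
  obtain ⟨E1, E2, E3⟩ := h
  have hb : 0 < β := by linarith
  have hg : 0 < γ := by linarith
  have e1 : Rμ - R - (Rμ - R - 1) * (α / β) ^ 2 = (γ / β) ^ 2 := by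
    field_simp; linarith
  rw [GG, e1, sq_rpow_aux (by positivity), sq_rpow_aux (by positivity)]
  have e2 : R * (Rμ - R - 1) / (1 + R) = R / (1 + R) * (Rμ - R - 1) := by ring
  rw [e2] at E1
  generalize R / (1 + R) = q at *
  field_simp
  linear_combination η ^ 2 * E2 - E1

lemma ratio_bounds {α β : ℝ} (h0 : 0 ≤ α) (h1 : α < β) : 0 ≤ (α / β) ^ 2 ∧ (α / β) ^ 2 < 1 := by
  have hb : 0 < β := by linarith
  have h2 : α / β < 1 := (div_lt_one hb).2 h1
  have h3 : 0 ≤ α / β := by positivity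
  exact ⟨by positivity, by nlinarith⟩

lemma exists_sol {R Rμ η : ℝ} (hR : 0 < R) (hRμ : 0 < Rμ) (hη : 0 < η) (hgt : R + 1 < Rμ)
    (h : 0 ≤ GG (Rμ - R) (R / (1 + R)) (η ^ 2) 0) :
    ∃ α β γ : ℝ, 0 ≤ α ∧ α < β ∧ β < γ ∧ SystemS1 R Rμ η α β γ := by
  have hq : 0 < R / (1 + R) := by positivity
  have hq1 : R / (1 + R) < 1 := (div_lt_one (by linarith)).2 (by linarith)
  have e2 : R * (Rμ - R - 1) / (1 + R) = R / (1 + R) * (Rμ - R - 1) := by ring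
  simp only [SystemS1, e2]
  have hA : 1 < Rμ - R := by linarith
  have hn := GG_one (e := η ^ 2) hA hq1
  generalize R / (1 + R) = q at *
  generalize Rμ - R = A at *
  have hcont : ContinuousOn (GG A q (η ^ 2)) (Set.Icc 0 1) := by
    have : Continuous (GG A q (η ^ 2)) := by
      unfold GG
      have k : Continuous fun x : ℝ => x ^ (3 / 2 : ℝ) :=
        Real.continuous_rpow_const (by norm_num)
      have k2 : Continuous fun x : ℝ => (A - (A - 1) * x) ^ (3 / 2 : ℝ) :=
        k.comp (by fun_prop)
      fun_prop
    exact this.continuousOn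
  obtain ⟨s, ⟨hs0, hs1⟩, hs⟩ := intermediate_value_Icc' (by norm_num : (0:ℝ) ≤ 1) hcont
    (⟨hn.le, h⟩ : (0:ℝ) ∈ Set.Icc _ _)
  have hs1 : s < 1 := lt_of_le_of_ne hs1 (by rintro rfl; linarith)
  obtain ⟨t, ht, rfl⟩ : ∃ t, 0 ≤ t ∧ s = t ^ 2 := ⟨√s, Real.sqrt_nonneg _, (Real.sq_sqrt hs0).symm⟩
  have ht1 : t < 1 := by nlinarith
  have hg1 : 1 < A - (A - 1) * t ^ 2 := by nlinarith
  obtain ⟨g, hg, hgA⟩ : ∃ g, 0 ≤ g ∧ A - (A - 1) * t ^ 2 = g ^ 2 :=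
    ⟨_, Real.sqrt_nonneg _, (Real.sq_sqrt (by linarith)).symm⟩
  have hg1 : 1 < g := by nlinarith
  rw [GG, hgA, sq_rpow_aux hg, sq_rpow_aux ht] at hs
  have ht3 : t ^ 3 ≤ 1 := pow_le_one₀ ht ht1.le
  have hD : 0 < A - q * (A - 1) * t ^ 3 := by
    have : q * (A - 1) * t ^ 3 ≤ q * (A - 1) * 1 :=
      mul_le_mul_of_nonneg_left ht3 (mul_nonneg hq.le (by linarith))
    nlinarith
  obtain ⟨b, hb, hb3⟩ : ∃ b : ℝ, 0 < b ∧ b ^ 3 = 9 * η ^ 2 * Rμ / 2 / (A - q * (A - 1) * t ^ 3) := by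
    have hp : 0 < 9 * η ^ 2 * Rμ / 2 / (A - q * (A - 1) * t ^ 3) := by positivity
    refine ⟨_ ^ (1 / 3 : ℝ), Real.rpow_pos_of_pos hp _, ?_⟩
    rw [← Real.rpow_natCast, ← Real.rpow_mul hp.le]
    norm_num
  rw [eq_div_iff hD.ne'] at hb3
  refine ⟨t * b, b, g * b, by positivity, by nlinarith, by nlinarith, ?_, ?_, ?_⟩
  · linear_combination hb3
  · have : η ^ 2 ≠ 0 := by positivity
    apply mul_left_cancel₀ this
    linear_combination hb3 + b ^ 3 * hs
  · linear_combination (-b ^ 2) * hgA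

/-- Lemma A.1: for `Rμ > R + 1`, system (S1) has a solution with `0 ≤ α < β < γ` iff
`Rμ ≥ Rμ⁺(R,η) = R + ((1+η²)/η²)²`; the solution is then unique, with `α > 0` when
`Rμ > Rμ⁺(R,η)` and `α = 0` when `Rμ = Rμ⁺(R,η)`. -/
theorem systemS1_solvability (R Rμ η : ℝ)
    (hR : 0 < R) (hRμ : 0 < Rμ) (hη : 0 < η) (hgt : R + 1 < Rμ) :
    ((∃ α β γ : ℝ, 0 ≤ α ∧ α < β ∧ β < γ ∧ SystemS1 R Rμ η α β γ) ↔
      R + ((1 + η ^ 2) / η ^ 2) ^ 2 ≤ Rμ) ∧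
    (∀ α β γ α' β' γ' : ℝ,
      0 ≤ α → α < β → β < γ → SystemS1 R Rμ η α β γ →
      0 ≤ α' → α' < β' → β' < γ' → SystemS1 R Rμ η α' β' γ' →
      α = α' ∧ β = β' ∧ γ = γ') ∧
    (∀ α β γ : ℝ, 0 ≤ α → α < β → β < γ → SystemS1 R Rμ η α β γ →
      (R + ((1 + η ^ 2) / η ^ 2) ^ 2 < Rμ → 0 < α) ∧
      (Rμ = R + ((1 + η ^ 2) / η ^ 2) ^ 2 → α = 0)) := by
  have hq : 0 < R / (1 + R) := by positivity
  have hq1 : R / (1 + R) < 1 := (div_lt_one (by linarith)).2 (by linarith)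
  have hA : 1 < Rμ - R := by linarith
  have he : 0 < η ^ 2 := by positivity
  obtain ⟨c, hc, hG0⟩ := GG_zero (q := R / (1 + R)) hA he
  refine ⟨⟨?_, ?_⟩, ?_, ?_⟩
  · rintro ⟨α, β, γ, h0, h1, h2, h⟩
    have hr := GG_of_sol hgt h0 h1 h2 h
    obtain ⟨b0, b1⟩ := ratio_bounds h0 h1
    by_contra! hlt
    have hneg : GG (Rμ - R) (R / (1 + R)) (η ^ 2) 0 < 0 := by
      rw [hG0]; exact mul_neg_of_pos_of_neg hc (by linarith)
    rcases b0.eq_or_lt with b | b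
    · rw [← b] at hr; linarith
    · have := GG_root_unique hA hq hq1 he le_rfl b b1 hneg.le
      linarith
  · intro hle
    apply exists_sol hR hRμ hη hgt
    rw [hG0]; exact mul_nonneg hc.le (by linarith)
  · intro α β γ α' β' γ' h0 h1 h2 h h0' h1' h2' h'
    have hr := GG_of_sol hgt h0 h1 h2 h
    have hr' := GG_of_sol hgt h0' h1' h2' h'
    obtain ⟨b0, b1⟩ := ratio_bounds h0 h1
    obtain ⟨b0', b1'⟩ := ratio_bounds h0' h1'
    have hb : 0 < β := by linarith
    have hb' : 0 < β' := by linarith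
    have hs : (α / β) ^ 2 = (α' / β') ^ 2 := by
      rcases lt_trichotomy ((α / β) ^ 2) ((α' / β') ^ 2) with l | l | l
      · have := GG_root_unique hA hq hq1 he b0 l b1' hr.le
        linarith
      · exact l
      · have := GG_root_unique hA hq hq1 he b0' l b1 hr'.le
        linarith
    have ht : α / β = α' / β' :=
      (pow_left_inj₀ (by positivity) (by positivity) (by norm_num)).1 hs
    obtain ⟨t, rfl⟩ : ∃ t, α = t * β := ⟨α / β, by field_simp⟩
    have ht2 : α' = t * β' := by
      field_simp at ht; linarith
    subst ht2
    obtain ⟨E1, E2, E3⟩ := h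
    obtain ⟨E1', E2', E3'⟩ := h'
    have ht0 : 0 ≤ t := nonneg_of_mul_nonneg_left h0 hb
    have ht1 : t < 1 := (mul_lt_iff_lt_one_left hb).1 h1
    have e2 : R * (Rμ - R - 1) / (1 + R) = R / (1 + R) * (Rμ - R - 1) := by ring
    rw [e2] at E1 E1'
    have ht3 : t ^ 3 ≤ 1 := pow_le_one₀ ht0 ht1.le
    have hD : 0 < (Rμ - R) - R / (1 + R) * (Rμ - R - 1) * t ^ 3 := by
      have : R / (1 + R) * (Rμ - R - 1) * t ^ 3 ≤ R / (1 + R) * (Rμ - R - 1) * 1 :=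
        mul_le_mul_of_nonneg_left ht3 (mul_nonneg hq.le (by linarith))
      have h5 : R / (1 + R) * (Rμ - R - 1) < Rμ - R - 1 :=
        mul_lt_of_lt_one_left (by linarith) hq1
      linarith
    have hb3 : β ^ 3 = β' ^ 3 := by
      apply mul_left_cancel₀ hD.ne'
      linear_combination E1 - E1'
    have hbb : β = β' := (pow_left_inj₀ hb.le hb'.le (by norm_num)).1 hb3
    subst hbb
    refine ⟨rfl, rfl, ?_⟩
    exact (pow_left_inj₀ (n := 2) (by linarith) (by linarith) (by norm_num)).1
      (by linear_combination E3 - E3')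
  · intro α β γ h0 h1 h2 h
    have hr := GG_of_sol hgt h0 h1 h2 h
    obtain ⟨b0, b1⟩ := ratio_bounds h0 h1
    have hb : 0 < β := by linarith
    constructor
    · intro hlt
      rcases h0.eq_or_lt with b | b
      · subst b
        have hz : ((0:ℝ) / β) ^ 2 = 0 := by simp
        rw [hz, hG0] at hr
        have := mul_pos hc (sub_pos.2 (lt_sub_iff_add_lt'.2 hlt))
        linarith
      · exact b
    · intro heq
      by_contra hne
      have ha : 0 < α := lt_of_le_of_ne h0 (Ne.symm hne)
      have hz : GG (Rμ - R) (R / (1 + R)) (η ^ 2) 0 ≤ 0 := by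
        rw [hG0]
        have : Rμ - R - ((1 + η ^ 2) / η ^ 2) ^ 2 = 0 := by linarith
        rw [this, mul_zero]
      have := GG_root_unique hA hq hq1 he le_rfl (by positivity : 0 < (α / β) ^ 2) b1 hz
      linarith
end

section
/- (Lemma A.2) Let R and η be positive reals. There exists a real number RμM > Rμ⁺(R,η) with the following property: for every Rμ ≥ RμM, system (S2) has exactly one solution (β₁, α, β, γ) with β₁ < 0 ≤ α < β < γ, and this solution satisfies −β₁ > α, with α = 0 if and only if Rμ = RμM; while for every Rμ with R + 1 < Rμ < RμM, system (S2) has no solution (β₁, α, β, γ) with β₁ < 0 ≤ α < β < γ. -/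
/-- System (S2) of algebraic equations determining the non-symmetric self-similar
profiles with connected supports. -/
def SystemS2 (R Rμ η β₁ α β γ : ℝ) : Prop :=
  Rμ * β₁ ^ 3 - (1 + R) * (Rμ - R) * β ^ 3 + R * (Rμ - R - 1) * α ^ 3
    = -(9 * η ^ 2 * Rμ * (1 + R)) ∧
  γ ^ 3 - (Rμ - R) * β ^ 3 + (Rμ - R - 1) * α ^ 3 = 9 * Rμ ∧
  γ ^ 2 - (Rμ - R) * β ^ 2 + (Rμ - R - 1) * α ^ 2 = 0 ∧
  Rμ * β₁ ^ 2 - (1 + R) * (Rμ - R) * β ^ 2 + R * (Rμ - R - 1) * α ^ 2 = 0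

noncomputable def gS (m t : ℝ) : ℝ := √(m - (m - 1) * t ^ 2)

noncomputable def bS (R m t : ℝ) : ℝ := √((R * (m - (m - 1) * t ^ 2) + m) / (m + R))

noncomputable def fS (R η m t : ℝ) : ℝ :=
  (m + R) * bS R m t ^ 3 + (1 + R) * m - R * (m - 1) * t ^ 3
    - η ^ 2 * (1 + R) * (gS m t ^ 3 - m + (m - 1) * t ^ 3)

noncomputable def hS (R η m t : ℝ) : ℝ :=
  η ^ 2 * (1 + R) * (gS m t - t) - R * (bS R m t + t)

theorem gS_arg {m t : ℝ} (hm : 1 < m) (h0 : 0 ≤ t) (h1 : t ≤ 1) :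
    1 ≤ m - (m - 1) * t ^ 2 := by
  have : t ^ 2 ≤ 1 := by nlinarith
  nlinarith

theorem gS_sq {m t : ℝ} (hm : 1 < m) (h0 : 0 ≤ t) (h1 : t ≤ 1) :
    gS m t ^ 2 = m - (m - 1) * t ^ 2 :=
  Real.sq_sqrt (by linarith [gS_arg hm h0 h1])

theorem gS_ge {m t : ℝ} (hm : 1 < m) (h0 : 0 ≤ t) (h1 : t ≤ 1) : 1 ≤ gS m t :=
  Real.one_le_sqrt.2 (gS_arg hm h0 h1)

theorem bS_arg {R m t : ℝ} (hR : 0 < R) (hm : 1 < m) (h0 : 0 ≤ t) (h1 : t ≤ 1) :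
    1 ≤ (R * (m - (m - 1) * t ^ 2) + m) / (m + R) := by
  rw [le_div_iff₀ (by linarith)]
  nlinarith [gS_arg hm h0 h1]

theorem bS_sq {R m t : ℝ} (hR : 0 < R) (hm : 1 < m) (h0 : 0 ≤ t) (h1 : t ≤ 1) :
    (m + R) * bS R m t ^ 2 = R * (m - (m - 1) * t ^ 2) + m := by
  have h : bS R m t ^ 2 = _ := Real.sq_sqrt (by linarith [bS_arg hR hm h0 h1])
  rw [h, mul_div_cancel₀]
  linarith

theorem bS_ge {R m t : ℝ} (hR : 0 < R) (hm : 1 < m) (h0 : 0 ≤ t) (h1 : t ≤ 1) :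
    1 ≤ bS R m t :=
  Real.one_le_sqrt.2 (bS_arg hR hm h0 h1)

theorem GS_pos {m t : ℝ} (hm : 1 < m) (h0 : 0 ≤ t) (h1 : t < 1) :
    0 < gS m t ^ 3 - m + (m - 1) * t ^ 3 := by
  have hs := gS_sq hm h0 h1.le
  have hg : 1 < gS m t := by
    have := gS_ge hm h0 h1.le
    have h2 : t ^ 2 < 1 := by nlinarith
    nlinarith [mul_pos (sub_pos.2 hm) (sub_pos.2 h2)]
  generalize gS m t = g at *
  have e : (g ^ 3 - m + (m - 1) * t ^ 3) * (1 + t)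
      = (g - 1) * ((g ^ 2 - t ^ 2) + g * t * (g - t)) := by
    linear_combination (1 + t + t ^ 2) * hs
  have : 0 < (g - 1) * ((g ^ 2 - t ^ 2) + g * t * (g - t)) := by
    apply mul_pos (by linarith)
    have : 0 ≤ g * t * (g - t) := by
      apply mul_nonneg (by positivity); linarith
    nlinarith
  rw [← e] at this
  exact pos_of_mul_pos_left this (by linarith)

theorem fS_one {R η m : ℝ} (hR : 0 < R) (hm : 1 < m) : 0 < fS R η m 1 := by
  have hg : gS m 1 = 1 := by simp [gS]
  have hb : bS R m 1 = 1 := by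
    have : (R + m) / (m + R) = 1 := by rw [add_comm]; apply div_self; linarith
    simp [bS, this]
  simp only [fS, hg, hb]
  nlinarith

theorem hS_mono {R η m s t : ℝ} (hR : 0 < R) (hm : 1 < m) (h0 : 0 ≤ s)
    (hst : s < t) (h1 : t ≤ 1) (h : hS R η m s ≤ 0) : hS R η m t < 0 := by
  have gs := gS_sq hm h0 (hst.le.trans h1)
  have gt := gS_sq hm (h0.trans hst.le) h1
  have bs := bS_sq hR hm h0 (hst.le.trans h1)
  have bt := bS_sq hR hm (h0.trans hst.le) h1
  have gs1 := gS_ge hm h0 (hst.le.trans h1)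
  have gt1 := gS_ge hm (h0.trans hst.le) h1
  have bs1 := bS_ge hR hm h0 (hst.le.trans h1)
  have bt1 := bS_ge hR hm (h0.trans hst.le) h1
  unfold hS at *
  have hc : 0 ≤ η ^ 2 * (1 + R) := by positivity
  generalize η ^ 2 * (1 + R) = c at *
  generalize gS m s = x at *
  generalize gS m t = y at *
  generalize bS R m s = p at *
  generalize bS R m t = q at *
  rw [← gs] at bs
  rw [← gt] at bt
  have hyx2 : y ^ 2 ≤ x ^ 2 := by
    rw [gs, gt]; nlinarith [mul_nonneg (sub_nonneg.2 hm.le) (by nlinarith : 0 ≤ t ^ 2 - s ^ 2)]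
  have hyx : y ≤ x := by nlinarith
  have hpq : p * y ≤ q * x := by
    have : (p * y) ^ 2 ≤ (q * x) ^ 2 := by
      have e : (m + R) * ((q * x) ^ 2 - (p * y) ^ 2) = m * (x ^ 2 - y ^ 2) := by
        linear_combination x ^ 2 * bt - y ^ 2 * bs
      have : 0 ≤ (m + R) * ((q * x) ^ 2 - (p * y) ^ 2) := by
        rw [e]; apply mul_nonneg <;> linarith
      have := nonneg_of_mul_nonneg_right this (by linarith : 0 < m + R)
      linarith
    exact (sq_le_sq₀ (by positivity) (by positivity)).1 this
  have hsy : s * y < t * x := by nlinarith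
  have key : x * (c * (y - t) - R * (q + t)) < 0 := by
    have a1 := mul_le_mul_of_nonneg_left hpq hR.le
    have a2 := mul_lt_mul_of_pos_left hsy hR
    have a3 := mul_le_mul_of_nonneg_left hsy.le hc
    have a4 := mul_le_mul_of_nonneg_left h (by linarith : 0 ≤ y)
    nlinarith
  by_contra hcon
  push Not at hcon
  nlinarith [mul_nonneg (by linarith : 0 ≤ x) hcon]

theorem gS_cont (m : ℝ) : Continuous (gS m) := by unfold gS; fun_prop
theorem bS_cont (R m : ℝ) : Continuous (bS R m) := by
  unfold bS
  exact Real.continuous_sqrt.comp (Continuous.div_const (by fun_prop) _)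
theorem fS_cont (R η m : ℝ) : Continuous (fS R η m) := by
  have := gS_cont m
  have := bS_cont R m
  unfold fS; fun_prop

theorem fS_deriv {R η m t : ℝ} (hR : 0 < R) (hm : 1 < m) (h0 : 0 ≤ t) (h1 : t ≤ 1) :
    HasDerivAt (fS R η m) (3 * (m - 1) * t * hS R η m t) t := by
  have g1 := gS_ge hm h0 h1
  have b1 := bS_ge hR hm h0 h1
  have hin : HasDerivAt (fun t : ℝ => m - (m - 1) * t ^ 2) (-((m - 1) * (2 * t))) t := by
    have := ((hasDerivAt_pow 2 t).const_mul (m - 1)).const_sub m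
    simpa using this
  have hg : HasDerivAt (gS m) (-((m - 1) * (2 * t)) / (2 * gS m t)) t :=
    hin.sqrt (by linarith [gS_arg hm h0 h1])
  have hb : HasDerivAt (bS R m) ((R * (-((m - 1) * (2 * t))) / (m + R)) / (2 * bS R m t)) t :=
    (((hin.const_mul R).add_const m).div_const (m + R)).sqrt (by linarith [bS_arg hR hm h0 h1])
  have ht := hasDerivAt_pow 3 t
  have hF := ((((hb.pow 3).const_mul (m + R)).add_const ((1 + R) * m)).sub
    (ht.const_mul (R * (m - 1)))).sub
    ((((hg.pow 3).sub_const m).add (ht.const_mul (m - 1))).const_mul (η ^ 2 * (1 + R)))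
  refine HasDerivAt.congr_deriv (f := fS R η m) hF ?_
  have : m + R ≠ 0 := by linarith
  unfold hS
  generalize gS m t = x at *
  generalize bS R m t = y at *
  have : x ≠ 0 := by linarith
  have : y ≠ 0 := by linarith
  field_simp
  push_cast
  ring

theorem fS_key {R η m t : ℝ} (hR : 0 < R) (hm : 1 < m) (h0 : 0 ≤ t) (h1 : t < 1)
    (hF : fS R η m t ≤ 0) : StrictMonoOn (fS R η m) (Set.Icc 0 t) := by
  have hpos : 0 < hS R η m t := by
    by_contra hcon
    push Not at hcon
    have : StrictAntiOn (fS R η m) (Set.Icc t 1) := by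
      apply strictAntiOn_of_deriv_neg (convex_Icc _ _) (fS_cont R η m).continuousOn
      intro x hx
      rw [interior_Icc] at hx
      rw [(fS_deriv hR hm (h0.trans hx.1.le) hx.2.le).deriv]
      have := hS_mono hR hm h0 hx.1 hx.2.le hcon
      have hx0 : 0 < x := by linarith [hx.1]
      exact mul_neg_of_pos_of_neg (mul_pos (by linarith) hx0) this
    have := this (Set.left_mem_Icc.2 h1.le) (Set.right_mem_Icc.2 h1.le) h1
    linarith [fS_one (η := η) hR hm]
  apply strictMonoOn_of_deriv_pos (convex_Icc _ _) (fS_cont R η m).continuousOn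
  intro x hx
  rw [interior_Icc] at hx
  rw [(fS_deriv hR hm hx.1.le (hx.2.le.trans h1.le)).deriv]
  have : 0 < hS R η m x := by
    by_contra hcon
    push Not at hcon
    linarith [hS_mono hR hm hx.1.le hx.2 h1.le hcon]
  exact mul_pos (mul_pos (by linarith) hx.1) this

theorem fS_uniq {R η m s t : ℝ} (hR : 0 < R) (hm : 1 < m) (hs0 : 0 ≤ s) (hs1 : s < 1)
    (h0 : 0 ≤ t) (h1 : t < 1) (hs : fS R η m s = 0) (ht : fS R η m t = 0) : s = t := by
  rcases lt_trichotomy s t with h | h | h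
  · have := fS_key hR hm h0 h1 ht.le ⟨hs0, h.le⟩ ⟨h0, le_rfl⟩ h
    linarith
  · exact h
  · have := fS_key hR hm hs0 hs1 hs.le ⟨h0, h.le⟩ ⟨hs0, le_rfl⟩ h
    linarith

theorem fS_zero_le {R η m t : ℝ} (hR : 0 < R) (hm : 1 < m)
    (h0 : 0 ≤ t) (h1 : t < 1) (ht : fS R η m t = 0) : fS R η m 0 ≤ 0 := by
  rcases h0.eq_or_lt with h | h
  · subst h; exact ht.le
  · have := fS_key hR hm h0 h1 ht.le ⟨le_rfl, h0⟩ ⟨h0, le_rfl⟩ h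
    linarith

theorem fS_exists {R η m : ℝ} (hR : 0 < R) (hm : 1 < m) (h : fS R η m 0 ≤ 0) :
    ∃ t, 0 ≤ t ∧ t < 1 ∧ fS R η m t = 0 := by
  obtain ⟨t, ht, h⟩ := intermediate_value_Icc (zero_le_one' ℝ)
    (fS_cont R η m).continuousOn ⟨h, (fS_one hR hm).le⟩
  refine ⟨t, ht.1, lt_of_le_of_ne ht.2 ?_, h⟩
  rintro rfl
  linarith [fS_one (η := η) hR hm]

noncomputable def phiS (R η m : ℝ) : ℝ := √((1 + R) / (m + R)) + (1 + η ^ 2) / √m - η ^ 2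

theorem fS_zero {R m : ℝ} (η : ℝ) (hR : 0 < R) (hm : 1 < m) :
    fS R η m 0 = (1 + R) * (m * √m) * phiS R η m := by
  have hb : bS R m 0 = √((1 + R) / (m + R)) * √m := by
    rw [← Real.sqrt_mul (by apply div_nonneg <;> linarith)]
    unfold bS; congr 1; ring
  have hg : gS m 0 = √m := by simp [gS]
  have h1 : √m ^ 2 = m := Real.sq_sqrt (by linarith)
  have h2 : (m + R) * √((1 + R) / (m + R)) ^ 2 = 1 + R := by
    rw [Real.sq_sqrt (by apply div_nonneg <;> linarith)]
    field_simp [(by linarith : m + R ≠ 0)]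
  have h3 : 0 < √m := Real.sqrt_pos.2 (by linarith)
  unfold fS phiS
  rw [hb, hg]
  generalize √((1 + R) / (m + R)) = u at *
  generalize √m = v at *
  subst h1
  field_simp
  linear_combination u * v ^ 3 * h2

theorem phiS_anti {R : ℝ} (η : ℝ) (hR : 0 < R) : StrictAntiOn (phiS R η) (Set.Ioi 0) := by
  intro x hx y hy hxy
  simp only [Set.mem_Ioi] at hx hy
  unfold phiS
  have h1 : √((1 + R) / (y + R)) ≤ √((1 + R) / (x + R)) := by
    apply Real.sqrt_le_sqrt
    apply div_le_div_of_nonneg_left <;> linarith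
  have h2 : (1 + η ^ 2) / √y < (1 + η ^ 2) / √x := by
    apply div_lt_div_of_pos_left (by positivity) (Real.sqrt_pos.2 hx)
    exact Real.sqrt_lt_sqrt hx.le hxy
  linarith

theorem phiS_root {R η : ℝ} (hR : 0 < R) (hη : 0 < η) :
    ∃ M, ((1 + η ^ 2) / η ^ 2) ^ 2 < M ∧ phiS R η M = 0 := by
  set K := ((1 + η ^ 2) / η ^ 2) ^ 2 with hK
  have hK0 : 0 < K := by positivity
  have hpos : 0 < phiS R η K := by
    unfold phiS
    have : √K = (1 + η ^ 2) / η ^ 2 := Real.sqrt_sq (by positivity)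
    rw [this]
    have e : (1 + η ^ 2) / ((1 + η ^ 2) / η ^ 2) = η ^ 2 := by field_simp
    rw [e]
    have : 0 < √((1 + R) / (K + R)) := by positivity
    linarith
  set L := ((√(1 + R) + 1 + η ^ 2) / η ^ 2) ^ 2 with hL
  have hL0 : 0 < L := by positivity
  have hneg : phiS R η L ≤ 0 := by
    unfold phiS
    have h2 : √L = (√(1 + R) + 1 + η ^ 2) / η ^ 2 := Real.sqrt_sq (by positivity)
    have h1 : √((1 + R) / (L + R)) ≤ √(1 + R) / √L := by
      rw [← Real.sqrt_div (by positivity)]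
      apply Real.sqrt_le_sqrt
      apply div_le_div_of_nonneg_left <;> linarith
    have h3 : √(1 + R) / √L + (1 + η ^ 2) / √L = η ^ 2 := by
      rw [h2, ← add_div, ← add_assoc]
      field_simp
    linarith
  have hKL : K ≤ L := by
    by_contra h
    push Not at h
    have := phiS_anti η hR hL0 hK0 h
    linarith
  have hc : ContinuousOn (phiS R η) (Set.Icc K L) := by
    intro x hx
    have hx0 : 0 < x := by linarith [hx.1]
    apply ContinuousAt.continuousWithinAt
    unfold phiS
    have : √x ≠ 0 := (Real.sqrt_pos.2 hx0).ne'
    have : x + R ≠ 0 := by linarith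
    fun_prop (disch := assumption)
  obtain ⟨M, hM, h⟩ := intermediate_value_Icc' hKL hc ⟨hneg, hpos.le⟩
  refine ⟨M, lt_of_le_of_ne hM.1 ?_, h⟩
  intro h'
  rw [← h'] at h
  linarith

theorem S2_forward {R η m β₁ α β γ : ℝ} (hR : 0 < R) (hm : 1 < m)
    (hb1 : β₁ < 0) (h0 : 0 ≤ α) (h1 : α < β) (h2 : β < γ)
    (h : SystemS2 R (m + R) η β₁ α β γ) :
    ∃ t, 0 ≤ t ∧ t < 1 ∧ fS R η m t = 0 ∧ α = t * β ∧ γ = gS m t * β ∧ β₁ = -(bS R m t * β) ∧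
      β ^ 3 * (gS m t ^ 3 - m + (m - 1) * t ^ 3) = 9 * (m + R) := by
  have hβ : 0 < β := by linarith
  obtain ⟨e1, e2, e3, e4⟩ := h
  obtain ⟨t, rfl⟩ : ∃ t, α = t * β := ⟨α / β, by field_simp⟩
  have ht0 : 0 ≤ t := nonneg_of_mul_nonneg_left h0 hβ
  have ht1 : t < 1 := by
    by_contra hc
    push Not at hc
    nlinarith
  have gs := gS_sq hm ht0 ht1.le
  have bs := bS_sq hR hm ht0 ht1.le
  have g1 := gS_ge hm ht0 ht1.le
  have b1 := bS_ge hR hm ht0 ht1.le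
  have hγ : γ = gS m t * β := by
    apply (pow_left_inj₀ (by linarith) (by positivity) two_ne_zero).1
    linear_combination e3 - β ^ 2 * gs
  have hb : -β₁ = bS R m t * β := by
    apply (pow_left_inj₀ (by linarith) (by positivity) two_ne_zero).1
    apply mul_left_cancel₀ (by linarith : m + R ≠ 0)
    linear_combination e4 - β ^ 2 * bs
  have hb' : β₁ = -(bS R m t * β) := by linarith
  subst hγ hb'
  refine ⟨t, ht0, ht1, ?_, rfl, rfl, rfl, ?_⟩
  · apply mul_left_cancel₀ (pow_pos hβ 3).ne'
    unfold fS
    linear_combination -e1 - η ^ 2 * (1 + R) * e2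
  · linear_combination e2

theorem S2_backward {R η m t β : ℝ} (hR : 0 < R) (hm : 1 < m) (ht0 : 0 ≤ t) (ht1 : t < 1)
    (hF : fS R η m t = 0)
    (hβ : β ^ 3 * (gS m t ^ 3 - m + (m - 1) * t ^ 3) = 9 * (m + R)) :
    SystemS2 R (m + R) η (-(bS R m t * β)) (t * β) β (gS m t * β) := by
  have gs := gS_sq hm ht0 ht1.le
  have bs := bS_sq hR hm ht0 ht1.le
  unfold fS at hF
  refine ⟨?_, ?_, ?_, ?_⟩
  · linear_combination -β ^ 3 * hF - η ^ 2 * (1 + R) * hβ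
  · linear_combination hβ
  · linear_combination β ^ 2 * gs
  · linear_combination β ^ 2 * bs

/-- Lemma A.2: there is a threshold `RμM > Rμ⁺(R,η)` such that system (S2) has a unique
solution with `β₁ < 0 ≤ α < β < γ` exactly when `Rμ ≥ RμM`; the solution satisfies
`−β₁ > α`, with `α = 0` iff `Rμ = RμM`; for `R + 1 < Rμ < RμM` no such solution exists. -/
theorem systemS2_solvability (R η : ℝ) (hR : 0 < R) (hη : 0 < η) :
    ∃ RμM : ℝ, R + ((1 + η ^ 2) / η ^ 2) ^ 2 < RμM ∧
      (∀ Rμ : ℝ, RμM ≤ Rμ →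
        (∃! q : ℝ × ℝ × ℝ × ℝ,
          q.1 < 0 ∧ 0 ≤ q.2.1 ∧ q.2.1 < q.2.2.1 ∧ q.2.2.1 < q.2.2.2 ∧
          SystemS2 R Rμ η q.1 q.2.1 q.2.2.1 q.2.2.2) ∧
        (∀ β₁ α β γ : ℝ, β₁ < 0 → 0 ≤ α → α < β → β < γ →
          SystemS2 R Rμ η β₁ α β γ → α < -β₁ ∧ (α = 0 ↔ Rμ = RμM))) ∧
      (∀ Rμ : ℝ, R + 1 < Rμ → Rμ < RμM →
        ¬ ∃ β₁ α β γ : ℝ, β₁ < 0 ∧ 0 ≤ α ∧ α < β ∧ β < γ ∧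
          SystemS2 R Rμ η β₁ α β γ) := by
  obtain ⟨M, hKM, hM⟩ := phiS_root hR hη
  have hM1 : 1 < M := by
    have : 1 < (1 + η ^ 2) / η ^ 2 := by
      rw [lt_div_iff₀ (by positivity)]; linarith
    nlinarith
  have hiff : ∀ m, 1 < m → (fS R η m 0 ≤ 0 ↔ M ≤ m) := by
    intro m hm
    have hp : 0 < (1 + R) * (m * √m) :=
      mul_pos (by linarith) (mul_pos (by linarith) (Real.sqrt_pos.2 (by linarith)))
    rw [fS_zero η hR hm, mul_nonpos_iff_pos_imp_nonpos, ← hM]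
    have h := (phiS_anti η hR).le_iff_ge (a := m) (b := M) (by simp; linarith) (by simp; linarith)
    rw [← h, hM]
    constructor
    · intro h'; exact h'.1 hp
    · intro h'; exact ⟨fun _ => h', fun h2 => by linarith⟩
  have hiff0 : ∀ m, 1 < m → (fS R η m 0 = 0 ↔ m = M) := by
    intro m hm
    have hp : 0 < (1 + R) * (m * √m) :=
      mul_pos (by linarith) (mul_pos (by linarith) (Real.sqrt_pos.2 (by linarith)))
    rw [fS_zero η hR hm, mul_eq_zero, or_iff_right hp.ne', ← hM]
    exact (phiS_anti η hR).injOn.eq_iff (by simp; linarith) (by simp; linarith)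
  refine ⟨R + M, by linarith, ?_, ?_⟩
  · intro Rμ hRμ
    obtain ⟨m, rfl⟩ : ∃ m, Rμ = m + R := ⟨Rμ - R, by ring⟩
    have hm : 1 < m := by linarith
    obtain ⟨t, ht0, ht1, ht⟩ := fS_exists (η := η) hR hm ((hiff m hm).2 (by linarith))
    have hG := GS_pos hm ht0 ht1
    refine ⟨?_, ?_⟩
    · obtain ⟨β, hβ0, hβ⟩ : ∃ β : ℝ, 0 < β ∧
          β ^ 3 * (gS m t ^ 3 - m + (m - 1) * t ^ 3) = 9 * (m + R) := by
        have hq : 0 < 9 * (m + R) / (gS m t ^ 3 - m + (m - 1) * t ^ 3) :=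
          div_pos (by linarith) hG
        refine ⟨(9 * (m + R) / (gS m t ^ 3 - m + (m - 1) * t ^ 3)) ^ ((3 : ℕ) : ℝ)⁻¹,
          Real.rpow_pos_of_pos hq _, ?_⟩
        rw [Real.rpow_inv_natCast_pow hq.le (by norm_num), div_mul_cancel₀ _ hG.ne']
      have hb := bS_ge hR hm ht0 ht1.le
      have hg : 1 < gS m t := by
        have := gS_ge hm ht0 ht1.le
        have hs := gS_sq hm ht0 ht1.le
        have h2 : t ^ 2 < 1 := by nlinarith
        nlinarith [mul_pos (sub_pos.2 hm) (sub_pos.2 h2)]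
      refine ⟨(-(bS R m t * β), t * β, β, gS m t * β), ⟨?_, ?_, ?_, ?_, ?_⟩, ?_⟩
      · have : 0 < bS R m t * β := mul_pos (by linarith) hβ0
        simpa using this
      · exact mul_nonneg ht0 hβ0.le
      · show t * β < β
        nlinarith
      · show β < gS m t * β
        nlinarith
      · exact S2_backward hR hm ht0 ht1 ht hβ
      · rintro ⟨x, a, b, c⟩ ⟨h1, h2, h3, h4, h5⟩
        simp only at h1 h2 h3 h4 h5
        obtain ⟨s, hs0, hs1, hs, rfl, rfl, rfl, hb3⟩ := S2_forward hR hm h1 h2 h3 h4 h5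
        obtain rfl := fS_uniq hR hm hs0 hs1 ht0 ht1 hs ht
        have : b = β := by
          apply (pow_left_inj₀ (by linarith) hβ0.le three_ne_zero).1
          exact mul_right_cancel₀ hG.ne' (hb3.trans hβ.symm)
        rw [this]
    · intro β₁ α β γ h1 h2 h3 h4 h5
      obtain ⟨s, hs0, hs1, hs, rfl, rfl, rfl, hb3⟩ := S2_forward hR hm h1 h2 h3 h4 h5
      have hb := bS_ge hR hm hs0 hs1.le
      have hβ0 : 0 < β := by linarith
      refine ⟨by nlinarith, ?_⟩
      rw [mul_eq_zero, or_iff_left hβ0.ne']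
      have : (m + R = R + M) ↔ m = M := by constructor <;> intro h <;> linarith
      rw [this, ← hiff0 m hm]
      constructor
      · rintro rfl; exact hs
      · intro h; exact fS_uniq hR hm hs0 hs1 le_rfl one_pos hs h
  · rintro Rμ hR1 hR2 ⟨β₁, α, β, γ, h1, h2, h3, h4, h5⟩
    obtain ⟨m, rfl⟩ : ∃ m, Rμ = m + R := ⟨Rμ - R, by ring⟩
    have hm : 1 < m := by linarith
    obtain ⟨s, hs0, hs1, hs, -⟩ := S2_forward hR hm h1 h2 h3 h4 h5
    have := (hiff m hm).1 (fS_zero_le hR hm hs0 hs1 hs)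
    linarith
end

section
/- (Characterization of the upper threshold RμM) Let R and η be positive reals. There exists a unique real number s with s > R + 1 satisfying √(s − R)·(η² − √((1+R)/s)) = 1 + η²; moreover this unique s satisfies s > Rμ⁺(R,η). -/
theorem aux_mono (R η a b : ℝ) (hR : 0 < R) (ha : R + 1 < a) (hab : a < b)
    (h : Real.sqrt (a - R) * (η ^ 2 - Real.sqrt ((1 + R) / a)) = 1 + η ^ 2) :
    1 + η ^ 2 < Real.sqrt (b - R) * (η ^ 2 - Real.sqrt ((1 + R) / b)) := by
  have h1 : 0 < Real.sqrt (a - R) := Real.sqrt_pos.2 (by linarith)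
  have h2 : 0 < η ^ 2 - Real.sqrt ((1 + R) / a) := by
    by_contra hc
    nlinarith [sq_nonneg η]
  have h3 : Real.sqrt (a - R) < Real.sqrt (b - R) :=
    Real.sqrt_lt_sqrt (by linarith) (by linarith)
  have h4 : Real.sqrt ((1 + R) / b) ≤ Real.sqrt ((1 + R) / a) := by
    apply Real.sqrt_le_sqrt
    apply div_le_div_of_nonneg_left <;> linarith
  rw [← h]
  exact mul_lt_mul h3 (by linarith) h2 (by linarith)

/-- Characterization of the upper threshold `RμM(R,η)`: the equation
`√(s − R)·(η² − √((1+R)/s)) = 1 + η²` has a unique solution `s > R + 1`, and this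
solution is larger than `Rμ⁺(R,η) = R + ((1+η²)/η²)²`. -/
theorem upper_threshold_exists_unique (R η : ℝ) (hR : 0 < R) (hη : 0 < η) :
    ∃ s : ℝ, (R + 1 < s ∧
        Real.sqrt (s - R) * (η ^ 2 - Real.sqrt ((1 + R) / s)) = 1 + η ^ 2) ∧
      (∀ t : ℝ, R + 1 < t →
        Real.sqrt (t - R) * (η ^ 2 - Real.sqrt ((1 + R) / t)) = 1 + η ^ 2 → t = s) ∧
      R + ((1 + η ^ 2) / η ^ 2) ^ 2 < s := by
  have hη2 : 0 < η ^ 2 := by positivity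
  set F : ℝ → ℝ := fun s => Real.sqrt (s - R) * (η ^ 2 - Real.sqrt ((1 + R) / s)) with hF
  set S : ℝ := R + 1 + 4 * (1 + R) / (η ^ 2) ^ 2 + (2 * (1 + η ^ 2) / η ^ 2) ^ 2 with hS
  have p1 : 0 < 4 * (1 + R) / (η ^ 2) ^ 2 := by positivity
  have p2 : 0 < (2 * (1 + η ^ 2) / η ^ 2) ^ 2 := by positivity
  have hRS : R + 1 ≤ S := by linarith
  have hcont : ContinuousOn F (Set.Icc (R + 1) S) := by
    have hd : ContinuousOn (fun s : ℝ => (1 + R) / s) (Set.Icc (R + 1) S) :=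
      continuousOn_const.div continuousOn_id (fun x hx => by
        have := hx.1
        exact ne_of_gt (by linarith))
    exact ((continuousOn_id.sub continuousOn_const).sqrt).mul (continuousOn_const.sub hd.sqrt)
  have hF1 : F (R + 1) = η ^ 2 - 1 := by
    have e1 : R + 1 - R = 1 := by ring
    have e2 : (1 + R) / (R + 1) = 1 := by rw [add_comm]; exact div_self (by linarith)
    simp only [hF, e1, e2, Real.sqrt_one, one_mul]
  have hF2 : 1 + η ^ 2 ≤ F S := by
    have q1 : 2 * (1 + η ^ 2) / η ^ 2 ≤ Real.sqrt (S - R) :=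
      Real.le_sqrt_of_sq_le (by linarith)
    have q2 : Real.sqrt ((1 + R) / S) ≤ η ^ 2 / 2 := by
      apply Real.sqrt_le_iff.2
      refine ⟨by positivity, ?_⟩
      rw [div_le_iff₀ (by linarith)]
      have : (η ^ 2 / 2) ^ 2 * (4 * (1 + R) / (η ^ 2) ^ 2) = 1 + R := by
        field_simp
        try norm_num
      rw [← this]
      apply mul_le_mul_of_nonneg_left _ (by positivity)
      linarith
    calc 1 + η ^ 2 = (2 * (1 + η ^ 2) / η ^ 2) * (η ^ 2 / 2) := by field_simp
      _ ≤ F S := mul_le_mul q1 (by linarith) (by positivity) (Real.sqrt_nonneg _)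
  obtain ⟨s, hs, hFs⟩ := intermediate_value_Icc hRS hcont
    (show 1 + η ^ 2 ∈ Set.Icc (F (R + 1)) (F S) from ⟨by linarith, hF2⟩)
  have hs1 : R + 1 < s := by
    rcases hs.1.lt_or_eq with h | h
    · exact h
    · rw [← h, hF1] at hFs
      linarith
  refine ⟨s, ⟨hs1, hFs⟩, ?_, ?_⟩
  · intro t ht hFt
    rcases lt_trichotomy t s with h | h | h
    · have := aux_mono R η t s hR ht h hFt
      exact absurd hFs this.ne'
    · exact h
    · have := aux_mono R η s t hR hs1 h hFs
      exact absurd hFt this.ne'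
  · have h1 : 0 < Real.sqrt (s - R) := Real.sqrt_pos.2 (by linarith)
    have h2 : 0 < Real.sqrt ((1 + R) / s) :=
      Real.sqrt_pos.2 (div_pos (by linarith) (by linarith))
    have h3 : (1 + η ^ 2) / η ^ 2 < Real.sqrt (s - R) := by
      rw [div_lt_iff₀ hη2]
      have : Real.sqrt (s - R) * (η ^ 2 - Real.sqrt ((1 + R) / s)) = 1 + η ^ 2 := hFs
      nlinarith [mul_pos h1 h2]
    have := (Real.lt_sqrt (by positivity)).1 h3
    linarith
end

section
/- (Characterization of the lower threshold Rμm) Let R and η be positive reals. There exists a unique real number s with 0 < s < R satisfying √(1+R−s)·(√(R/s) − η²(1+R)/R) = 1 + η²(1+R)/R; moreover this unique s satisfies s < Rμ⁻(R,η) := R³(1+R)/(R³ + (η²(1+R)+R)²). -/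
theorem aux_anti (R a s t : ℝ) (ha : 0 < a) (ht : 0 < t) (hts : t < s) (hs : s < R)
    (h : Real.sqrt (1 + R - s) * (Real.sqrt (R / s) - a) = 1 + a) :
    1 + a < Real.sqrt (1 + R - t) * (Real.sqrt (R / t) - a) := by
  have h1 : 0 < Real.sqrt (1 + R - s) := Real.sqrt_pos.mpr (by linarith)
  have h2 : 0 < Real.sqrt (R / s) - a := by
    by_contra hc
    push Not at hc
    nlinarith [mul_nonneg h1.le (neg_nonneg.mpr hc)]
  have h3 : Real.sqrt (1 + R - s) < Real.sqrt (1 + R - t) :=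
    Real.sqrt_lt_sqrt (by linarith) (by linarith)
  have h4 : Real.sqrt (R / s) < Real.sqrt (R / t) := by
    have : 0 < R := by linarith
    apply Real.sqrt_lt_sqrt
    · have : 0 < s := by linarith
      positivity
    · exact div_lt_div_of_pos_left this ht hts
  rw [← h]
  exact mul_lt_mul'' h3 (by linarith) h1.le h2.le

theorem aux_main (R a : ℝ) (hR : 0 < R) (ha : 0 < a) :
    ∃ s : ℝ, ((0 < s ∧ s < R) ∧
        Real.sqrt (1 + R - s) * (Real.sqrt (R / s) - a) = 1 + a) ∧
      (∀ t : ℝ, 0 < t → t < R →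
        Real.sqrt (1 + R - t) * (Real.sqrt (R / t) - a) = 1 + a → t = s) ∧
      s < R * (1 + R) / (R + (1 + a) ^ 2) := by
  set s0 := R * (1 + R) / (R + (1 + a) ^ 2) with hs0
  set e := R / (1 + 2 * a) ^ 2 with he
  have he0 : 0 < e := by positivity
  have hes : e ≤ s0 := by
    rw [he, hs0, div_le_div_iff₀ (by positivity) (by positivity), mul_assoc]
    apply mul_le_mul_of_nonneg_left _ hR.le
    nlinarith [mul_pos hR ha, mul_pos hR (mul_pos ha ha), mul_pos ha ha]
  have hs0R : s0 < R := by
    rw [hs0, div_lt_iff₀ (by positivity)]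
    apply mul_lt_mul_of_pos_left _ hR
    nlinarith
  have hfe : 1 + a ≤ Real.sqrt (1 + R - e) * (Real.sqrt (R / e) - a) := by
    have h1 : R / e = (1 + 2 * a) ^ 2 := by rw [he]; field_simp
    rw [h1, Real.sqrt_sq (by positivity)]
    have h2 : 1 ≤ Real.sqrt (1 + R - e) := Real.one_le_sqrt.mpr (by linarith)
    nlinarith
  have hfs : Real.sqrt (1 + R - s0) * (Real.sqrt (R / s0) - a) < 1 + a := by
    have h1 : Real.sqrt (1 + R - s0) * Real.sqrt (R / s0) = 1 + a := by
      rw [← Real.sqrt_mul (by linarith)]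
      have : (1 + R - s0) * (R / s0) = (1 + a) ^ 2 := by
        rw [hs0]; field_simp; ring
      rw [this, Real.sqrt_sq (by positivity)]
    have h2 : 0 < Real.sqrt (1 + R - s0) := Real.sqrt_pos.mpr (by linarith)
    nlinarith [mul_pos h2 ha]
  have hcont : ContinuousOn
      (fun s : ℝ => Real.sqrt (1 + R - s) * (Real.sqrt (R / s) - a)) (Set.Icc e s0) := by
    have hd : ContinuousOn (fun s : ℝ => R / s) (Set.Icc e s0) :=
      continuousOn_const.div continuousOn_id (fun x hx => (lt_of_lt_of_le he0 hx.1).ne')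
    exact (by fun_prop : Continuous fun s : ℝ => Real.sqrt (1 + R - s)).continuousOn.mul
      (hd.sqrt.sub continuousOn_const)
  obtain ⟨s, hs, hfeq⟩ := intermediate_value_Icc' hes hcont ⟨hfs.le, hfe⟩
  have hfeq : Real.sqrt (1 + R - s) * (Real.sqrt (R / s) - a) = 1 + a := hfeq
  have hspos : 0 < s := lt_of_lt_of_le he0 hs.1
  have hsR : s < R := lt_of_le_of_lt hs.2 hs0R
  refine ⟨s, ⟨⟨hspos, hsR⟩, hfeq⟩, ?_, ?_⟩
  · intro t ht htR hft
    rcases lt_trichotomy t s with h | h | h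
    · exact absurd hft (aux_anti R a s t ha ht h hsR hfeq).ne'
    · exact h
    · exact absurd hfeq (aux_anti R a t s ha hspos h htR hft).ne'
  · rcases lt_or_eq_of_le hs.2 with h | h
    · exact h
    · rw [h] at hfeq
      exact absurd hfeq hfs.ne


/-- Characterization of the lower threshold `Rμm(R,η)`: the equation
`√(1+R−s)·(√(R/s) − η²(1+R)/R) = 1 + η²(1+R)/R` has a unique solution `0 < s < R`, and
this solution is smaller than `Rμ⁻(R,η) = R³(1+R)/(R³ + (η²(1+R)+R)²)`. -/
theorem lower_threshold_exists_unique (R η : ℝ) (hR : 0 < R) (hη : 0 < η) :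
    ∃ s : ℝ, ((0 < s ∧ s < R) ∧
        Real.sqrt (1 + R - s) * (Real.sqrt (R / s) - η ^ 2 * (1 + R) / R)
          = 1 + η ^ 2 * (1 + R) / R) ∧
      (∀ t : ℝ, 0 < t → t < R →
        Real.sqrt (1 + R - t) * (Real.sqrt (R / t) - η ^ 2 * (1 + R) / R)
          = 1 + η ^ 2 * (1 + R) / R → t = s) ∧
      s < R ^ 3 * (1 + R) / (R ^ 3 + (η ^ 2 * (1 + R) + R) ^ 2) := by
  have key : R ^ 3 * (1 + R) / (R ^ 3 + (η ^ 2 * (1 + R) + R) ^ 2)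
      = R * (1 + R) / (R + (1 + η ^ 2 * (1 + R) / R) ^ 2) := by
    rw [div_eq_div_iff (by positivity) (by positivity)]
    field_simp
    ring
  rw [key]
  exact aux_main R (η ^ 2 * (1 + R) / R) hR (by positivity)
end

section
/- (Lemma A.3(i)) Let R, Rμ, η be positive reals with Rμ > R + 1, and let (γ₁, β₁, α₁, α, β, γ) ∈ ℝ⁶ be a solution of system (S3) satisfying γ₁ ≤ β₁ ≤ α₁ ≤ 0 ≤ α ≤ β ≤ γ. If γ₁ = β₁ or β₁ = α₁, then γ₁ = β₁ = α₁ < 0 ≤ α < β < γ, and the quadruple (β₁, α, β, γ) is a solution of system (S2). -/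
/-- System (S3) of algebraic equations determining the non-symmetric self-similar
profiles with disconnected supports. -/
def SystemS3 (R Rμ η γ₁ β₁ α₁ α β γ : ℝ) : Prop :=
  γ₁ ^ 2 - (Rμ - R) * β₁ ^ 2 + (Rμ - R - 1) * α₁ ^ 2 = 0 ∧
  γ ^ 2 - (Rμ - R) * β ^ 2 + (Rμ - R - 1) * α ^ 2 = 0 ∧
  R * (γ₁ ^ 2 - γ ^ 2) + (Rμ - R) * (β₁ ^ 2 - β ^ 2) = 0 ∧
  (Rμ - R) * (β ^ 3 - β₁ ^ 3) - R * (Rμ - R - 1) / (1 + R) * (α ^ 3 - α₁ ^ 3)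
    = 9 * η ^ 2 * Rμ ∧
  (γ ^ 3 - γ₁ ^ 3) - (Rμ - R) * (β ^ 3 - β₁ ^ 3) + (Rμ - R - 1) * (α ^ 3 - α₁ ^ 3)
    = 9 * Rμ

/-- Lemma A.3(i): an ordered solution of (S3) with `γ₁ = β₁` or `β₁ = α₁` collapses to
`γ₁ = β₁ = α₁ < 0 ≤ α < β < γ` and yields a solution of (S2). -/
theorem systemS3_collapse_left (R Rμ η : ℝ)
    (hR : 0 < R) (hRμ : 0 < Rμ) (hη : 0 < η) (hgt : R + 1 < Rμ)
    (γ₁ β₁ α₁ α β γ : ℝ)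
    (hord : γ₁ ≤ β₁ ∧ β₁ ≤ α₁ ∧ α₁ ≤ 0 ∧ 0 ≤ α ∧ α ≤ β ∧ β ≤ γ)
    (hsol : SystemS3 R Rμ η γ₁ β₁ α₁ α β γ)
    (hcase : γ₁ = β₁ ∨ β₁ = α₁) :
    γ₁ = β₁ ∧ β₁ = α₁ ∧ α₁ < 0 ∧ 0 ≤ α ∧ α < β ∧ β < γ ∧
    SystemS2 R Rμ η β₁ α β γ := by
  obtain ⟨o1, o2, o3, o4, o5, o6⟩ := hord
  obtain ⟨e1, e2, e3, e4, e5⟩ := hsol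
  have hc : 0 < Rμ - R - 1 := by linarith
  have key : γ₁ = β₁ ∧ β₁ = α₁ := by
    rcases hcase with h | h
    · refine ⟨h, ?_⟩
      subst h
      have h1 : (Rμ - R - 1) * (α₁ ^ 2 - γ₁ ^ 2) = 0 := by linarith
      have h2 : α₁ ^ 2 - γ₁ ^ 2 = 0 := (mul_eq_zero.mp h1).resolve_left hc.ne'
      have h3 : (-γ₁) ^ 2 = (-α₁) ^ 2 := by linarith
      have h4 := (pow_left_inj₀ (by linarith) (by linarith) two_ne_zero).mp h3
      linarith
    · refine ⟨?_, h⟩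
      subst h
      have h3 : (-γ₁) ^ 2 = (-β₁) ^ 2 := by linarith
      have h4 := (pow_left_inj₀ (by linarith) (by linarith) two_ne_zero).mp h3
      linarith
  obtain ⟨k1, k2⟩ := key
  subst k1
  subst k2
  have f5 : γ ^ 3 - (Rμ - R) * β ^ 3 + (Rμ - R - 1) * α ^ 3 = 9 * Rμ := by linarith
  have hab : α ≠ β := by
    intro h
    subst h
    have h3 : γ ^ 2 = α ^ 2 := by linarith
    have h4 := (pow_left_inj₀ (by linarith) (by linarith) two_ne_zero).mp h3
    subst h4
    linarith
  have hbg : β ≠ γ := by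
    intro h
    subst h
    have h1 : (Rμ - R - 1) * (α ^ 2 - β ^ 2) = 0 := by linarith
    have h2 : α ^ 2 - β ^ 2 = 0 := (mul_eq_zero.mp h1).resolve_left hc.ne'
    have h3 : α ^ 2 = β ^ 2 := by linarith
    exact hab ((pow_left_inj₀ (by linarith) (by linarith) two_ne_zero).mp h3)
  have hab' := lt_of_le_of_ne o5 hab
  have hbg' := lt_of_le_of_ne o6 hbg
  refine ⟨rfl, rfl, lt_of_le_of_ne o3 ?_, o4, hab', hbg', ?_, f5, e2, ?_⟩
  · intro h
    subst h
    have hγ : 0 < γ := by linarith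
    have h1 : 0 < R * γ ^ 2 := by positivity
    have h2 : 0 ≤ (Rμ - R) * β ^ 2 := mul_nonneg (by linarith) (sq_nonneg _)
    linarith
  · have hR1 : (1 + R) ≠ 0 := by linarith
    field_simp at e4
    linarith
  · linear_combination e3 + R * e2
end

section
/- (Lemma A.3(ii)) Let R, Rμ, η be positive reals with Rμ > R + 1, and let (γ₁, β₁, α₁, α, β, γ) ∈ ℝ⁶ be a solution of system (S3) satisfying γ₁ ≤ β₁ ≤ α₁ ≤ 0 ≤ α ≤ β ≤ γ. If γ = β or β = α, then γ₁ < β₁ < α₁ ≤ 0 < α = β = γ, and the quadruple (−α, −α₁, −β₁, −γ₁) is a solution of system (S2). -/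
/-- Lemma A.3(ii): an ordered solution of (S3) with `γ = β` or `β = α` collapses to
`γ₁ < β₁ < α₁ ≤ 0 < α = β = γ` and yields, after reflection, a solution of (S2). -/
theorem systemS3_collapse_right (R Rμ η : ℝ)
    (hR : 0 < R) (hRμ : 0 < Rμ) (hη : 0 < η) (hgt : R + 1 < Rμ)
    (γ₁ β₁ α₁ α β γ : ℝ)
    (hord : γ₁ ≤ β₁ ∧ β₁ ≤ α₁ ∧ α₁ ≤ 0 ∧ 0 ≤ α ∧ α ≤ β ∧ β ≤ γ)
    (hsol : SystemS3 R Rμ η γ₁ β₁ α₁ α β γ)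
    (hcase : γ = β ∨ β = α) :
    γ₁ < β₁ ∧ β₁ < α₁ ∧ α₁ ≤ 0 ∧ 0 < α ∧ α = β ∧ β = γ ∧
    SystemS2 R Rμ η (-α) (-α₁) (-β₁) (-γ₁) := by
  obtain ⟨o1, o2, o3, o4, o5, o6⟩ := hord
  obtain ⟨e1, e2, e3, e4, e5⟩ := hsol
  have ha : 0 < Rμ - R - 1 := by linarith
  have hαβ : α = β := by
    rcases hcase with h | h
    · subst h
      have h1 : (Rμ - R - 1) * (α ^ 2 - γ ^ 2) = 0 := by linarith
      have h2 : α ^ 2 - γ ^ 2 = 0 := (mul_eq_zero.mp h1).resolve_left ha.ne'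
      exact (pow_left_inj₀ o4 (by linarith) two_ne_zero).mp (by linarith)
    · exact h.symm
  subst hαβ
  have hγ : γ = α := by
    have h2 : γ ^ 2 = α ^ 2 := by linarith
    exact (pow_left_inj₀ (by linarith) (by linarith) two_ne_zero).mp h2
  subst hγ
  have key : ¬ (γ₁ = β₁ ∧ β₁ = α₁) := by
    rintro ⟨h, h'⟩
    subst h'
    subst h
    have h3 : (9 : ℝ) * Rμ = 0 := by rw [← e5]; ring
    linarith
  have s1 : γ₁ ≠ β₁ := by
    intro h
    refine key ⟨h, ?_⟩
    subst h
    have h1 : (Rμ - R - 1) * (α₁ ^ 2 - γ₁ ^ 2) = 0 := by linarith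
    have h2 : α₁ ^ 2 - γ₁ ^ 2 = 0 := (mul_eq_zero.mp h1).resolve_left ha.ne'
    have h3 : -γ₁ = -α₁ :=
      (pow_left_inj₀ (by linarith) (by linarith) two_ne_zero).mp
        (by linarith [neg_sq γ₁, neg_sq α₁])
    linarith
  have s2 : β₁ ≠ α₁ := by
    intro h
    refine key ⟨?_, h⟩
    subst h
    have h2 : γ₁ ^ 2 = β₁ ^ 2 := by linarith
    have h3 : -γ₁ = -β₁ :=
      (pow_left_inj₀ (by linarith) (by linarith) two_ne_zero).mp
        (by linarith [neg_sq γ₁, neg_sq β₁])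
    linarith
  have l1 := lt_of_le_of_ne o1 s1
  have l2 := lt_of_le_of_ne o2 s2
  have hpos : 0 < γ := by
    rcases o4.lt_or_eq with h | h
    · exact h
    · exfalso
      subst h
      have hb : β₁ < 0 := by linarith
      have p1 : 0 < (Rμ - R) * β₁ ^ 2 := mul_pos (by linarith) (by have := hb.ne; positivity)
      have p2 : 0 ≤ R * γ₁ ^ 2 := by positivity
      linarith
  refine ⟨l1, l2, o3, hpos, rfl, rfl, ?_, ?_, ?_, ?_⟩
  · have hR1 : (1 + R) ≠ 0 := by linarith
    field_simp at e4
    linarith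
  · linarith
  · linarith
  · linear_combination R * e1 - e3
end

section
/- (Lemma A.3(iii)) Let R, Rμ, η be positive reals with Rμ > R + 1, and let (γ₁, β₁, α₁, α, β, γ) ∈ ℝ⁶ be a solution of system (S3) satisfying γ₁ ≤ β₁ ≤ α₁ ≤ 0 ≤ α ≤ β ≤ γ. If α₁ = −α, then γ₁ = −γ, β₁ = −β, 0 ≤ α < β < γ, and the triple (α, β, γ) is a solution of system (S1). -/
/-- Lemma A.3(iii): an ordered solution of (S3) with `α₁ = −α` is symmetric,
`γ₁ = −γ`, `β₁ = −β`, `0 ≤ α < β < γ`, and `(α, β, γ)` solves (S1). -/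
theorem systemS3_symmetric (R Rμ η : ℝ)
    (hR : 0 < R) (hRμ : 0 < Rμ) (hη : 0 < η) (hgt : R + 1 < Rμ)
    (γ₁ β₁ α₁ α β γ : ℝ)
    (hord : γ₁ ≤ β₁ ∧ β₁ ≤ α₁ ∧ α₁ ≤ 0 ∧ 0 ≤ α ∧ α ≤ β ∧ β ≤ γ)
    (hsol : SystemS3 R Rμ η γ₁ β₁ α₁ α β γ)
    (hcase : α₁ = -α) :
    γ₁ = -γ ∧ β₁ = -β ∧ 0 ≤ α ∧ α < β ∧ β < γ ∧
    SystemS1 R Rμ η α β γ := by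
  obtain ⟨h1, h2, h3, h4, h5, h6⟩ := hord
  obtain ⟨e1, e2, e3, e4, e5⟩ := hsol
  subst hcase
  have hm : 0 < Rμ - R - 1 := by linarith
  have hb : β₁ = -β := by
    have h : ((R + 1) * (Rμ - R)) * (β₁ ^ 2 - β ^ 2) = 0 := by
      linear_combination e3 - R * e1 + R * e2
    have hne : (R + 1) * (Rμ - R) ≠ 0 := by
      apply ne_of_gt
      apply mul_pos <;> linarith
    have h' : β₁ ^ 2 = β ^ 2 := by
      have := (mul_eq_zero.mp h).resolve_left hne
      linarith
    rcases sq_eq_sq_iff_eq_or_eq_neg.mp h' with h | h <;> linarith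
  subst hb
  have hg : γ₁ = -γ := by
    have h' : γ₁ ^ 2 = γ ^ 2 := by linear_combination e1 - e2
    rcases sq_eq_sq_iff_eq_or_eq_neg.mp h' with h | h <;> linarith
  subst hg
  have hab : α < β := by
    refine lt_of_le_of_ne h5 ?_
    intro h
    subst h
    have h' : γ ^ 2 = α ^ 2 := by linear_combination e2
    have hga : γ = α := by
      rcases sq_eq_sq_iff_eq_or_eq_neg.mp h' with h | h <;> linarith
    subst hga
    have : 9 * Rμ = 0 := by linear_combination -e5
    linarith
  refine ⟨rfl, rfl, h4, hab, ?_, ?_, ?_, e2⟩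
  · refine lt_of_le_of_ne h6 ?_
    intro h
    subst h
    have h' : (Rμ - R - 1) * ((β - α) * (β + α)) = 0 := by linear_combination -e2
    have : 0 < (Rμ - R - 1) * ((β - α) * (β + α)) :=
      mul_pos hm (mul_pos (by linarith) (by linarith))
    linarith
  · linear_combination e4 / 2
  · linear_combination e5 / 2
end

section
/- (Lemma A.4) Let R, Rμ, η be positive reals, and let RμM be a real number with RμM > R + 1 satisfying √(RμM − R)·(η² − √((1+R)/RμM)) = 1 + η². Then: (a) if Rμ⁺(R,η) < Rμ < RμM, system (S3) has exactly one solution (γ₁, β₁, α₁, α, β, γ) satisfying γ₁ < β₁ < α₁ < 0 = α < β < γ; (b) if R + 1 < Rμ ≤ Rμ⁺(R,η) or Rμ ≥ RμM, system (S3) has no solution with this property. -/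
noncomputable def auxB (ρ t : ℝ) : ℝ := Real.sqrt (1 - ρ * t ^ 2)
noncomputable def auxC (k t : ℝ) : ℝ := Real.sqrt (k - (k - 1) * t ^ 2)
noncomputable def auxF (k ρ h p t : ℝ) : ℝ :=
  h * ((auxC k t) ^ 3 + (k - 1) * t ^ 3) - (1 + h) * k + ρ * k * t ^ 3 + k * p * (auxB ρ t) ^ 3
noncomputable def auxD (k ρ t : ℝ) : ℝ := k * ((auxB ρ t) ^ 3 + 1) - ρ * k * t ^ 3

lemma aux_tan (x y : ℝ) (hx : 0 ≤ x) (hy : 0 ≤ y) :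
    y ^ 3 + 3 / 2 * y * (x ^ 2 - y ^ 2) ≤ x ^ 3 := by
  nlinarith [mul_nonneg (sq_nonneg (x - y)) (by positivity : 0 ≤ 2 * x + y)]

lemma auxB_sq (ρ t : ℝ) (h1 : ρ < 1) (ht0 : 0 ≤ t) (ht : t ≤ 1) :
    (auxB ρ t) ^ 2 = 1 - ρ * t ^ 2 := by
  unfold auxB
  apply Real.sq_sqrt
  have : t ^ 2 ≤ 1 := by nlinarith
  nlinarith [sq_nonneg t]

lemma auxB_pos (ρ t : ℝ) (h1 : ρ < 1) (ht0 : 0 ≤ t) (ht : t ≤ 1) :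
    0 < auxB ρ t := by
  unfold auxB
  apply Real.sqrt_pos.2
  have : t ^ 2 ≤ 1 := by nlinarith
  rcases le_or_gt ρ 0 with h | h <;> nlinarith [sq_nonneg t]

lemma auxC_sq (k t : ℝ) (h1 : 1 < k) (ht0 : 0 ≤ t) (ht : t ≤ 1) :
    (auxC k t) ^ 2 = k - (k - 1) * t ^ 2 := by
  unfold auxC
  apply Real.sq_sqrt
  have : t ^ 2 ≤ 1 := by nlinarith
  nlinarith [sq_nonneg t]

lemma auxB_nn (ρ t : ℝ) : 0 ≤ auxB ρ t := Real.sqrt_nonneg _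
lemma auxC_nn (k t : ℝ) : 0 ≤ auxC k t := Real.sqrt_nonneg _

/-- no zero when p ≤ 0 -/
lemma auxF_neg (k s ρ h p t : ℝ) (hk : 1 < k) (hs : 0 < s) (hsk : s ^ 2 = k) (hh : 0 < h)
    (hρ0 : 0 < ρ) (hρ : ρ < 1)
    (hp : p = h * s - 1 - h) (hp0 : p ≤ 0) (ht0 : 0 < t) (ht : t < 1) :
    auxF k ρ h p t < 0 := by
  have hC := auxC_sq k t hk ht0.le ht.le
  have hC0 := auxC_nn k t
  have hB0 := auxB_nn ρ t
  unfold auxF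
  set C := auxC k t
  set B := auxB ρ t
  have hs1 : 1 < s := by nlinarith
  have ht2 : t ^ 2 < 1 := by nlinarith
  have hC1 : 1 ≤ C := by nlinarith [mul_pos (sub_pos.2 hk) (sub_pos.2 ht2)]
  have hCs : C ≤ s := by nlinarith [sq_nonneg t]
  -- convexity bound
  have hcv : C ^ 3 + (k - 1) * t ^ 3 ≤ s * k * (1 - t ^ 2) + k * t ^ 2 := by
    have e1 : C ^ 3 = C * (k - (k - 1) * t ^ 2) := by rw [← hC]; ring
    have e2 : C ^ 2 - t ^ 2 = k * (1 - t ^ 2) := by rw [hC]; ring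
    have e3 : C ^ 2 - 1 = (k - 1) * (1 - t ^ 2) := by rw [hC]; ring
    -- C^3 ≤ s^3 (1-u) + u
    have h1 : C ^ 3 ≤ s ^ 3 * (1 - t ^ 2) + t ^ 2 := by
      have q2 : (k - 1) * (s ^ 3 * (1 - t ^ 2) + t ^ 2 - C ^ 3)
          = s ^ 3 * (C ^ 2 - 1) + (s ^ 2 - C ^ 2) - (s ^ 2 - 1) * C ^ 3 := by
        rw [hC, hsk]; nlinarith [hC, hsk]
      have q3 : s ^ 3 * (C ^ 2 - 1) + (s ^ 2 - C ^ 2) - (s ^ 2 - 1) * C ^ 3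
          = (C - 1) * (s - C) * (s - 1) * (s * C + s + C) := by ring
      have q4 : 0 ≤ (C - 1) * (s - C) * (s - 1) * (s * C + s + C) := by
        have := sub_nonneg.2 hC1
        have := sub_nonneg.2 hCs
        have := sub_nonneg.2 hs1.le
        positivity
      by_contra hcon
      push Not at hcon
      nlinarith
    have h2 : t ^ 3 ≤ t ^ 2 := by nlinarith [sq_nonneg t]
    have h3 : s ^ 3 = s * k := by rw [← hsk]; ring
    rw [h3] at h1
    nlinarith
  have h4 : ρ * t ^ 3 < t ^ 2 := by
    have : 0 < t ^ 2 := by positivity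
    have : t ^ 3 ≤ t ^ 2 := by nlinarith [sq_nonneg t]
    nlinarith [pow_pos ht0 3]
  have h5 : p * B ^ 3 ≤ 0 := mul_nonpos_of_nonpos_of_nonneg hp0 (by positivity)
  have h6 : p * (1 - t ^ 2) ≤ 0 := mul_nonpos_of_nonpos_of_nonneg hp0 (by linarith)
  have h7 := mul_le_mul_of_nonneg_left hcv hh.le
  have h8 : h * s = p + 1 + h := by linarith
  have h9 : h * (s * k * (1 - t ^ 2) + k * t ^ 2) = k * ((p + 1 + h) * (1 - t ^ 2) + h * t ^ 2) := by
    rw [← h8]; ring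
  have h10 : k * (p * (1 - t ^ 2) - t ^ 2 + ρ * t ^ 3 + p * B ^ 3) < 0 :=
    mul_neg_of_pos_of_neg (by linarith) (by linarith)
  nlinarith

lemma auxF_one (k ρ h p : ℝ) (hρ : ρ < 1) :
    auxF k ρ h p 1 = k * (auxB ρ 1) ^ 2 * (p * auxB ρ 1 - 1) := by
  have hB := auxB_sq ρ 1 hρ zero_le_one le_rfl
  have : auxC k 1 = 1 := by unfold auxC; norm_num
  have h2 : k * (auxB ρ 1) ^ 2 = k * (1 - ρ) := by rw [hB]; ring
  unfold auxF
  rw [this]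
  linear_combination h2

lemma auxF_pos (k ρ h p t : ℝ) (hk : 1 < k) (hh : 0 < h)
    (hρ0 : 0 < ρ) (hρ : ρ < 1) (hp : 1 ≤ p * auxB ρ 1)
    (ht0 : 0 < t) (ht : t < 1) : 0 < auxF k ρ h p t := by
  have hC := auxC_sq k t hk ht0.le ht.le
  have hC0 := auxC_nn k t
  have hB0 := auxB_nn ρ t
  have hB := auxB_sq ρ t hρ ht0.le ht.le
  have hB1 := auxB_sq ρ 1 hρ zero_le_one le_rfl
  have hB1p := auxB_pos ρ 1 hρ zero_le_one le_rfl
  unfold auxF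
  set C := auxC k t
  set B := auxB ρ t
  set B1 := auxB ρ 1
  have hp0 : 0 < p := by
    by_contra hcon
    push Not at hcon
    nlinarith
  have h1 := aux_tan C 1 hC0 zero_le_one
  have h2 := aux_tan t 1 ht0.le zero_le_one
  have h3 := aux_tan B B1 hB0 hB1p.le
  have h4 : k ≤ C ^ 3 + (k - 1) * t ^ 3 := by nlinarith
  have h5 : 0 ≤ h * (C ^ 3 + (k - 1) * t ^ 3 - k) := mul_nonneg hh.le (by linarith)
  have h6 := mul_le_mul_of_nonneg_left h3 hp0.le
  have h7 : B ^ 2 - B1 ^ 2 = ρ * (1 - t ^ 2) := by rw [hB, hB1]; ring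
  rw [h7] at h6
  have h8 : 0 ≤ (p * B1 - 1) * (B1 ^ 2 + 3 / 2 * (ρ * (1 - t ^ 2))) := by
    apply mul_nonneg (by linarith)
    have : 0 < 1 - t ^ 2 := by nlinarith
    positivity
  have h9 : B1 ^ 2 + 3 / 2 * (ρ * (1 - t ^ 2)) ≤ p * B ^ 3 := by nlinarith
  have h10 : 0 < ρ * ((1 - t) ^ 2 * (1 + 2 * t)) := by
    have : 0 < 1 - t := by linarith
    positivity
  have h11 : 0 < -1 + ρ * t ^ 3 + p * B ^ 3 := by nlinarith
  have h12 : 0 < k * (-1 + ρ * t ^ 3 + p * B ^ 3) := mul_pos (by linarith) h11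
  nlinarith

lemma auxF_tan (k ρ h p x y : ℝ) (hk : 1 < k) (hh : 0 < h)
    (hρ0 : 0 < ρ) (hρ : ρ < 1) (hp : 0 ≤ p)
    (hx0 : 0 ≤ x) (hx : x ≤ 1) (hy0 : 0 ≤ y) (hy : y ≤ 1) :
    auxF k ρ h p y + 3 / 2 * (-(h * (k - 1) * (auxC k y - y)) + ρ * k * y
      - ρ * k * p * auxB ρ y) * (x ^ 2 - y ^ 2) ≤ auxF k ρ h p x := by
  have hCx := auxC_sq k x hk hx0 hx
  have hCy := auxC_sq k y hk hy0 hy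
  have hBx := auxB_sq ρ x hρ hx0 hx
  have hBy := auxB_sq ρ y hρ hy0 hy
  have h1 := aux_tan _ _ (auxC_nn k x) (auxC_nn k y)
  have h2 := aux_tan _ _ (auxB_nn ρ x) (auxB_nn ρ y)
  have h3 := aux_tan _ _ hx0 hy0
  rw [hCx, hCy] at h1
  rw [hBx, hBy] at h2
  have g1 := mul_le_mul_of_nonneg_left h1 hh.le
  have g2 := mul_le_mul_of_nonneg_left h2 (mul_nonneg (by linarith : 0 ≤ k) hp)
  have g3 := mul_le_mul_of_nonneg_left h3
    (add_nonneg (mul_nonneg hh.le (by linarith : 0 ≤ k - 1)) (mul_nonneg hρ0.le (by linarith : 0 ≤ k)))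
  unfold auxF
  linear_combination g1 + g2 + g3

lemma auxF_uniq_lt (k ρ h p x y : ℝ) (hk : 1 < k) (hh : 0 < h)
    (hρ0 : 0 < ρ) (hρ : ρ < 1) (hp : 0 ≤ p) (h1 : auxF k ρ h p 1 < 0)
    (hx0 : 0 < x) (hy : y < 1) (hxy : x < y)
    (hFx : auxF k ρ h p x = 0) (hFy : auxF k ρ h p y = 0) : False := by
  have a := auxF_tan k ρ h p x y hk hh hρ0 hρ hp hx0.le (by linarith) (by linarith) hy.le
  have b := auxF_tan k ρ h p 1 y hk hh hρ0 hρ hp zero_le_one le_rfl (by linarith) hy.le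
  rw [hFx, hFy] at a
  rw [hFy] at b
  set m := 3 / 2 * (-(h * (k - 1) * (auxC k y - y)) + ρ * k * y
      - ρ * k * p * auxB ρ y)
  have c : x ^ 2 - y ^ 2 < 0 := by nlinarith
  have d : 0 < 1 ^ 2 - y ^ 2 := by nlinarith
  have e : m < 0 := by
    by_contra hcon
    push Not at hcon
    nlinarith [mul_nonneg hcon d.le]
  nlinarith [mul_pos_of_neg_of_neg e c]

lemma auxF_uniq (k ρ h p x y : ℝ) (hk : 1 < k) (hh : 0 < h)
    (hρ0 : 0 < ρ) (hρ : ρ < 1) (hp : 0 ≤ p) (h1 : auxF k ρ h p 1 < 0)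
    (hx0 : 0 < x) (hx : x < 1) (hy0 : 0 < y) (hy : y < 1)
    (hFx : auxF k ρ h p x = 0) (hFy : auxF k ρ h p y = 0) : x = y := by
  rcases lt_trichotomy x y with h' | h' | h'
  · exact (auxF_uniq_lt k ρ h p x y hk hh hρ0 hρ hp h1 hx0 hy h' hFx hFy).elim
  · exact h'
  · exact (auxF_uniq_lt k ρ h p y x hk hh hρ0 hρ hp h1 hy0 hx h' hFy hFx).elim

lemma auxF_ex (k ρ h p : ℝ) (h0 : 0 < auxF k ρ h p 0) (h1 : auxF k ρ h p 1 < 0) :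
    ∃ t, 0 < t ∧ t < 1 ∧ auxF k ρ h p t = 0 := by
  have hc : ContinuousOn (auxF k ρ h p) (Set.Icc 0 1) := by
    apply Continuous.continuousOn
    unfold auxF auxB auxC
    fun_prop
  have := intermediate_value_Ioo' (zero_le_one) hc
  obtain ⟨t, ht, hF⟩ := this ⟨h1, h0⟩
  exact ⟨t, ht.1, ht.2, hF⟩

lemma aux_norm (R Rμ η s ρ k p γ₁ β₁ α₁ α β γ : ℝ) (hR : 0 < R)
    (hkd : k = Rμ - R) (hk : 1 < k) (hs : 0 < s) (hsk : s ^ 2 = k)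
    (hρd : ρ * k = R * (k - 1) / (1 + R)) (hρ : ρ < 1)
    (hp : p = η ^ 2 * s - 1 - η ^ 2)
    (h1 : γ₁ < β₁) (h2 : β₁ < α₁) (h3 : α₁ < 0) (h4 : α = 0) (h5 : 0 < β) (h6 : β < γ)
    (hS : SystemS3 R Rμ η γ₁ β₁ α₁ α β γ) :
    ∃ t b, 0 < t ∧ t < 1 ∧ 0 < b ∧ β₁ = -b ∧ α₁ = -(t * b) ∧ γ₁ = -(auxC k t * b) ∧
      β = auxB ρ t * b ∧ γ = s * (auxB ρ t * b) ∧ b ^ 3 * auxD k ρ t = 9 * η ^ 2 * Rμ ∧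
      auxF k ρ (η ^ 2) p t = 0 := by
  subst h4
  have hb : 0 < -β₁ := by linarith
  obtain ⟨b, rfl⟩ : ∃ b, β₁ = -b := ⟨-β₁, by ring⟩
  rw [neg_neg] at hb
  obtain ⟨t, rfl⟩ : ∃ t, α₁ = -(t * b) := ⟨-α₁ / b, by field_simp⟩
  have ht0 : 0 < t := by
    by_contra hcon
    push Not at hcon
    nlinarith
  have ht1 : t < 1 := by
    by_contra hcon
    push Not at hcon
    nlinarith
  obtain ⟨e1, e2, e3, e4, e5⟩ := hS
  rw [← hkd] at e1 e2 e3 e4 e5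
  rw [← hρd] at e4
  have hC := auxC_sq k t hk ht0.le ht1.le
  have hC0 := auxC_nn k t
  have hBp := auxB_pos ρ t hρ ht0.le ht1.le
  have hB := auxB_sq ρ t hρ ht0.le ht1.le
  have hk0 : 0 < k := by linarith
  have E1 : γ₁ = -(auxC k t * b) := by
    have : (-γ₁) ^ 2 = (auxC k t * b) ^ 2 := by rw [mul_pow, hC]; linarith
    have := (pow_left_inj₀ (by linarith) (by positivity) two_ne_zero).1 this
    linarith
  have hρd' : ρ * k * (1 + R) = R * (k - 1) := by rw [hρd]; field_simp
  have E2 : β = auxB ρ t * b := by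
    have e : k * (1 + R) * β ^ 2 = k * (1 + R) * (auxB ρ t * b) ^ 2 := by
      rw [mul_pow, hB]
      linear_combination (-1) * e3 + R * e1 - R * e2 + t ^ 2 * b ^ 2 * hρd'
    have := mul_left_cancel₀ (by positivity) e
    exact (pow_left_inj₀ (by linarith) (by positivity) two_ne_zero).1 this
  have E3 : γ = s * (auxB ρ t * b) := by
    rw [← E2]
    have : γ ^ 2 = (s * β) ^ 2 := by rw [mul_pow, hsk]; linarith
    exact (pow_left_inj₀ (by linarith) (by positivity) two_ne_zero).1 this
  refine ⟨t, b, ht0, ht1, hb, rfl, rfl, E1, E2, E3, ?_, ?_⟩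
  · rw [E2] at e4
    unfold auxD
    linear_combination e4
  · rw [E1, E2, E3] at e5
    rw [E2] at e4
    have : b ^ 3 * auxF k ρ (η ^ 2) p t = 0 := by
      unfold auxF
      rw [hp]
      linear_combination (η ^ 2) * e5 - e4 - η ^ 2 * s * (auxB ρ t) ^ 3 * b ^ 3 * hsk
    exact (mul_eq_zero.1 this).resolve_left (by positivity)

lemma aux_conv (R Rμ η s ρ k p t b : ℝ) (hR : 0 < R) (hη : 0 < η)
    (hkd : k = Rμ - R) (hk : 1 < k) (hs : 0 < s) (hsk : s ^ 2 = k)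
    (hρd : ρ * k = R * (k - 1) / (1 + R)) (hρ : ρ < 1)
    (hp : p = η ^ 2 * s - 1 - η ^ 2)
    (ht0 : 0 < t) (ht1 : t < 1) (hb : 0 < b) (hD : b ^ 3 * auxD k ρ t = 9 * η ^ 2 * Rμ)
    (hF : auxF k ρ (η ^ 2) p t = 0) :
    -(auxC k t * b) < -b ∧ -b < -(t * b) ∧ -(t * b) < 0 ∧ (0:ℝ) = 0 ∧ 0 < auxB ρ t * b ∧
    auxB ρ t * b < s * (auxB ρ t * b) ∧
    SystemS3 R Rμ η (-(auxC k t * b)) (-b) (-(t * b)) 0 (auxB ρ t * b) (s * (auxB ρ t * b)) := by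
  have hC := auxC_sq k t hk ht0.le ht1.le
  have hC0 := auxC_nn k t
  have hBp := auxB_pos ρ t hρ ht0.le ht1.le
  have hB := auxB_sq ρ t hρ ht0.le ht1.le
  have hk0 : 0 < k := by linarith
  have hC1 : 1 < auxC k t := by
    have : t ^ 2 < 1 := by nlinarith
    nlinarith [mul_pos (sub_pos.2 hk) (sub_pos.2 this)]
  have hs1 : 1 < s := by nlinarith
  have hBb : 0 < auxB ρ t * b := by positivity
  have hρd' : ρ * k * (1 + R) = R * (k - 1) := by rw [hρd]; field_simp
  unfold auxD at hD
  unfold auxF at hF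
  rw [hp] at hF
  refine ⟨by nlinarith, by nlinarith, by nlinarith [mul_pos ht0 hb], rfl, hBb, by nlinarith, ?_⟩
  unfold SystemS3
  rw [← hkd, ← hρd]
  refine ⟨?_, ?_, ?_, ?_, ?_⟩
  · linear_combination b ^ 2 * hC
  · linear_combination (auxB ρ t * b) ^ 2 * hsk
  · linear_combination R * b ^ 2 * hC - R * (auxB ρ t * b) ^ 2 * hsk
      - k * (1 + R) * b ^ 2 * hB + b ^ 2 * t ^ 2 * hρd'
  · linear_combination hD
  · have h0 : η ^ 2 ≠ 0 := by positivity
    apply mul_left_cancel₀ h0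
    linear_combination hD + b ^ 3 * hF + η ^ 2 * s * (auxB ρ t) ^ 3 * b ^ 3 * hsk

lemma auxD_pos (k ρ t : ℝ) (hk : 1 < k) (hρ0 : 0 < ρ) (hρ : ρ < 1) (ht0 : 0 < t) (ht1 : t < 1) :
    0 < auxD k ρ t := by
  unfold auxD
  have h0 := auxB_nn ρ t
  have : t ^ 3 < 1 := pow_lt_one₀ ht0.le ht1 (by norm_num)
  have h2 : ρ * t ^ 3 < 1 := by nlinarith [pow_pos ht0 3]
  have h3 : 0 < k * ((auxB ρ t) ^ 3 + (1 - ρ * t ^ 3)) := by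
    have : 0 < 1 - ρ * t ^ 3 := by linarith
    positivity
  linarith

/-- Lemma A.4: with `RμM` the threshold solving `√(RμM−R)(η² − √((1+R)/RμM)) = 1+η²`,
system (S3) has exactly one solution with `γ₁ < β₁ < α₁ < 0 = α < β < γ` when
`Rμ⁺(R,η) < Rμ < RμM`, and none when `R + 1 < Rμ ≤ Rμ⁺(R,η)` or `Rμ ≥ RμM`. -/
theorem systemS3_alpha_zero_solvability (R Rμ η RμM : ℝ)
    (hR : 0 < R) (hRμ : 0 < Rμ) (hη : 0 < η)
    (hM1 : R + 1 < RμM)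
    (hM2 : Real.sqrt (RμM - R) * (η ^ 2 - Real.sqrt ((1 + R) / RμM)) = 1 + η ^ 2) :
    (R + ((1 + η ^ 2) / η ^ 2) ^ 2 < Rμ → Rμ < RμM →
      ∃! q : ℝ × ℝ × ℝ × ℝ × ℝ × ℝ,
        q.1 < q.2.1 ∧ q.2.1 < q.2.2.1 ∧ q.2.2.1 < 0 ∧ q.2.2.2.1 = 0 ∧
        0 < q.2.2.2.2.1 ∧ q.2.2.2.2.1 < q.2.2.2.2.2 ∧
        SystemS3 R Rμ η q.1 q.2.1 q.2.2.1 q.2.2.2.1 q.2.2.2.2.1 q.2.2.2.2.2) ∧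
    ((R + 1 < Rμ ∧ Rμ ≤ R + ((1 + η ^ 2) / η ^ 2) ^ 2) ∨ RμM ≤ Rμ →
      ¬ ∃ γ₁ β₁ α₁ α β γ : ℝ,
        γ₁ < β₁ ∧ β₁ < α₁ ∧ α₁ < 0 ∧ α = 0 ∧ 0 < β ∧ β < γ ∧
        SystemS3 R Rμ η γ₁ β₁ α₁ α β γ) := by
  have hη2 : 0 < η ^ 2 := by positivity
  have hM0 : 0 < RμM := by linarith
  have hsM : 0 < Real.sqrt (RμM - R) := Real.sqrt_pos.2 (by linarith)
  have hfM : 0 < η ^ 2 - Real.sqrt ((1 + R) / RμM) := by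
    by_contra hcon
    push Not at hcon
    nlinarith [mul_nonneg hsM.le (sub_nonneg.2 hcon)]
  -- common setup
  have setup : R + 1 < Rμ → ∃ k s ρ p : ℝ, k = Rμ - R ∧ 1 < k ∧ 0 < s ∧ s ^ 2 = k ∧
      s = Real.sqrt (Rμ - R) ∧
      ρ * k = R * (k - 1) / (1 + R) ∧ 0 < ρ ∧ ρ < 1 ∧ p = η ^ 2 * s - 1 - η ^ 2 ∧
      auxB ρ 1 * (s * Real.sqrt ((1 + R) / Rμ)) = 1 := by
    intro hlt
    have hk : 0 < Rμ - R := by linarith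
    have hρ1 : R * (Rμ - R - 1) / (1 + R) / (Rμ - R) < 1 := by
      rw [div_div, div_lt_one (by positivity)]
      nlinarith
    refine ⟨Rμ - R, Real.sqrt (Rμ - R), R * (Rμ - R - 1) / (1 + R) / (Rμ - R), _, rfl,
      by linarith, Real.sqrt_pos.2 hk, Real.sq_sqrt hk.le, rfl, by field_simp, ?_, hρ1, rfl, ?_⟩
    · have : 0 < Rμ - R - 1 := by linarith
      positivity
    · have hB := auxB_sq _ 1 hρ1 zero_le_one le_rfl
      have hBp := auxB_pos _ 1 hρ1 zero_le_one le_rfl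
      rw [← pow_left_inj₀ (by positivity) zero_le_one two_ne_zero, mul_pow, mul_pow, hB,
        Real.sq_sqrt hk.le, Real.sq_sqrt (by positivity)]
      field_simp
      ring
  constructor
  · intro hlo hhi
    have hq : 1 < (1 + η ^ 2) / η ^ 2 := by rw [one_lt_div hη2]; linarith
    have hlt : R + 1 < Rμ := by nlinarith
    obtain ⟨k, s, ρ, p, hkd, hk, hs, hsk, hsd, hρd, hρ0, hρ, hp, hB1⟩ := setup hlt
    have hp0 : 0 < p := by
      have : (1 + η ^ 2) / η ^ 2 < s := by
        apply lt_of_pow_lt_pow_left₀ 2 hs.le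
        rw [hsk, hkd]; linarith
      rw [div_lt_iff₀ hη2] at this
      rw [hp]; linarith
    have hBp := auxB_pos ρ 1 hρ zero_le_one le_rfl
    have hF1 : auxF k ρ (η ^ 2) p 1 < 0 := by
      rw [auxF_one k ρ _ p hρ]
      apply mul_neg_of_pos_of_neg (by positivity)
      have hr : Real.sqrt ((1 + R) / RμM) < Real.sqrt ((1 + R) / Rμ) := by
        apply Real.sqrt_lt_sqrt (by positivity)
        apply div_lt_div_of_pos_left (by positivity) hRμ hhi
      have hss : s ≤ Real.sqrt (RμM - R) := by
        rw [hsd]; exact Real.sqrt_le_sqrt (by linarith)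
      have : p < s * Real.sqrt ((1 + R) / Rμ) := by
        have a := mul_lt_mul_of_pos_left hr hs
        have b := mul_le_mul_of_nonneg_right hss hfM.le
        rw [hp]; nlinarith
      have := mul_lt_mul_of_pos_right this hBp
      linarith
    have hF0 : 0 < auxF k ρ (η ^ 2) p 0 := by
      have c0 : auxC k 0 = s := by
        unfold auxC
        rw [← hsk]
        simp [Real.sqrt_sq hs.le]
      have b0 : auxB ρ 0 = 1 := by unfold auxB; simp
      unfold auxF
      rw [c0, b0]
      have : η ^ 2 * (s ^ 3 + (k - 1) * 0 ^ 3) - (1 + η ^ 2) * k + ρ * k * 0 ^ 3 + k * p * 1 ^ 3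
          = 2 * k * p := by
        rw [hp, ← hsk]; ring
      rw [this]; positivity
    obtain ⟨t, ht0, ht1, hFt⟩ := auxF_ex k ρ _ p hF0 hF1
    have hDp := auxD_pos k ρ t hk hρ0 hρ ht0 ht1
    obtain ⟨b, hb, hbD⟩ : ∃ b : ℝ, 0 < b ∧ b ^ 3 = 9 * η ^ 2 * Rμ / auxD k ρ t := by
      have hpos : 0 < 9 * η ^ 2 * Rμ / auxD k ρ t := by positivity
      refine ⟨(9 * η ^ 2 * Rμ / auxD k ρ t) ^ ((3 : ℕ) : ℝ)⁻¹, by positivity, ?_⟩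
      exact Real.rpow_inv_natCast_pow hpos.le (by norm_num)
    have hbD' : b ^ 3 * auxD k ρ t = 9 * η ^ 2 * Rμ := by rw [hbD]; field_simp
    refine ⟨(-(auxC k t * b), -b, -(t * b), 0, auxB ρ t * b, s * (auxB ρ t * b)), ?_, ?_⟩
    · exact aux_conv R Rμ η s ρ k p t b hR hη hkd hk hs hsk hρd hρ hp ht0 ht1 hb hbD' hFt
    · rintro ⟨γ₁, β₁, α₁, α, β, γ⟩ ⟨h1, h2, h3, h4, h5, h6, hS⟩
      simp only at h1 h2 h3 h4 h5 h6 hS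
      obtain ⟨t', b', ht0', ht1', hb', e1, e2, e3, e4, e5, hD', hF'⟩ :=
        aux_norm R Rμ η s ρ k p γ₁ β₁ α₁ α β γ hR hkd hk hs hsk hρd hρ hp h1 h2 h3 h4 h5 h6 hS
      have ht : t' = t := auxF_uniq k ρ _ p t' t hk hη2 hρ0 hρ hp0.le hF1 ht0' ht1' ht0 ht1 hF' hFt
      subst ht
      have hbb : b' = b := by
        have : b' ^ 3 = b ^ 3 := mul_right_cancel₀ hDp.ne' (hD'.trans hbD'.symm)
        exact (pow_left_inj₀ hb'.le hb.le (by norm_num)).1 this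
      subst hbb
      rw [e1, e2, e3, e4, e5, h4]
  · rintro hcase ⟨γ₁, β₁, α₁, α, β, γ, h1, h2, h3, h4, h5, h6, hS⟩
    have hlt : R + 1 < Rμ := by
      rcases hcase with h | h
      · exact h.1
      · linarith
    obtain ⟨k, s, ρ, p, hkd, hk, hs, hsk, hsd, hρd, hρ0, hρ, hp, hB1⟩ := setup hlt
    obtain ⟨t, b, ht0, ht1, hb, -, -, -, -, -, -, hF⟩ :=
      aux_norm R Rμ η s ρ k p γ₁ β₁ α₁ α β γ hR hkd hk hs hsk hρd hρ hp h1 h2 h3 h4 h5 h6 hS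
    rcases hcase with ⟨-, h⟩ | h
    · have hp0 : p ≤ 0 := by
        have : s ≤ (1 + η ^ 2) / η ^ 2 := by
          apply (pow_le_pow_iff_left₀ hs.le (by positivity) two_ne_zero).1
          rw [hsk, hkd]; linarith
        rw [le_div_iff₀ hη2] at this
        rw [hp]; linarith
      have := auxF_neg k s ρ _ p t hk hs hsk hη2 hρ0 hρ hp hp0 ht0 ht1
      linarith
    · have hBp := auxB_pos ρ 1 hρ zero_le_one le_rfl
      have hr : Real.sqrt ((1 + R) / Rμ) ≤ Real.sqrt ((1 + R) / RμM) := by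
        apply Real.sqrt_le_sqrt
        apply div_le_div_of_nonneg_left (by positivity) hM0 h
      have hss : Real.sqrt (RμM - R) ≤ s := by
        rw [hsd]; exact Real.sqrt_le_sqrt (by linarith)
      have : s * Real.sqrt ((1 + R) / Rμ) ≤ p := by
        have a := mul_le_mul_of_nonneg_left hr hs.le
        have b := mul_le_mul_of_nonneg_right hss hfM.le
        rw [hp]; nlinarith
      have := mul_le_mul_of_nonneg_right this hBp.le
      have := auxF_pos k ρ _ p t hk hη2 hρ0 hρ (by linarith) ht0 ht1
      linarith
end

section
/- (Lemma 3.8) Let R, Rμ, η be positive reals with R + 1 < Rμ ≤ Rμ⁺(R,η). Then system (S3) has no solution (γ₁, β₁, α₁, α, β, γ) satisfying both γ₁ < β₁ < α₁ ≤ 0 ≤ α < β < γ and α₁ ≠ −α. -/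
theorem half_le (t a b c : ℝ) (ht : 1 < t) (ha : 0 ≤ a) (hab : a < b) (hbc : b < c)
    (h : c ^ 2 - t ^ 2 * b ^ 2 + (t ^ 2 - 1) * a ^ 2 = 0) :
    c ^ 3 + t * (t ^ 2 - 1) * a ^ 3 ≤ t ^ 3 * b ^ 3 ∧
    (0 < a → c ^ 3 + t * (t ^ 2 - 1) * a ^ 3 < t ^ 3 * b ^ 3) := by
  have hb : 0 < b := by linarith
  have hc : 0 < c := by linarith
  have ht0 : 0 < t := by linarith
  have hs : 0 < c + t * b := by positivity
  have ht2 : 0 < t ^ 2 - 1 := by nlinarith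
  have hW : 0 < c ^ 2 + t * c * (b - a) + t ^ 2 * b * (b - a) := by
    have : 0 < b - a := by linarith
    positivity
  have key : (c + t * b) * (t ^ 3 * b ^ 3 - (c ^ 3 + t * (t ^ 2 - 1) * a ^ 3))
      = (t ^ 2 - 1) * a ^ 2 * (c ^ 2 + t * c * (b - a) + t ^ 2 * b * (b - a)) := by
    linear_combination (-(c ^ 2 + t * c * b + t ^ 2 * b ^ 2)) * h
  constructor
  · have h1 : 0 ≤ (c + t * b) * (t ^ 3 * b ^ 3 - (c ^ 3 + t * (t ^ 2 - 1) * a ^ 3)) := by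
      rw [key]; positivity
    linarith [nonneg_of_mul_nonneg_right h1 hs]
  · intro ha'
    have h1 : 0 < (c + t * b) * (t ^ 3 * b ^ 3 - (c ^ 3 + t * (t ^ 2 - 1) * a ^ 3)) := by
      rw [key]; positivity
    linarith [(mul_pos_iff_of_pos_left hs).1 h1]

/-- Lemma 3.8: for `R + 1 < Rμ ≤ Rμ⁺(R,η)`, system (S3) has no non-symmetric ordered
solution, i.e. no solution with `γ₁ < β₁ < α₁ ≤ 0 ≤ α < β < γ` and `α₁ ≠ −α`. -/
theorem systemS3_no_nonsymmetric (R Rμ η : ℝ)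
    (hR : 0 < R) (hRμ : 0 < Rμ) (hη : 0 < η)
    (hgt : R + 1 < Rμ) (hle : Rμ ≤ R + ((1 + η ^ 2) / η ^ 2) ^ 2) :
    ¬ ∃ γ₁ β₁ α₁ α β γ : ℝ,
      γ₁ < β₁ ∧ β₁ < α₁ ∧ α₁ ≤ 0 ∧ 0 ≤ α ∧ α < β ∧ β < γ ∧ α₁ ≠ -α ∧
      SystemS3 R Rμ η γ₁ β₁ α₁ α β γ := by
  rintro ⟨γ₁, β₁, α₁, α, β, γ, h1, h2, h3, h4, h5, h6, h7, e1, e2, -, e4, e5⟩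
  obtain ⟨t, ht, hK⟩ : ∃ t : ℝ, 1 < t ∧ Rμ - R = t ^ 2 :=
    ⟨√(Rμ - R), by rw [Real.lt_sqrt (by norm_num)]; linarith,
      (Real.sq_sqrt (by linarith)).symm⟩
  rw [hK] at e1 e2 e4 e5
  have hη2 : 0 < η ^ 2 := by positivity
  have htle : t ≤ (1 + η ^ 2) / η ^ 2 :=
    by
    refine (pow_le_pow_iff_left₀ (by linarith) (by positivity) two_ne_zero).1 ?_
    linarith
  rw [le_div_iff₀ hη2] at htle
  have ht2 : 0 < t ^ 2 - 1 := by nlinarith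
  have A0 : 0 ≤ α ^ 3 - α₁ ^ 3 := by
    have : 0 ≤ (-α₁) ^ 3 := pow_nonneg (by linarith) 3
    have := pow_nonneg h4 3
    nlinarith
  have hq : R * (t ^ 2 - 1) / (1 + R) ≤ t ^ 2 - 1 := by
    rw [div_le_iff₀ (by linarith)]; nlinarith
  have hqA := mul_le_mul_of_nonneg_right hq A0
  have hqA' := mul_le_mul_of_nonneg_left hqA (by linarith : (0 : ℝ) ≤ t - 1)
  have hlow : (t - 1) * (9 * η ^ 2 * Rμ) ≤ 9 * Rμ := by nlinarith
  rw [← e4, ← e5] at hlow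
  have L1 := half_le t α β γ ht h4 h5 h6 e2
  have L2 := half_le t (-α₁) (-β₁) (-γ₁) ht (by linarith) (by linarith) (by linarith)
    (by linear_combination e1)
  have hmain : t ^ 3 * β ^ 3 + t ^ 3 * (-β₁) ^ 3 ≤
      γ ^ 3 + t * (t ^ 2 - 1) * α ^ 3 + ((-γ₁) ^ 3 + t * (t ^ 2 - 1) * (-α₁) ^ 3) := by
    linarith
  rcases h4.lt_or_eq with ha | ha
  · linarith [L1.2 ha, L2.1]
  · have : 0 < -α₁ := by
      rcases h3.lt_or_eq with hb | hb
      · linarith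
      · exact absurd (by rw [hb, ← ha]; simp) h7
    linarith [L1.1, L2.2 this]
end
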